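/- Assume that every nontrivial zero of the Riemann zeta function has real part 1/2 and that the set of ordinates of ζ (the positive imaginary parts of its nontrivial zeros) is linearly independent over ℚ. Then the limit δ = lim_{X→∞} (1/log X) · ∫_{t ∈ [2,X], π(t) > Li(t)} dt/t exists, and 0 < δ < 1/2. -/

import Mathlib

open Filter MeasureTheory

/-- `π(x)`: the number of primes `p ≤ x`. -/
noncomputable def primePi (x : ℝ) : ℕ := Nat.primeCounting ⌊x⌋₊

/-- `Li(x) = ∫₂ˣ dt / log t`. -/
noncomputable def Li (x : ℝ) : ℝ := ∫ t in (2:ℝ)..x, 1 / Real.log t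

/-- The set of ordinates of the Riemann zeta function: positive imaginary parts of
nontrivial zeros. -/
def zetaOrdinates : Set ℝ :=
  {t : ℝ | 0 < t ∧ ∃ ρ : ℂ, riemannZeta ρ = 0 ∧ 0 < ρ.re ∧ ρ.re < 1 ∧ ρ.im = t}

section ZetaBounds
open Complex Set

/-- The fractional part on `(1, ∞)`, extended by zero. -/
noncomputable def fractAboveOne (x : ℝ) : ℂ := (Ioi (1 : ℝ)).indicator (fun x ↦ ((Int.fract x : ℝ) : ℂ)) x

lemma norm_fractAboveOne_le (x : ℝ) : ‖fractAboveOne x‖ ≤ 1 := by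
  unfold fractAboveOne
  by_cases hx : x ∈ Ioi (1 : ℝ)
  · rw [indicator_of_mem hx, norm_real, Real.norm_eq_abs, abs_of_nonneg (Int.fract_nonneg x)]
    exact (Int.fract_lt_one x).le
  · rw [indicator_of_notMem hx]; simp

lemma measurable_fractAboveOne : Measurable fractAboveOne := by
  unfold fractAboveOne
  exact (measurable_ofReal.comp measurable_fract).indicator measurableSet_Ioi

lemma locallyIntegrableOn_fractAboveOne : LocallyIntegrableOn fractAboveOne (Ioi 0) := by
  have h : LocallyIntegrable (fun _ : ℝ ↦ (1 : ℝ)) := locallyIntegrable_const 1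
  refine (LocallyIntegrable.mono h measurable_fractAboveOne.aestronglyMeasurable ?_).locallyIntegrableOn _
  filter_upwards with x
  simpa using norm_fractAboveOne_le x

lemma fractAboveOne_isBigO_atTop : fractAboveOne =O[atTop] (fun x : ℝ ↦ x ^ (-(0 : ℝ))) := by
  refine Asymptotics.IsBigO.of_bound 1 ?_
  filter_upwards with x
  simpa using norm_fractAboveOne_le x

lemma fractAboveOne_isBigO_zero (b : ℝ) :
    fractAboveOne =O[nhdsWithin 0 (Ioi 0)] (fun x : ℝ ↦ x ^ (-b)) := by
  refine Asymptotics.IsBigO.of_bound 1 ?_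
  filter_upwards [mem_nhdsWithin_of_mem_nhds (Iio_mem_nhds (zero_lt_one))] with x hx
  have : fractAboveOne x = 0 := indicator_of_notMem (by simpa using (le_of_lt hx)) _
  rw [this]; simp

lemma mellin_fractAboveOne (s : ℂ) :
    mellin fractAboveOne (-s) = ∫ t in Ioi (1 : ℝ), (t : ℂ) ^ (-(s + 1)) * ((Int.fract t : ℝ) : ℂ) := by
  unfold mellin
  have h : ∀ t : ℝ, (t : ℂ) ^ (-s - 1) • fractAboveOne t =
      (Ioi (1 : ℝ)).indicator (fun t ↦ (t : ℂ) ^ (-(s + 1)) * ((Int.fract t : ℝ) : ℂ)) t := by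
    intro t
    unfold fractAboveOne
    by_cases ht : t ∈ Ioi (1 : ℝ)
    · rw [indicator_of_mem ht, indicator_of_mem ht, smul_eq_mul]; congr 2; ring
    · rw [indicator_of_notMem ht, indicator_of_notMem ht, smul_zero]
  simp_rw [h]
  rw [setIntegral_indicator measurableSet_Ioi]
  congr 2
  ext x; simp

lemma differentiableAt_mellin_fractAboveOne {s : ℂ} (hs : 0 < s.re) :
    DifferentiableAt ℂ (fun s ↦ mellin fractAboveOne (-s)) s := by
  have := mellin_differentiableAt_of_isBigO_rpow (s := -s) (b := -s.re - 1)
    locallyIntegrableOn_fractAboveOne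
    fractAboveOne_isBigO_atTop (by simpa using hs) (fractAboveOne_isBigO_zero _) (by simp)
  exact this.comp s differentiableAt_id.neg

lemma integrableOn_cpow_mul_fract {s : ℂ} (hs : 0 < s.re) :
    IntegrableOn (fun t : ℝ ↦ (t : ℂ) ^ (-(s + 1)) * ((Int.fract t : ℝ) : ℂ)) (Ioi 1) := by
  have h1 : IntegrableOn (fun t : ℝ ↦ (t : ℂ) ^ (-(s + 1))) (Ioi 1) :=
    integrableOn_Ioi_cpow_of_lt (by simp; linarith) one_pos
  refine Integrable.mono h1 (h1.aestronglyMeasurable.mul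
    (measurable_ofReal.comp measurable_fract).aestronglyMeasurable) ?_
  filter_upwards with t
  rw [norm_mul]
  refine mul_le_of_le_one_right (norm_nonneg _) ?_
  rw [norm_real, Real.norm_eq_abs, abs_of_nonneg (Int.fract_nonneg t)]
  exact (Int.fract_lt_one t).le

lemma riemannZeta_eq_of_one_lt_re {s : ℂ} (hs : 1 < s.re) :
    riemannZeta s = s * (1 / (s - 1) - mellin fractAboveOne (-s)) := by
  have h0 : (fun n : ℕ ↦ ∑ k ∈ Finset.Icc 1 n, (1 : ℝ)) =O[atTop] fun n ↦ (n : ℝ) ^ (1 : ℝ) := by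
    simpa using Asymptotics.isBigO_refl _ _
  have h1 := LSeries_eq_mul_integral_of_nonneg (fun _ ↦ 1) (zero_le_one) hs h0 (by simp)
  have h2 : LSeries (fun _ ↦ ((1 : ℝ) : ℂ)) s = riemannZeta s := by
    rw [← LSeries_one_eq_riemannZeta hs]; congr 1
  rw [← h2, h1, mellin_fractAboveOne]
  congr 1
  have h3 : ∫ t in Ioi (1 : ℝ), (t : ℂ) ^ (-s) = 1 / (s - 1) := by
    rw [integral_Ioi_cpow_of_lt (by simpa using hs) one_pos]
    have : s - 1 ≠ 0 := fun h ↦ by rw [sub_eq_zero.mp h] at hs; simp at hs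
    have h' : -s + 1 ≠ 0 := fun h ↦ this (by linear_combination -h)
    simp; field_simp
    ring
  rw [← h3, ← integral_sub]
  · refine setIntegral_congr_fun measurableSet_Ioi fun t ht ↦ ?_
    have ht0 : (0 : ℝ) < t := one_pos.trans ht
    have hf : ((⌊t⌋₊ : ℝ) : ℂ) = t - ((Int.fract t : ℝ) : ℂ) := by
      have := natCast_floor_eq_intCast_floor (R := ℝ) ht0.le
      rw [← ofReal_sub, this]; congr 1; linarith [Int.self_sub_floor t]
    simp only [Finset.sum_const, Nat.card_Icc]
    have : (t : ℂ) ^ (-s) = t * (t : ℂ) ^ (-(s + 1)) := by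
      have := cpow_add (x := (t : ℂ)) 1 (-(s+1)) (by exact_mod_cast ht0.ne')
      rw [cpow_one] at this
      rw [← this]; congr 1; ring
    rw [this]
    have hf' : (⌊t⌋₊ : ℂ) = t - ((Int.fract t : ℝ) : ℂ) := by exact_mod_cast hf
    simp [hf']; ring
  · exact integrableOn_Ioi_cpow_of_lt (by simpa using hs) one_pos
  · exact integrableOn_cpow_mul_fract (by linarith)

/-- The classical continuation of `(s - 1) ζ(s)` to `Re s > 0`. -/
lemma riemannZeta₁_eq {s : ℂ} (hs : 0 < s.re) :
    riemannZeta₁ s = s - s * (s - 1) * mellin fractAboveOne (-s) := by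
  have hU : IsOpen {s : ℂ | 0 < s.re} := isOpen_lt continuous_const continuous_re
  have hconn : IsPreconnected {s : ℂ | 0 < s.re} := (convex_halfSpace_re_gt 0).isPreconnected
  have hf : AnalyticOnNhd ℂ riemannZeta₁ {s : ℂ | 0 < s.re} :=
    (differentiable_riemannZeta₁.differentiableOn).analyticOnNhd hU
  have hg : AnalyticOnNhd ℂ (fun s ↦ s - s * (s - 1) * mellin fractAboveOne (-s))
      {s : ℂ | 0 < s.re} := by
    refine DifferentiableOn.analyticOnNhd (fun z hz ↦ ?_) hU
    have := differentiableAt_mellin_fractAboveOne hz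
    exact (DifferentiableAt.sub (by fun_prop) (DifferentiableAt.mul (by fun_prop) this)).differentiableWithinAt
  refine hf.eqOn_of_preconnected_of_eventuallyEq hg hconn (z₀ := 2) (by simp) ?_ hs
  have hV : {s : ℂ | 1 < s.re} ∈ nhds (2 : ℂ) :=
    (isOpen_lt continuous_const continuous_re).mem_nhds (by simp)
  filter_upwards [hV] with z hz
  have hz1 : z - 1 ≠ 0 := fun h ↦ by rw [sub_eq_zero.mp h] at hz; simp at hz
  have h1 := riemannZeta_eq_inv_sub_mul (sub_ne_zero.mp hz1)
  rw [riemannZeta_eq_of_one_lt_re hz] at h1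
  field_simp at h1
  linear_combination -h1

lemma norm_mellin_fractAboveOne_le {s : ℂ} (hs : 0 < s.re) :
    ‖mellin fractAboveOne (-s)‖ ≤ 1 / s.re := by
  rw [mellin_fractAboveOne]
  have h1 : IntegrableOn (fun t : ℝ ↦ t ^ (-(s.re + 1))) (Ioi 1) :=
    integrableOn_Ioi_rpow_of_lt (by linarith) one_pos
  calc _ ≤ ∫ t in Ioi (1 : ℝ), t ^ (-(s.re + 1)) := by
        refine norm_integral_le_of_norm_le h1 ?_
        filter_upwards [ae_restrict_mem measurableSet_Ioi] with t ht
        have ht0 : (0 : ℝ) < t := one_pos.trans ht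
        rw [norm_mul, norm_cpow_eq_rpow_re_of_pos ht0, norm_real, Real.norm_eq_abs,
          abs_of_nonneg (Int.fract_nonneg t)]
        simpa using mul_le_of_le_one_right (Real.rpow_nonneg ht0.le _) (Int.fract_lt_one t).le
    _ = 1 / s.re := by
        rw [integral_Ioi_rpow_of_lt (by linarith) one_pos]
        have : -(s.re + 1) + 1 = - s.re := by ring
        rw [this]; simp

lemma norm_riemannZeta₁_le {s : ℂ} (hs : 1 / 5 ≤ s.re) :
    ‖riemannZeta₁ s‖ ≤ 6 * (1 + ‖s‖) ^ 2 := by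
  have h0 : 0 < s.re := by linarith
  rw [riemannZeta₁_eq h0]
  have h1 : ‖mellin fractAboveOne (-s)‖ ≤ 5 := (norm_mellin_fractAboveOne_le h0).trans (by
    rw [div_le_iff₀ h0]; linarith)
  have h2 : ‖s - 1‖ ≤ ‖s‖ + 1 := (norm_sub_le _ _).trans (by simp)
  calc _ ≤ ‖s‖ + ‖s‖ * (‖s‖ + 1) * 5 := by
        refine (norm_sub_le _ _).trans ?_
        rw [norm_mul, norm_mul]; gcongr
    _ ≤ _ := by nlinarith [norm_nonneg s]

lemma riemannZeta₁_eq_zero_iff {s : ℂ} (hs : 0 < s.re) :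
    riemannZeta₁ s = 0 ↔ riemannZeta s = 0 ∧ s.re < 1 := by
  by_cases h1 : s = 1
  · subst h1; simp
  rw [riemannZeta_eq_inv_sub_mul h1]
  have : (s - 1)⁻¹ ≠ 0 := inv_ne_zero (sub_ne_zero.mpr h1)
  simp only [mul_eq_zero, this, false_or]
  refine ⟨fun h ↦ ⟨h, ?_⟩, fun h ↦ h.1⟩
  by_contra hre
  have := riemannZeta_ne_zero_of_one_le_re (s := s) (not_lt.mp hre)
  rw [riemannZeta_eq_inv_sub_mul h1, h] at this
  simp at this

lemma riemannZeta₁_real_ne_zero {x : ℝ} (h0 : 0 < x) (h1 : x < 1) : riemannZeta₁ (x : ℂ) ≠ 0 := by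
  rw [riemannZeta₁_eq (by simpa using h0), mellin_fractAboveOne]
  have h2 : ∫ t in Ioi (1 : ℝ), (t : ℂ) ^ (-((x : ℂ) + 1)) * ((Int.fract t : ℝ) : ℂ) =
      ((∫ t in Ioi (1 : ℝ), t ^ (-(x + 1)) * Int.fract t : ℝ) : ℂ) := by
    rw [← integral_complex_ofReal]
    refine setIntegral_congr_fun measurableSet_Ioi fun t ht ↦ ?_
    have ht0 : (0 : ℝ) < t := one_pos.trans ht
    push_cast [ofReal_cpow ht0.le]
    rfl
  have h3 : 0 ≤ ∫ t in Ioi (1 : ℝ), t ^ (-(x + 1)) * Int.fract t :=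
    setIntegral_nonneg measurableSet_Ioi fun t ht ↦
      mul_nonneg (Real.rpow_nonneg (one_pos.trans ht).le _) (Int.fract_nonneg t)
  rw [h2]
  generalize (∫ t in Ioi (1 : ℝ), t ^ (-(x + 1)) * Int.fract t) = I at h3
  intro h
  have h4 : x - x * (x - 1) * I = 0 := by exact_mod_cast h
  have h5 := mul_nonneg (mul_nonneg h0.le (sub_nonneg.mpr h1.le)) h3
  nlinarith

/-- A uniform lower bound for `(s - 1) ζ(s)` on `Re s ≥ 2`. -/
lemma norm_riemannZeta₁_ge {s : ℂ} (hs : 2 ≤ s.re) : 1 / 4 ≤ ‖riemannZeta₁ s‖ := by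
  have hs1 : 1 < s.re := by linarith
  have hne : s ≠ 1 := fun h ↦ by rw [h] at hs1; simp at hs1
  have h1 : 1 ≤ ‖s - 1‖ := by
    have := abs_re_le_norm (s - 1)
    rw [sub_re, one_re, abs_of_nonneg (by linarith)] at this
    linarith
  have hsum := zeta_eq_tsum_one_div_nat_add_one_cpow hs1
  have hterm : ∀ n : ℕ, ‖1 / ((n : ℂ) + 1) ^ s‖ ≤ 1 / ((n : ℝ) + 1) ^ 2 := by
    intro n
    have : ((n : ℂ) + 1) = ((n + 1 : ℝ) : ℂ) := by push_cast; ring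
    rw [this, norm_div, norm_one, norm_cpow_eq_rpow_re_of_pos (by positivity)]
    refine one_div_le_one_div_of_le (by positivity) ?_
    rw [← Real.rpow_natCast]
    exact Real.rpow_le_rpow_of_exponent_le (by simp) (by simpa using hs)
  have hs2 : Summable (fun n : ℕ ↦ 1 / ((n : ℝ) + 1) ^ 2) := by
    have := (summable_nat_add_iff 1).mpr (Real.summable_one_div_nat_pow.mpr (one_lt_two))
    simpa using this
  have hsm : Summable (fun n : ℕ ↦ 1 / ((n : ℂ) + 1) ^ s) := .of_norm_bounded hs2 hterm
  have hz2 : ∑' n : ℕ, 1 / ((n : ℝ) + 1) ^ 2 = Real.pi ^ 2 / 6 := by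
    have := hasSum_zeta_two.tsum_eq
    rw [hasSum_zeta_two.summable.tsum_eq_zero_add] at this
    simpa using this
  have hrest : ‖riemannZeta s - 1‖ ≤ Real.pi ^ 2 / 6 - 1 := by
    rw [hsum, hsm.tsum_eq_zero_add]
    simp only [Nat.cast_zero, zero_add, one_cpow, div_one, add_sub_cancel_left]
    rw [← hz2, hs2.tsum_eq_zero_add]
    simp only [Nat.cast_zero, zero_add, one_pow, div_one, add_sub_cancel_left]
    refine tsum_of_norm_bounded ((summable_nat_add_iff 1).mpr hs2).hasSum fun n ↦ hterm (n + 1)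
  have hpi : Real.pi ^ 2 / 6 - 1 ≤ 3 / 4 := by
    have := Real.pi_lt_d2
    nlinarith [Real.pi_pos]
  have h2 : 1 / 4 ≤ ‖riemannZeta s‖ := by
    have := norm_sub_norm_le (1 : ℂ) (1 - riemannZeta s)
    rw [norm_one, norm_sub_rev, sub_sub_cancel] at this
    rw [norm_sub_rev] at hrest
    have h' := norm_sub_le (riemannZeta s) (riemannZeta s - 1)
    rw [sub_sub_cancel, norm_one, norm_sub_rev (riemannZeta s) 1] at h'
    linarith
  have h3 : riemannZeta₁ s = (s - 1) * riemannZeta s := by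
    rw [riemannZeta_eq_inv_sub_mul hne, mul_inv_cancel_left₀ (sub_ne_zero.mpr hne)]
  rw [h3, norm_mul]
  nlinarith [norm_nonneg (riemannZeta s)]

end ZetaBounds

section LocalFactorization
open Complex Set Metric

lemma analyticOrderAt_ne_top_of_differentiable {f : ℂ → ℂ} (hf : Differentiable ℂ f) {c : ℂ}
    (hc : f c ≠ 0) (z : ℂ) : analyticOrderAt f z ≠ ⊤ := by
  intro h
  rw [analyticOrderAt_eq_top] at h
  have := (hf.differentiableOn.analyticOnNhd isOpen_univ).eqOn_zero_of_preconnected_of_eventuallyEq_zero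
    isPreconnected_univ (mem_univ z) h
  exact hc (this (mem_univ c))

lemma exists_extract_zero {f : ℂ → ℂ} (hf : Differentiable ℂ f) (a : ℂ)
    (ha : analyticOrderAt f a ≠ ⊤) :
    ∃ g : ℂ → ℂ, Differentiable ℂ g ∧ g a ≠ 0 ∧
      ∀ z, f z = (z - a) ^ analyticOrderNatAt f a * g z := by
  obtain ⟨k, hk, hka, hfk⟩ := (hf.analyticAt a).analyticOrderAt_ne_top.1 ha
  set n := analyticOrderNatAt f a
  have hev : ∀ᶠ z in nhds a, Function.update (fun z ↦ f z / (z - a) ^ n) a (k a) z = k z := by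
    filter_upwards [hfk] with z hz
    by_cases hza : z = a
    · subst hza; simp
    · have : (z - a) ^ n ≠ 0 := pow_ne_zero _ (sub_ne_zero.mpr hza)
      rw [Function.update_of_ne hza, hz, smul_eq_mul, mul_div_cancel_left₀ _ this]
  refine ⟨Function.update (fun z ↦ f z / (z - a) ^ n) a (k a), fun z ↦ ?_, by simpa using hka,
    fun z ↦ ?_⟩
  · by_cases hza : z = a
    · subst hza
      exact hk.differentiableAt.congr_of_eventuallyEq hev
    · have h1 : DifferentiableAt ℂ (fun z ↦ f z / (z - a) ^ n) z :=
        (hf z).div (by fun_prop) (pow_ne_zero _ (sub_ne_zero.mpr hza))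
      refine h1.congr_of_eventuallyEq ?_
      filter_upwards [isOpen_ne.mem_nhds hza] with w hw
      rw [Function.update_of_ne hw]
  · by_cases hza : z = a
    · subst hza
      simpa using hfk.self_of_nhds
    · have : (z - a) ^ n ≠ 0 := pow_ne_zero _ (sub_ne_zero.mpr hza)
      rw [Function.update_of_ne hza, mul_div_cancel₀ _ this]

/-- Finitely many zeros of an entire function can be divided out. -/
lemma exists_extract_zeros {f : ℂ → ℂ} (hf : Differentiable ℂ f) {c : ℂ} (hc : f c ≠ 0)
    (Z : Finset ℂ) :
    ∃ g : ℂ → ℂ, Differentiable ℂ g ∧ (∀ ρ ∈ Z, g ρ ≠ 0) ∧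
      ∀ z, f z = (∏ ρ ∈ Z, (z - ρ) ^ analyticOrderNatAt f ρ) * g z := by
  classical
  induction Z using Finset.induction_on with
  | empty => exact ⟨f, hf, by simp, by simp⟩
  | insert a Z ha ih =>
    obtain ⟨g, hg, hgZ, hfg⟩ := ih
    have hgc : g c ≠ 0 := fun h ↦ hc (by rw [hfg, h, mul_zero])
    obtain ⟨k, hk, hka, hgk⟩ :=
      exists_extract_zero hg a (analyticOrderAt_ne_top_of_differentiable hg hgc a)
    have hP : Differentiable ℂ (fun z ↦ ∏ ρ ∈ Z, (z - ρ) ^ analyticOrderNatAt f ρ) := by fun_prop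
    have hPa : ∏ ρ ∈ Z, (a - ρ) ^ analyticOrderNatAt f ρ ≠ 0 :=
      Finset.prod_ne_zero_iff.mpr fun ρ hρ ↦
        pow_ne_zero _ (sub_ne_zero.mpr fun h ↦ ha (h ▸ hρ))
    have hord : analyticOrderNatAt f a = analyticOrderNatAt g a := by
      have : f = (fun z ↦ ∏ ρ ∈ Z, (z - ρ) ^ analyticOrderNatAt f ρ) * g := funext hfg
      unfold analyticOrderNatAt
      conv_lhs => rw [this]
      rw [analyticOrderAt_mul (hP.analyticAt a) (hg.analyticAt a),
        (hP.analyticAt a).analyticOrderAt_eq_zero.mpr hPa, zero_add]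
    refine ⟨k, hk, fun ρ hρ ↦ ?_, fun z ↦ ?_⟩
    · rcases Finset.mem_insert.mp hρ with rfl | hρ
      · exact hka
      · intro h
        exact hgZ ρ hρ (by rw [hgk, h, mul_zero])
    · rw [Finset.prod_insert ha, hfg, hgk, hord]; ring

lemma finite_zeros_of_differentiable {f : ℂ → ℂ} (hf : Differentiable ℂ f) {c : ℂ} (hc : f c ≠ 0)
    {K : Set ℂ} (hK : IsCompact K) : {z ∈ K | f z = 0}.Finite := by
  by_contra hinf
  obtain ⟨z, -, hz⟩ := Set.Infinite.exists_accPt_of_subset_isCompact hinf hK (sep_subset _ _)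
  have h1 : ∃ᶠ w in nhdsWithin z {z}ᶜ, f w = 0 := by
    rw [accPt_iff_frequently_nhdsNE] at hz
    exact hz.mono fun w hw ↦ hw.2
  have := (hf.differentiableOn.analyticOnNhd isOpen_univ).eqOn_zero_of_preconnected_of_frequently_eq_zero
    isPreconnected_univ (mem_univ z) h1
  exact hc (this (mem_univ c))

/-- Existence of a holomorphic logarithm on a disc, normalized at the centre. -/
lemma exists_log_on_ball {h : ℂ → ℂ} {r : ℝ} (hr : 0 < r) (hd : Differentiable ℂ h)
    (h0 : ∀ z ∈ ball (0 : ℂ) r, h z ≠ 0) :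
    ∃ φ : ℂ → ℂ, φ 0 = 0 ∧ (∀ z ∈ ball (0 : ℂ) r, HasDerivAt φ (logDeriv h z) z) ∧
      ∀ z ∈ ball (0 : ℂ) r, h z = h 0 * exp (φ z) := by
  have hl : DifferentiableOn ℂ (logDeriv h) (ball 0 r) := fun z hz ↦
    ((hd.analyticAt z).deriv.differentiableAt.div (hd z) (h0 z hz)).differentiableWithinAt
  obtain ⟨φ, hφ0, hφ⟩ := hl.isExactOn_ball.with_val_at 0 0
  refine ⟨φ, hφ0, hφ, fun z hz ↦ ?_⟩
  have key : ∀ w ∈ ball (0 : ℂ) r, HasDerivAt (fun w ↦ h w * exp (-φ w)) 0 w := by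
    intro w hw
    have := (hd w).hasDerivAt.fun_mul ((hφ w hw).fun_neg.cexp)
    refine this.congr_deriv ?_
    rw [logDeriv_apply]
    field_simp [h0 w hw]
    ring
  have := isOpen_ball.is_const_of_deriv_eq_zero (convex_ball (0 : ℂ) r).isPreconnected
    (fun w hw ↦ (key w hw).differentiableAt.differentiableWithinAt) (fun w hw ↦ (key w hw).deriv)
    hz (mem_ball_self hr)
  simp only [hφ0, neg_zero, exp_zero, mul_one] at this
  rw [← this, mul_assoc, ← exp_add]; simp

lemma norm_blaschke_numerator {R : ℝ} (hR : 0 < R) {z : ℂ} (ρ : ℂ) (hz : ‖z‖ = R) :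
    ‖((R : ℂ) ^ 2 - (starRingEnd ℂ) ρ * z) / R‖ = ‖z - ρ‖ := by
  have h1 : (R : ℂ) ^ 2 = (starRingEnd ℂ) z * z := by
    rw [← normSq_eq_conj_mul_self, normSq_eq_norm_sq, hz]; push_cast; ring
  rw [h1, ← sub_mul, norm_div, norm_mul, ← map_sub, RCLike.norm_conj, hz, norm_real,
    Real.norm_of_nonneg hR.le, mul_div_cancel_right₀ _ hR.ne']

lemma logDeriv_prod_pow_mul {Z : Finset ℂ} {B : ℂ → ℂ → ℂ} {m : ℂ → ℕ} {g : ℂ → ℂ} {s : ℂ}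
    (hB : ∀ ρ ∈ Z, B ρ s ≠ 0) (hBd : ∀ ρ ∈ Z, DifferentiableAt ℂ (B ρ) s)
    (hg : g s ≠ 0) (hgd : DifferentiableAt ℂ g s) :
    logDeriv (fun z ↦ (∏ ρ ∈ Z, B ρ z ^ m ρ) * g z) s =
      ∑ ρ ∈ Z, (m ρ : ℂ) * logDeriv (B ρ) s + logDeriv g s := by
  rw [logDeriv_mul (f := fun z ↦ ∏ ρ ∈ Z, B ρ z ^ m ρ) s
    (Finset.prod_ne_zero_iff.mpr fun ρ hρ ↦ pow_ne_zero _ (hB ρ hρ)) hg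
    (DifferentiableAt.fun_finsetProd fun ρ hρ ↦ (hBd ρ hρ).pow _) hgd,
    logDeriv_prod (f := fun ρ z ↦ B ρ z ^ m ρ) (fun ρ hρ ↦ pow_ne_zero _ (hB ρ hρ))
    (fun ρ hρ ↦ (hBd ρ hρ).pow _)]
  congr 1
  exact Finset.sum_congr rfl fun ρ hρ ↦ logDeriv_fun_pow (hBd ρ hρ) _

/-- Zero count and logarithmic derivative on a disc in terms of the growth of an entire function. -/
lemma local_logDeriv_bound {f : ℂ → ℂ} (hf : Differentiable ℂ f) {r' r R L : ℝ} (hr' : 0 < r')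
    (hr'r : r' < r) (hrR : r < R) (hL : 0 < L) (hf0 : f 0 ≠ 0)
    (hM : ∀ z, ‖z‖ ≤ R → ‖f z‖ ≤ ‖f 0‖ * Real.exp L) (Z : Finset ℂ)
    (hZ : ∀ z, z ∈ Z ↔ f z = 0 ∧ ‖z‖ ≤ r) :
    (∑ ρ ∈ Z, (analyticOrderNatAt f ρ : ℝ)) ≤ L / Real.log (R / r) ∧
    ∀ s, ‖s‖ ≤ r' → f s ≠ 0 →
      ‖logDeriv f s - ∑ ρ ∈ Z, (analyticOrderNatAt f ρ : ℂ) / (s - ρ)‖ ≤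
        L * (8 * r / (r - r') ^ 2 + r / (Real.log (R / r) * (R ^ 2 - r ^ 2))) := by
  have hr : 0 < r := hr'.trans hr'r
  have hR : 0 < R := hr.trans hrR
  obtain ⟨g, hg, hgZ, hfg⟩ := exists_extract_zeros hf hf0 Z
  set m : ℂ → ℕ := analyticOrderNatAt f
  set B : ℂ → ℂ → ℂ := fun ρ z ↦ ((R : ℂ) ^ 2 - (starRingEnd ℂ) ρ * z) / R with hB
  set h : ℂ → ℂ := fun z ↦ (∏ ρ ∈ Z, B ρ z ^ m ρ) * g z with hh
  have hRC : (R : ℂ) ≠ 0 := by exact_mod_cast hR.ne'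
  have hBd : ∀ ρ, Differentiable ℂ (B ρ) := fun ρ ↦ by simp only [hB]; fun_prop
  have hhd : Differentiable ℂ h := by
    refine Differentiable.mul ?_ hg
    exact Differentiable.fun_finsetProd fun ρ _ ↦ (hBd ρ).pow _
  have hlog : 0 < Real.log (R / r) := Real.log_pos ((one_lt_div hr).mpr hrR)
  have hsphere : ∀ z, ‖z‖ = R → ‖h z‖ = ‖f z‖ := by
    intro z hz
    simp only [hh]
    rw [hfg, norm_mul, norm_mul, norm_prod, norm_prod]
    congr 1
    refine Finset.prod_congr rfl fun ρ _ ↦ ?_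
    rw [norm_pow, norm_pow, norm_blaschke_numerator hR ρ hz]
  have hmax : ∀ z, ‖z‖ ≤ R → ‖h z‖ ≤ ‖f 0‖ * Real.exp L := by
    intro z hz
    refine norm_le_of_forall_mem_frontier_norm_le (U := ball 0 R) isBounded_ball
      hhd.diffContOnCl ?_ ?_
    · intro w hw
      rw [frontier_ball _ hR.ne', mem_sphere_zero_iff_norm] at hw
      rw [hsphere w hw]; exact hM w hw.le
    · rw [closure_ball _ hR.ne', mem_closedBall_zero_iff]; exact hz
  have hZ0 : ∀ ρ ∈ Z, ρ ≠ 0 := fun ρ hρ h ↦ hf0 (h ▸ ((hZ ρ).mp hρ).1)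
  have hh0 : ‖h 0‖ ≥ ‖f 0‖ * (R / r) ^ (∑ ρ ∈ Z, m ρ) := by
    have : ∀ ρ ∈ Z, (R / r) ^ m ρ * ‖(0 - ρ) ^ m ρ‖ ≤ ‖B ρ 0 ^ m ρ‖ := by
      intro ρ hρ
      rw [norm_pow, norm_pow, ← mul_pow]
      refine pow_le_pow_left₀ (by positivity) ?_ _
      have : B ρ 0 = R := by simp only [hB]; field_simp; simp
      rw [this, norm_real, Real.norm_of_nonneg hR.le, zero_sub, norm_neg, div_mul_eq_mul_div,
        div_le_iff₀ hr]
      exact mul_le_mul_of_nonneg_left ((hZ ρ).mp hρ).2 hR.le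
    simp only [hh]
    rw [hfg 0, norm_mul, norm_mul, norm_prod, norm_prod, ← Finset.prod_pow_eq_pow_sum]
    calc _ = (∏ ρ ∈ Z, (R / r) ^ m ρ * ‖(0 - ρ) ^ m ρ‖) * ‖g 0‖ := by
          rw [Finset.prod_mul_distrib]; ring
      _ ≤ _ := mul_le_mul_of_nonneg_right
          (Finset.prod_le_prod (fun ρ _ ↦ by positivity) this) (norm_nonneg _)
  have hf0p : 0 < ‖f 0‖ := norm_pos_iff.mpr hf0
  have hsum : (∑ ρ ∈ Z, (m ρ : ℝ)) ≤ L / Real.log (R / r) := by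
    have h1 : (R / r) ^ (∑ ρ ∈ Z, m ρ) ≤ Real.exp L := by
      have := hh0.le.trans (hmax 0 (by simpa using hR.le))
      exact le_of_mul_le_mul_left this hf0p
    have h2 := Real.log_le_log (by positivity) h1
    rw [Real.log_exp, Real.log_pow] at h2
    rw [le_div_iff₀ hlog]
    exact_mod_cast h2
  refine ⟨hsum, fun s hs hfs ↦ ?_⟩
  have hBne : ∀ ρ ∈ Z, ∀ z, ‖z‖ ≤ r → R ^ 2 - r ^ 2 ≤ ‖(R : ℂ) ^ 2 - (starRingEnd ℂ) ρ * z‖ := by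
    intro ρ hρ z hz
    have h1 : ‖(starRingEnd ℂ) ρ * z‖ ≤ r ^ 2 := by
      rw [norm_mul, RCLike.norm_conj, sq]
      exact mul_le_mul ((hZ ρ).mp hρ).2 hz (norm_nonneg _) hr.le
    have h2 := norm_sub_norm_le ((R : ℂ) ^ 2) ((starRingEnd ℂ) ρ * z)
    rw [norm_pow, norm_real, Real.norm_of_nonneg hR.le] at h2
    linarith
  have hRr : 0 < R ^ 2 - r ^ 2 := by nlinarith
  have hBne' : ∀ ρ ∈ Z, ∀ z, ‖z‖ ≤ r → B ρ z ≠ 0 := by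
    intro ρ hρ z hz h
    have h1 := hBne ρ hρ z hz
    simp only [hB, div_eq_zero_iff, hRC, or_false] at h
    rw [h, norm_zero] at h1
    linarith
  have hgne : ∀ z, ‖z‖ ≤ r → g z ≠ 0 := by
    intro z hz h
    have : z ∈ Z := (hZ z).mpr ⟨by rw [hfg, h, mul_zero], hz⟩
    exact hgZ z this h
  have hhne : ∀ z ∈ ball (0 : ℂ) r, h z ≠ 0 := by
    intro z hz
    have hz' : ‖z‖ ≤ r := (mem_ball_zero_iff.mp hz).le
    exact mul_ne_zero (Finset.prod_ne_zero_iff.mpr fun ρ hρ ↦ pow_ne_zero _ (hBne' ρ hρ z hz'))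
      (hgne z hz')
  obtain ⟨φ, hφ0, hφ, hhφ⟩ := exists_log_on_ball hr hhd hhne
  have hh0' : ‖f 0‖ ≤ ‖h 0‖ := by
    refine le_trans ?_ hh0
    exact le_mul_of_one_le_right hf0p.le (one_le_pow₀ ((one_lt_div hr).mpr hrR).le)
  have hre : MapsTo φ (ball 0 r) {z | z.re ≤ L} := by
    intro z hz
    have h1 := hmax z ((mem_ball_zero_iff.mp hz).le.trans hrR.le)
    rw [hhφ z hz, norm_mul, norm_exp] at h1
    have h2 : ‖f 0‖ * Real.exp (φ z).re ≤ ‖f 0‖ * Real.exp L :=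
      (mul_le_mul_of_nonneg_right hh0' (Real.exp_pos _).le).trans h1
    exact Real.exp_le_exp.mp (le_of_mul_le_mul_left h2 hf0p)
  have hφd : DifferentiableOn ℂ φ (ball 0 r) := fun z hz ↦
    (hφ z hz).differentiableAt.differentiableWithinAt
  have hε : 0 < (r - r') / 2 := by linarith
  have hball : closedBall s ((r - r') / 2) ⊆ ball 0 r := by
    intro z hz
    rw [mem_closedBall, dist_eq_norm] at hz
    rw [mem_ball_zero_iff]
    have := norm_add_le (z - s) s
    rw [sub_add_cancel] at this
    linarith
  have hsr : s ∈ ball (0 : ℂ) r := hball (mem_closedBall_self hε.le)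
  have hderiv : ‖logDeriv h s‖ ≤ L * (8 * r / (r - r') ^ 2) := by
    rw [← (hφ s hsr).deriv]
    refine (norm_deriv_le_of_forall_mem_sphere_norm_le (C := 2 * L * r / ((r - r') / 2)) hε
      (hφd.mono ?_).diffContOnCl ?_).trans (le_of_eq ?_)
    · rw [closure_ball _ hε.ne']; exact hball
    · intro z hz
      have hzb := hball (sphere_subset_closedBall hz)
      refine (borelCaratheodory_zero hL hφd hre hr hzb hφ0).trans ?_
      have hz1 : ‖z‖ ≤ r - (r - r') / 2 := by
        rw [mem_sphere, dist_eq_norm] at hz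
        have := norm_add_le (z - s) s
        rw [sub_add_cancel] at this
        linarith
      have : (r - r') / 2 ≤ r - ‖z‖ := by linarith
      have hz2 : ‖z‖ ≤ r := by linarith
      gcongr
    · field_simp; ring
  have hsr' : ‖s‖ ≤ r := hs.trans hr'r.le
  have hsρ : ∀ ρ ∈ Z, s - ρ ≠ 0 := by
    intro ρ hρ h
    rw [sub_eq_zero.mp h] at hfs
    exact hfs ((hZ ρ).mp hρ).1
  have hlf : logDeriv f s = ∑ ρ ∈ Z, (m ρ : ℂ) / (s - ρ) + logDeriv g s := by
    have : f = fun z ↦ (∏ ρ ∈ Z, (z - ρ) ^ m ρ) * g z := funext hfg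
    rw [this, logDeriv_prod_pow_mul hsρ (fun ρ _ ↦ by fun_prop) (hgne s hsr') (hg s)]
    congr 1
    refine Finset.sum_congr rfl fun ρ hρ ↦ ?_
    rw [logDeriv_apply]
    simp [div_eq_mul_inv]
  have hlh : logDeriv h s = ∑ ρ ∈ Z, (m ρ : ℂ) * (-(starRingEnd ℂ) ρ /
      ((R : ℂ) ^ 2 - (starRingEnd ℂ) ρ * s)) + logDeriv g s := by
    simp only [hh]
    rw [logDeriv_prod_pow_mul (fun ρ hρ ↦ hBne' ρ hρ s hsr') (fun ρ _ ↦ hBd ρ s) (hgne s hsr') (hg s)]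
    congr 1
    refine Finset.sum_congr rfl fun ρ hρ ↦ ?_
    rw [logDeriv_apply]
    have : HasDerivAt (B ρ) (-(starRingEnd ℂ) ρ / R) s := by
      have h1 := (((hasDerivAt_id s).const_mul ((starRingEnd ℂ) ρ)).const_sub ((R : ℂ) ^ 2)).div_const (R : ℂ)
      simpa using h1
    rw [this.deriv]
    simp only [hB]
    rw [div_div_div_cancel_right₀ hRC]
  have hfin : logDeriv f s - ∑ ρ ∈ Z, (m ρ : ℂ) / (s - ρ) = logDeriv h s -
      ∑ ρ ∈ Z, (m ρ : ℂ) * (-(starRingEnd ℂ) ρ / ((R : ℂ) ^ 2 - (starRingEnd ℂ) ρ * s)) := by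
    rw [hlf, hlh]; ring
  rw [hfin]
  have hsumB : ‖∑ ρ ∈ Z, (m ρ : ℂ) * (-(starRingEnd ℂ) ρ /
      ((R : ℂ) ^ 2 - (starRingEnd ℂ) ρ * s))‖ ≤ L / Real.log (R / r) * (r / (R ^ 2 - r ^ 2)) := by
    refine (norm_sum_le _ _).trans ?_
    calc _ ≤ ∑ ρ ∈ Z, (m ρ : ℝ) * (r / (R ^ 2 - r ^ 2)) := by
          refine Finset.sum_le_sum fun ρ hρ ↦ ?_
          rw [norm_mul, Complex.norm_natCast, norm_div, norm_neg, RCLike.norm_conj]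
          gcongr
          · exact ((hZ ρ).mp hρ).2
          · exact hBne ρ hρ s hsr'
      _ = (∑ ρ ∈ Z, (m ρ : ℝ)) * (r / (R ^ 2 - r ^ 2)) := by rw [Finset.sum_mul]
      _ ≤ _ := mul_le_mul_of_nonneg_right hsum (by positivity)
  refine (norm_sub_le _ _).trans ((add_le_add hderiv hsumB).trans (le_of_eq ?_))
  field_simp

lemma analyticOrderNatAt_comp_add_const (f : ℂ → ℂ) (c z : ℂ) :
    analyticOrderNatAt (fun w ↦ f (w + c)) z = analyticOrderNatAt f (z + c) := by
  have := analyticOrderAt_comp_of_deriv_ne_zero (f := f) (g := fun w ↦ w + c) (z₀ := z)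
    (by fun_prop) (by simp)
  unfold analyticOrderNatAt
  rw [← this]; rfl

/-- The multiplicity of a point as a zero of `(s - 1) ζ(s)`. -/
noncomputable def zetaOrder (ρ : ℂ) : ℕ := analyticOrderNatAt riemannZeta₁ ρ

/-- Landau's local approximation of `ζ'/ζ` by nearby zeros, with the count of those zeros. -/
lemma exists_zeta_local_bound : ∃ C : ℝ, 0 < C ∧ ∀ c : ℂ, c.re = 2 → ∀ Z : Finset ℂ,
    (∀ z, z ∈ Z ↔ riemannZeta₁ z = 0 ∧ ‖z - c‖ ≤ 1.7) →
    (∑ ρ ∈ Z, (zetaOrder ρ : ℝ)) ≤ C * Real.log (3 + |c.im|) ∧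
    ∀ s, ‖s - c‖ ≤ 1.6 → riemannZeta₁ s ≠ 0 →
      ‖logDeriv riemannZeta₁ s - ∑ ρ ∈ Z, (zetaOrder ρ : ℂ) / (s - ρ)‖ ≤
        C * Real.log (3 + |c.im|) := by
  set A : ℝ := 1 / Real.log (1.8 / 1.7)
  set D : ℝ := 8 * 1.7 / (1.7 - 1.6) ^ 2 + 1.7 / (Real.log (1.8 / 1.7) * (1.8 ^ 2 - 1.7 ^ 2))
  have hlogp : 0 < Real.log (1.8 / 1.7) := Real.log_pos (by norm_num)
  have hA : 0 < A := by positivity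
  have hD : 0 < D := by
    have : (0 : ℝ) < 1.8 ^ 2 - 1.7 ^ 2 := by norm_num
    positivity
  refine ⟨7 * (A + D), by positivity, fun c hc Z hZ ↦ ?_⟩
  set X : ℝ := 3 + |c.im|
  have hX : 3 ≤ X := by simp [X]
  have hlogX : 1 ≤ Real.log X := by
    rw [Real.le_log_iff_exp_le (by linarith)]
    linarith [Real.exp_one_lt_d9]
  set f : ℂ → ℂ := fun z ↦ riemannZeta₁ (z + c)
  have hfd : Differentiable ℂ f := differentiable_riemannZeta₁.comp (by fun_prop)
  have hf0 : 1 / 4 ≤ ‖f 0‖ := by simpa [f] using norm_riemannZeta₁_ge hc.ge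
  have hcn : ‖c‖ ≤ X - 1 := by
    have := norm_le_abs_re_add_abs_im c
    rw [hc] at this
    simp only [X]; norm_num at this ⊢; linarith
  have hM : ∀ z, ‖z‖ ≤ 1.8 → ‖f z‖ ≤ ‖f 0‖ * Real.exp (7 * Real.log X) := by
    intro z hz
    have h1 : ‖f z‖ ≤ 6 * (1 + ‖z + c‖) ^ 2 := by
      refine norm_riemannZeta₁_le ?_
      have := (abs_re_le_norm z).trans hz
      rw [abs_le] at this
      rw [add_re, hc]; norm_num at this ⊢; linarith [this.1]
    have h2 : ‖z + c‖ ≤ 2 * X - 1 := (norm_add_le _ _).trans (by norm_num at hz; linarith)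
    have h3 : Real.exp (7 * Real.log X) = X ^ 7 := by
      rw [mul_comm, Real.exp_mul, Real.exp_log (by linarith)]
      exact_mod_cast rfl
    have h4 : (1 + ‖z + c‖) ^ 2 ≤ (2 * X) ^ 2 := pow_le_pow_left₀ (by positivity) (by linarith) 2
    have h5 : (243 : ℝ) ≤ X ^ 5 := by
      have := pow_le_pow_left₀ (by norm_num) hX 5
      norm_num at this ⊢; exact this
    have h6 : X ^ 7 = X ^ 5 * X ^ 2 := by ring
    have h7 : 243 * X ^ 2 ≤ X ^ 7 := h6 ▸ mul_le_mul_of_nonneg_right h5 (by positivity)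
    rw [h3]
    have h8 : 1 / 4 * X ^ 7 ≤ ‖f 0‖ * X ^ 7 := mul_le_mul_of_nonneg_right hf0 (by positivity)
    nlinarith
  set e : ℂ ↪ ℂ := ⟨fun z ↦ z - c, sub_left_injective⟩
  have hZ' : ∀ z, z ∈ Z.map e ↔ f z = 0 ∧ ‖z‖ ≤ 1.7 := by
    intro z
    rw [Finset.mem_map]
    constructor
    · rintro ⟨w, hw, rfl⟩
      simpa [e, f] using (hZ w).mp hw
    · intro h
      exact ⟨z + c, (hZ _).mpr (by simpa [f] using h), by simp [e]⟩
  have key := local_logDeriv_bound hfd (r' := 1.6) (r := 1.7) (R := 1.8) (L := 7 * Real.log X)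
    (by norm_num) (by norm_num) (by norm_num) (by linarith)
    (fun h ↦ by rw [h, norm_zero] at hf0; norm_num at hf0) hM (Z.map e) hZ'
  have hord : ∀ ρ, analyticOrderNatAt f (e ρ) = zetaOrder ρ := by
    intro ρ
    rw [show f = fun z ↦ riemannZeta₁ (z + c) from rfl,
      analyticOrderNatAt_comp_add_const]
    simp [e, zetaOrder]
  simp only [Finset.sum_map, hord] at key
  refine ⟨key.1.trans ?_, fun s hs hfs ↦ ?_⟩
  · have : 7 * Real.log X / Real.log (1.8 / 1.7) = 7 * Real.log X * A := by
      simp only [A]; ring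
    rw [this]
    nlinarith [mul_pos (by linarith : 0 < Real.log X) hD]
  · have h1 := key.2 (s - c) hs (by simpa [f] using hfs)
    have h2 : logDeriv f (s - c) = logDeriv riemannZeta₁ s := by
      rw [logDeriv_apply, logDeriv_apply]
      simp only [f]
      rw [deriv_comp_add_const, sub_add_cancel]
    have h3 : ∀ ρ, s - c - e ρ = s - ρ := fun ρ ↦ by simp [e]
    simp only [h2, h3] at h1
    refine h1.trans ?_
    change 7 * Real.log X * D ≤ _
    nlinarith [mul_pos (by linarith : 0 < Real.log X) hA]

end LocalFactorization

section ManyZeros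
open Complex Set Metric

/-- Quantitative form of Hadamard factorization at finite radius. -/
lemma norm_mul_neg_le_of_radius {h : ℂ → ℂ} (hd : Differentiable ℂ h) (h0 : h 0 ≠ 0) {K : ℝ}
    (hK : ∀ Z : Finset ℂ, (∀ β ∈ Z, h β = 0) →
      ∑ β ∈ Z, (analyticOrderNatAt h β : ℝ) / ‖β‖ ≤ K)
    {R L : ℝ} (hR : 0 < R) (hL : 0 < L) (hM : ∀ z, ‖z‖ ≤ 4 * R → ‖h z‖ ≤ ‖h 0‖ * Real.exp L)
    {x : ℂ} (hx : ‖x‖ < R / 2) :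
    ‖h x * h (-x)‖ ≤ ‖h 0‖ ^ 2 * Real.exp (2 * K * ‖x‖) * Real.exp (4 * L * (‖x‖ / (R / 2)) ^ 2) := by
  have hfin := finite_zeros_of_differentiable hd h0 (isCompact_closedBall (0 : ℂ) R)
  set Z : Finset ℂ := hfin.toFinset
  have hZ : ∀ z, z ∈ Z ↔ ‖z‖ ≤ R ∧ h z = 0 := fun z ↦ by simp [Z]
  have hZ0 : ∀ β ∈ Z, β ≠ 0 := fun β hβ e ↦ h0 (e ▸ ((hZ β).mp hβ).2)
  obtain ⟨g, hg, hgZ, hhg⟩ := exists_extract_zeros hd h0 Z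
  set m : ℂ → ℕ := analyticOrderNatAt h
  set a : ℂ := ∏ β ∈ Z, (-β) ^ m β
  have ha : a ≠ 0 := Finset.prod_ne_zero_iff.mpr fun β hβ ↦ pow_ne_zero _ (neg_ne_zero.mpr (hZ0 β hβ))
  set G : ℂ → ℂ := fun z ↦ a * g z
  have hGd : Differentiable ℂ G := by simp only [G]; fun_prop
  have hhG : ∀ z, h z = (∏ β ∈ Z, (1 - z / β) ^ m β) * G z := by
    intro z
    rw [hhg z, ← mul_assoc, ← Finset.prod_mul_distrib]
    congr 1
    refine Finset.prod_congr rfl fun β hβ ↦ ?_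
    rw [← mul_pow]
    congr 1
    field_simp [hZ0 β hβ]
    ring
  have hG0 : G 0 = h 0 := by rw [hhG 0]; simp
  have hGmax : ∀ z, ‖z‖ ≤ 4 * R → ‖G z‖ ≤ ‖h 0‖ * Real.exp L := by
    intro z hz
    have h4R : (4 * R) ≠ 0 := by positivity
    refine norm_le_of_forall_mem_frontier_norm_le (U := ball 0 (4 * R)) isBounded_ball
      hGd.diffContOnCl ?_ ?_
    · intro w hw
      rw [frontier_ball _ h4R, mem_sphere_zero_iff_norm] at hw
      refine le_trans ?_ (hM w hw.le)
      rw [hhG w, norm_mul (∏ β ∈ Z, (1 - w / β) ^ m β)]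
      refine le_mul_of_one_le_left (norm_nonneg (G w)) ?_
      rw [norm_prod]
      refine Finset.one_le_prod fun β hβ ↦ ?_
      rw [norm_pow]
      refine one_le_pow₀ ?_
      have hβ1 := ((hZ β).mp hβ).1
      have hβ0 : 0 < ‖β‖ := norm_pos_iff.mpr (hZ0 β hβ)
      have h1 := norm_sub_norm_le (w / β) 1
      rw [norm_sub_rev, norm_div, norm_one, hw] at h1
      have h2 : 4 ≤ 4 * R / ‖β‖ := by rw [le_div_iff₀ hβ0]; linarith
      linarith
    · rw [closure_ball _ h4R, mem_closedBall_zero_iff]; exact hz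
  have hGne : ∀ z ∈ ball (0 : ℂ) R, G z ≠ 0 := by
    intro z hz e
    have hgz : g z = 0 := (mul_eq_zero.mp e).resolve_left ha
    have hzZ : z ∈ Z := (hZ z).mpr ⟨(mem_ball_zero_iff.mp hz).le, by rw [hhG z, e, mul_zero]⟩
    exact hgZ z hzZ hgz
  obtain ⟨φ, hφ0, hφ, hGφ⟩ := exists_log_on_ball hR hGd hGne
  rw [hG0] at hGφ
  have h0p : 0 < ‖h 0‖ := norm_pos_iff.mpr h0
  have hre : MapsTo φ (ball 0 R) {z | z.re ≤ L} := by
    intro z hz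
    have h1 := hGmax z ((mem_ball_zero_iff.mp hz).le.trans (by linarith))
    rw [hGφ z hz, norm_mul, norm_exp] at h1
    exact Real.exp_le_exp.mp (le_of_mul_le_mul_left h1 h0p)
  have hφd : DifferentiableOn ℂ φ (ball 0 R) := fun z hz ↦
    (hφ z hz).differentiableAt.differentiableWithinAt
  have hφb : ∀ z, ‖z‖ < R / 2 → ‖φ z‖ ≤ 2 * L := by
    intro z hz
    have hzR : z ∈ ball (0 : ℂ) R := mem_ball_zero_iff.mpr (by linarith)
    refine (borelCaratheodory_zero hL hφd hre hR hzR hφ0).trans ?_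
    rw [div_le_iff₀ (by linarith)]
    nlinarith
  have hneg : ∀ z, z ∈ ball (0 : ℂ) R → -z ∈ ball (0 : ℂ) R := fun z hz ↦ by simpa using hz
  have hχd : ∀ z ∈ ball (0 : ℂ) R,
      HasDerivAt (fun z ↦ φ z + φ (-z)) (logDeriv G z - logDeriv G (-z)) z := by
    intro z hz
    have h1 : HasDerivAt (fun z ↦ φ (-z)) (logDeriv G (-z) * -1) z :=
      (hφ (-z) (hneg z hz)).comp z (hasDerivAt_neg z)
    exact ((hφ z hz).fun_add h1).congr_deriv (by ring)
  have hsub : ball (0 : ℂ) (R / 2) ⊆ ball 0 R := ball_subset_ball (by linarith)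
  have hχ : ‖φ x + φ (-x)‖ ≤ 4 * L * (‖x‖ / (R / 2)) ^ 2 := by
    have := dist_le_mul_div_pow_of_mapsTo_ball_of_isLittleO (f := fun z ↦ φ z + φ (-z)) (c := 0)
      (z := x) (R₁ := R / 2) (R₂ := 4 * L) (n := 1)
      (fun z hz ↦ (hχd z (hsub hz)).differentiableAt.differentiableWithinAt) ?_ ?_
      (mem_ball_zero_iff.mpr hx)
    · simpa [hφ0, dist_eq_norm] using this
    · intro z hz
      rw [mem_ball_zero_iff] at hz
      have h1 := hφb z hz
      have h2 := hφb (-z) (by simpa using hz)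
      have h3 := norm_add_le (φ z) (φ (-z))
      simp only [neg_zero, hφ0, add_zero, mem_closedBall_zero_iff]
      linarith
    · have := (hχd 0 (mem_ball_self hR))
      rw [neg_zero, sub_self, hasDerivAt_iff_isLittleO] at this
      simp only [smul_zero, sub_zero] at this
      refine this.trans_isBigO ?_
      simp only [pow_one, sub_zero]
      exact (Asymptotics.isBigO_refl _ _).norm_right
  have hP : ∀ w : ℂ, ‖∏ β ∈ Z, (1 - w / β) ^ m β‖ ≤ Real.exp (K * ‖w‖) := by
    intro w
    have h1 : ∀ β ∈ Z, ‖(1 - w / β) ^ m β‖ ≤ Real.exp ((m β : ℝ) / ‖β‖ * ‖w‖) := by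
      intro β _
      have h2 : ‖1 - w / β‖ ≤ Real.exp (‖w‖ / ‖β‖) := by
        have h3 := norm_sub_le 1 (w / β)
        rw [norm_one, norm_div] at h3
        linarith [Real.add_one_le_exp (‖w‖ / ‖β‖)]
      rw [norm_pow]
      refine (pow_le_pow_left₀ (norm_nonneg _) h2 _).trans (le_of_eq ?_)
      rw [← Real.exp_nat_mul]; congr 1; ring
    rw [norm_prod]
    refine (Finset.prod_le_prod (fun β _ ↦ norm_nonneg _) h1).trans ?_
    rw [← Real.exp_sum, ← Finset.sum_mul]
    refine Real.exp_le_exp.mpr (mul_le_mul_of_nonneg_right ?_ (norm_nonneg _))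
    exact hK Z fun β hβ ↦ ((hZ β).mp hβ).2
  have hxR : x ∈ ball (0 : ℂ) R := mem_ball_zero_iff.mpr (by linarith)
  rw [hhG x, hhG (-x), hGφ x hxR, hGφ (-x) (hneg x hxR)]
  have hexp : ‖exp (φ x) * exp (φ (-x))‖ ≤ Real.exp (4 * L * (‖x‖ / (R / 2)) ^ 2) := by
    rw [← exp_add, norm_exp]
    exact Real.exp_le_exp.mpr ((re_le_norm _).trans hχ)
  have hPx := hP x
  have hPx' := hP (-x)
  rw [norm_neg] at hPx'
  calc _ = ‖h 0‖ ^ 2 * (‖∏ β ∈ Z, (1 - x / β) ^ m β‖ * ‖∏ β ∈ Z, (1 - -x / β) ^ m β‖) *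
        ‖exp (φ x) * exp (φ (-x))‖ := by simp only [norm_mul]; ring
    _ ≤ ‖h 0‖ ^ 2 * (Real.exp (K * ‖x‖) * Real.exp (K * ‖x‖)) *
        Real.exp (4 * L * (‖x‖ / (R / 2)) ^ 2) := by gcongr
    _ = _ := by rw [← Real.exp_add]; congr 3; ring

/-- An entire function of order less than two whose zeros have summable reciprocals has at most
exponential type on average over `x` and `-x`. -/
lemma norm_mul_neg_le_of_order {h : ℂ → ℂ} (hd : Differentiable ℂ h) (h0 : h 0 ≠ 0) {C K : ℝ}
    (hK : ∀ Z : Finset ℂ, (∀ β ∈ Z, h β = 0) →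
      ∑ β ∈ Z, (analyticOrderNatAt h β : ℝ) / ‖β‖ ≤ K)
    (hC : 0 < C) (hgrow : ∀ z, ‖h z‖ ≤ ‖h 0‖ * Real.exp (C * (1 + ‖z‖) ^ (3 / 2 : ℝ))) (x : ℂ) :
    ‖h x * h (-x)‖ ≤ ‖h 0‖ ^ 2 * Real.exp (2 * K * ‖x‖) := by
  have hlim : Tendsto (fun R : ℝ ↦ 4 * (C * (5 * R) ^ (3 / 2 : ℝ)) * (‖x‖ / (R / 2)) ^ 2) atTop
      (nhds 0) := by
    have h1 : Tendsto (fun R : ℝ ↦ (16 * C * 5 ^ (3 / 2 : ℝ) * ‖x‖ ^ 2) * R ^ (-(1 / 2) : ℝ)) atTop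
        (nhds ((16 * C * 5 ^ (3 / 2 : ℝ) * ‖x‖ ^ 2) * 0)) :=
      (tendsto_rpow_neg_atTop (by norm_num)).const_mul _
    rw [mul_zero] at h1
    refine h1.congr' ?_
    filter_upwards [eventually_gt_atTop 0] with R hR
    rw [Real.mul_rpow (by norm_num) hR.le]
    have : R ^ (3 / 2 : ℝ) = R ^ (-(1 / 2) : ℝ) * R ^ 2 := by
      rw [← Real.rpow_natCast, ← Real.rpow_add hR]; norm_num
    rw [this]
    field_simp
    ring
  have hlim' : Tendsto (fun R : ℝ ↦ ‖h 0‖ ^ 2 * Real.exp (2 * K * ‖x‖) *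
      Real.exp (4 * (C * (5 * R) ^ (3 / 2 : ℝ)) * (‖x‖ / (R / 2)) ^ 2)) atTop
      (nhds (‖h 0‖ ^ 2 * Real.exp (2 * K * ‖x‖) * Real.exp 0)) :=
    ((Real.continuous_exp.tendsto 0).comp hlim).const_mul _
  rw [Real.exp_zero, mul_one] at hlim'
  refine ge_of_tendsto hlim' ?_
  filter_upwards [eventually_ge_atTop 1, eventually_gt_atTop (2 * ‖x‖)] with R hR1 hRx
  refine norm_mul_neg_le_of_radius hd h0 hK (by linarith) (by positivity) (fun z hz ↦ ?_) (by linarith)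
  refine (hgrow z).trans ?_
  gcongr
  linarith

/-- Riemann's entire function, normalized by `ξ(s) = s (s - 1) Λ(s)`. -/
noncomputable def xiEntire (s : ℂ) : ℂ := s * (s - 1) * completedRiemannZeta₀ s + 1

lemma differentiable_xiEntire : Differentiable ℂ xiEntire := by
  unfold xiEntire
  have := differentiable_completedZeta₀
  fun_prop

lemma xiEntire_one_sub (s : ℂ) : xiEntire (1 - s) = xiEntire s := by
  unfold xiEntire
  rw [completedRiemannZeta₀_one_sub]; ring

lemma xiEntire_eq {s : ℂ} (hs : 0 < s.re) : xiEntire s = s * Gammaℝ s * riemannZeta₁ s := by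
  by_cases h1 : s = 1
  · subst h1; simp [xiEntire, Gammaℝ_one]
  have h0 : s ≠ 0 := fun h ↦ by rw [h] at hs; simp at hs
  have hsub : s - 1 ≠ 0 := sub_ne_zero.mpr h1
  have hz : riemannZeta₁ s = (s - 1) * riemannZeta s := by
    rw [riemannZeta_eq_inv_sub_mul h1, mul_inv_cancel_left₀ hsub]
  have hG := Gammaℝ_ne_zero_of_re_pos hs
  have h1s : 1 - s ≠ 0 := sub_ne_zero.mpr (Ne.symm h1)
  rw [hz, riemannZeta_def_of_ne_zero h0, completedRiemannZeta_eq]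
  unfold xiEntire
  field_simp
  ring

lemma norm_Gamma_le_Gamma_re {z : ℂ} (hz : 0 < z.re) : ‖Gamma z‖ ≤ Real.Gamma z.re := by
  rw [Gamma_eq_integral hz, Real.Gamma_eq_integral hz, GammaIntegral]
  refine (norm_integral_le_integral_norm _).trans (le_of_eq ?_)
  refine setIntegral_congr_fun measurableSet_Ioi fun t ht ↦ ?_
  simp only [norm_mul, norm_real, Real.norm_eq_abs, Real.abs_exp]
  rw [norm_cpow_eq_rpow_re_of_pos ht]
  simp

lemma Real.Gamma_le_factorial {x : ℝ} (hx : 1 / 4 ≤ x) {n : ℕ} (hn : x + 1 ≤ n) :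
    Real.Gamma x ≤ 16 / 5 * n.factorial := by
  have hx0 : x ≠ 0 := by positivity
  have h1 : Real.Gamma (x + 2) = (x + 1) * (x * Real.Gamma x) := by
    rw [← Real.Gamma_add_one hx0, ← Real.Gamma_add_one (by positivity)]; ring_nf
  have h2 : Real.Gamma (x + 2) ≤ n.factorial := by
    rw [← Real.Gamma_nat_eq_factorial]
    exact Real.Gamma_strictMonoOn_Ici.monotoneOn (by simp; linarith)
      (by simp only [mem_Ici]; linarith) (by linarith)
  have h3 : 0 < Real.Gamma x := Real.Gamma_pos_of_pos (by linarith)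
  have h4 : 5 / 16 ≤ (x + 1) * x := by nlinarith
  nlinarith

lemma exists_norm_xiEntire_le : ∃ A C : ℝ, 0 < A ∧ 0 < C ∧
    ∀ z : ℂ, ‖xiEntire (z + 1 / 2)‖ ≤ A * Real.exp (C * (1 + ‖z‖) ^ (3 / 2 : ℝ)) := by
  refine ⟨6 * 16 / 5 * 4, 3 + 2 * 3 ^ (3 / 2 : ℝ), by norm_num, by positivity, ?_⟩
  have key : ∀ z : ℂ, 0 ≤ z.re → ‖xiEntire (z + 1 / 2)‖ ≤
      (6 * 16 / 5 * 4) * Real.exp ((3 + 2 * 3 ^ (3 / 2 : ℝ)) * (1 + ‖z‖) ^ (3 / 2 : ℝ)) := by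
    intro z hz
    set s : ℂ := z + 1 / 2
    set r := ‖z‖
    have hr : 0 ≤ r := norm_nonneg _
    have hre : s.re = z.re + 1 / 2 := by simp [s]
    have hzr : z.re ≤ r := re_le_norm z
    have hs : ‖s‖ ≤ 1 + r := by
      refine (norm_add_le _ _).trans ?_
      norm_num
      linarith
    set n : ℕ := ⌈s.re / 2 + 1⌉₊
    have hn1 : s.re / 2 + 1 ≤ n := Nat.le_ceil _
    have hn2 : (n : ℝ) < s.re / 2 + 1 + 1 := Nat.ceil_lt_add_one (by linarith)
    have hn3 : (n : ℝ) ≤ 3 * (1 + r) := by linarith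
    have hnpos : (0 : ℝ) < n := by linarith
    have hhalf : (s / 2).re = s.re / 2 := by simp
    have hG : ‖Gammaℝ s‖ ≤ 16 / 5 * n.factorial := by
      rw [Gammaℝ_def, norm_mul]
      have h1 : ‖(Real.pi : ℂ) ^ (-s / 2)‖ ≤ 1 := by
        rw [norm_cpow_eq_rpow_re_of_pos Real.pi_pos]
        refine Real.rpow_le_one_of_one_le_of_nonpos (by linarith [Real.pi_gt_three]) ?_
        rw [neg_div, neg_re, hhalf]
        linarith
      have h2 : ‖Gamma (s / 2)‖ ≤ 16 / 5 * n.factorial := by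
        refine (norm_Gamma_le_Gamma_re (by rw [hhalf]; linarith)).trans ?_
        rw [hhalf]
        exact Real.Gamma_le_factorial (by linarith) hn1
      calc _ ≤ 1 * (16 / 5 * (n.factorial : ℝ)) := by gcongr
        _ = _ := one_mul _
    have hfac : (n.factorial : ℝ) ≤ Real.exp (2 * 3 ^ (3 / 2 : ℝ) * (1 + r) ^ (3 / 2 : ℝ)) := by
      have h1 : (n.factorial : ℝ) ≤ (n : ℝ) ^ n := by exact_mod_cast n.factorial_le_pow
      refine h1.trans ?_
      rw [← Real.exp_log (pow_pos hnpos n), Real.log_pow]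
      refine Real.exp_le_exp.mpr ?_
      have h2 := Real.log_le_rpow_div hnpos.le (ε := 1 / 2) (by norm_num)
      have h3 : (n : ℝ) ^ (3 / 2 : ℝ) = n * (n : ℝ) ^ (1 / 2 : ℝ) := by
        rw [← Real.rpow_one_add' hnpos.le (by norm_num)]; norm_num
      have h4 : (n : ℝ) ^ (3 / 2 : ℝ) ≤ (3 * (1 + r)) ^ (3 / 2 : ℝ) := by gcongr
      rw [Real.mul_rpow (by norm_num) (by positivity)] at h4
      have h5 : (n : ℝ) * Real.log n ≤ n * ((n : ℝ) ^ (1 / 2 : ℝ) / (1 / 2)) := by gcongr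
      linarith
    have hpow : (1 + r) ^ 3 ≤ Real.exp (3 * (1 + r) ^ (3 / 2 : ℝ)) := by
      have h1 : (1 + r) ≤ Real.exp ((1 + r) ^ (3 / 2 : ℝ)) := by
        have h2 : (1 + r) ^ (1 : ℝ) ≤ (1 + r) ^ (3 / 2 : ℝ) :=
          Real.rpow_le_rpow_of_exponent_le (by linarith) (by norm_num)
        rw [Real.rpow_one] at h2
        linarith [Real.add_one_le_exp ((1 + r) ^ (3 / 2 : ℝ))]
      calc (1 + r) ^ 3 ≤ Real.exp ((1 + r) ^ (3 / 2 : ℝ)) ^ 3 := by gcongr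
        _ = _ := by rw [← Real.exp_nat_mul]; norm_num
    have hf : ‖riemannZeta₁ s‖ ≤ 6 * 4 * (1 + r) ^ 2 := by
      refine (norm_riemannZeta₁_le (by linarith)).trans ?_
      have : (1 + ‖s‖) ^ 2 ≤ (2 * (1 + r)) ^ 2 := by
        have := norm_nonneg s
        gcongr
        linarith
      linarith
    rw [xiEntire_eq (by linarith), norm_mul, norm_mul]
    calc ‖s‖ * ‖Gammaℝ s‖ * ‖riemannZeta₁ s‖
        ≤ (1 + r) * (16 / 5 * n.factorial) * (6 * 4 * (1 + r) ^ 2) := by gcongr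
      _ = (6 * 16 / 5 * 4) * ((1 + r) ^ 3 * n.factorial) := by ring
      _ ≤ (6 * 16 / 5 * 4) * (Real.exp (3 * (1 + r) ^ (3 / 2 : ℝ)) *
          Real.exp (2 * 3 ^ (3 / 2 : ℝ) * (1 + r) ^ (3 / 2 : ℝ))) := by gcongr
      _ = _ := by rw [← Real.exp_add, add_mul]
  intro z
  rcases le_total 0 z.re with hz | hz
  · exact key z hz
  · have h1 := key (-z) (by simpa using hz)
    rw [norm_neg] at h1
    rwa [← xiEntire_one_sub, show 1 - (z + 1 / 2) = -z + 1 / 2 by ring]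

lemma re_pos_of_xiEntire_eq_zero {s : ℂ} (h : xiEntire s = 0) : 0 < s.re := by
  by_contra! hs
  have h1 : 0 < (1 - s).re := by simp; linarith
  rw [← xiEntire_one_sub, xiEntire_eq h1, mul_eq_zero, mul_eq_zero] at h
  have h0 : 1 - s ≠ 0 := fun e ↦ by rw [e] at h1; simp at h1
  have h2 : riemannZeta₁ (1 - s) = 0 := by
    simpa [h0, Gammaℝ_ne_zero_of_re_pos h1] using h
  have := ((riemannZeta₁_eq_zero_iff h1).mp h2).2
  simp at this
  linarith

lemma riemannZeta₁_eq_zero_of_xiEntire {s : ℂ} (h : xiEntire s = 0) : riemannZeta₁ s = 0 := by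
  have h1 := re_pos_of_xiEntire_eq_zero h
  have h0 : s ≠ 0 := fun e ↦ by rw [e] at h1; simp at h1
  rw [xiEntire_eq h1] at h
  simpa [h0, Gammaℝ_ne_zero_of_re_pos h1] using h

lemma analyticOrderNatAt_xiEntire {s : ℂ} (hs : 0 < s.re) :
    analyticOrderNatAt xiEntire s = zetaOrder s := by
  have hopen : IsOpen {z : ℂ | 0 < z.re} := isOpen_lt continuous_const continuous_re
  have hev : xiEntire =ᶠ[nhds s] (fun z ↦ z * Gammaℝ z) * riemannZeta₁ := by
    filter_upwards [hopen.mem_nhds hs] with z hz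
    exact xiEntire_eq hz
  have hΓ : AnalyticAt ℂ (fun z ↦ z * Gammaℝ z) s := by
    refine analyticAt_id.mul ?_
    have := (differentiable_Gammaℝ_inv.analyticAt s).inv
      (inv_ne_zero (Gammaℝ_ne_zero_of_re_pos hs))
    refine this.congr (Eventually.of_forall fun z ↦ ?_)
    simp
  have h0 : s ≠ 0 := fun e ↦ by rw [e] at hs; simp at hs
  have hne : s * Gammaℝ s ≠ 0 := mul_ne_zero h0 (Gammaℝ_ne_zero_of_re_pos hs)
  unfold zetaOrder analyticOrderNatAt
  rw [analyticOrderAt_congr hev, analyticOrderAt_mul hΓ (differentiable_riemannZeta₁.analyticAt s),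
    hΓ.analyticOrderAt_eq_zero.mpr hne, zero_add]

/-- The sum of the reciprocals of the nontrivial zeros of the zeta function diverges. -/
theorem exists_lt_sum_zetaOrder_div_norm (K : ℝ) : ∃ Z : Finset ℂ,
    (∀ ρ ∈ Z, riemannZeta₁ ρ = 0 ∧ 0 < ρ.re) ∧ K < ∑ ρ ∈ Z, (zetaOrder ρ : ℝ) / ‖ρ‖ := by
  by_contra! hcon
  set h : ℂ → ℂ := fun z ↦ xiEntire (z + 1 / 2)
  have hd : Differentiable ℂ h := by
    have := differentiable_xiEntire
    simp only [h]
    fun_prop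
  have h0 : h 0 ≠ 0 := by
    have h1 : (0 : ℝ) < (1 / 2 : ℂ).re := by norm_num
    simp only [h, zero_add]
    rw [xiEntire_eq h1]
    refine mul_ne_zero (mul_ne_zero (by norm_num) (Gammaℝ_ne_zero_of_re_pos h1)) ?_
    have := riemannZeta₁_real_ne_zero (x := 1 / 2) (by norm_num) (by norm_num)
    simpa using this
  have h0p : 0 < ‖h 0‖ := norm_pos_iff.mpr h0
  obtain ⟨δ, hδ, hδh⟩ : ∃ δ > 0, ∀ z, ‖z‖ < δ → h z ≠ 0 := by
    have := hd.continuous.continuousAt.eventually_ne h0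
    obtain ⟨δ, hδ, hb⟩ := Metric.eventually_nhds_iff.mp this
    exact ⟨δ, hδ, fun z hz ↦ hb (by simpa using hz)⟩
  set B : ℝ := 1 + 1 / (2 * δ)
  have hB : 0 < B := by positivity
  have hK : ∀ Z : Finset ℂ, (∀ β ∈ Z, h β = 0) →
      ∑ β ∈ Z, (analyticOrderNatAt h β : ℝ) / ‖β‖ ≤ B * K := by
    intro Z hZ
    have h2 := hcon (Z.map (addRightEmbedding (1 / 2))) (by
      intro ρ hρ
      obtain ⟨β, hβ, rfl⟩ := Finset.mem_map.mp hρ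
      exact ⟨riemannZeta₁_eq_zero_of_xiEntire (hZ β hβ), re_pos_of_xiEntire_eq_zero (hZ β hβ)⟩)
    rw [Finset.sum_map] at h2
    refine le_trans ?_ (mul_le_mul_of_nonneg_left h2 hB.le)
    rw [Finset.mul_sum]
    refine Finset.sum_le_sum fun β hβ ↦ ?_
    have hρ := re_pos_of_xiEntire_eq_zero (hZ β hβ)
    have hord : analyticOrderNatAt h β = zetaOrder (β + 1 / 2) := by
      rw [← analyticOrderNatAt_xiEntire hρ]
      exact analyticOrderNatAt_comp_add_const _ _ _
    have hβδ : δ ≤ ‖β‖ := by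
      by_contra! hlt
      exact hδh β hlt (hZ β hβ)
    have hβ0 : 0 < ‖β‖ := hδ.trans_le hβδ
    have hρ0 : 0 < ‖β + 1 / 2‖ := norm_pos_iff.mpr fun e ↦ by rw [e] at hρ; simp at hρ
    have hle : ‖β + 1 / 2‖ ≤ B * ‖β‖ := by
      have h3 := norm_add_le β (1 / 2)
      have h4 : ‖(1 / 2 : ℂ)‖ = 1 / 2 := by norm_num
      have h5 : 1 / 2 ≤ 1 / (2 * δ) * ‖β‖ := by
        rw [div_mul_eq_mul_div, one_mul, le_div_iff₀ (by positivity)]; linarith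
      simp only [B]
      linarith
    simp only [addRightEmbedding_apply, hord]
    rw [mul_div_assoc', div_le_div_iff₀ hβ0 hρ0]
    have := mul_le_mul_of_nonneg_left hle (Nat.cast_nonneg (α := ℝ) (zetaOrder (β + 1 / 2)))
    linarith
  obtain ⟨A, C, hA, hC, hAC⟩ := exists_norm_xiEntire_le
  have hgrow : ∀ z, ‖h z‖ ≤ ‖h 0‖ *
      Real.exp ((|Real.log (A / ‖h 0‖)| + C) * (1 + ‖z‖) ^ (3 / 2 : ℝ)) := by
    intro z
    refine (hAC z).trans ?_
    have h1 : 1 ≤ (1 + ‖z‖) ^ (3 / 2 : ℝ) :=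
      Real.one_le_rpow (by linarith [norm_nonneg z]) (by norm_num)
    have h2 : A ≤ ‖h 0‖ * Real.exp (|Real.log (A / ‖h 0‖)| * (1 + ‖z‖) ^ (3 / 2 : ℝ)) := by
      have h3 : Real.log (A / ‖h 0‖) ≤ |Real.log (A / ‖h 0‖)| * (1 + ‖z‖) ^ (3 / 2 : ℝ) :=
        (le_abs_self _).trans (le_mul_of_one_le_right (abs_nonneg _) h1)
      have h4 := Real.exp_le_exp.mpr h3
      rwa [Real.exp_log (by positivity), div_le_iff₀' h0p] at h4
    rw [add_mul, Real.exp_add, ← mul_assoc]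
    gcongr
  have hbound := norm_mul_neg_le_of_order hd h0 hK (by positivity) hgrow
  set E : ℝ := Real.exp (2 * (B * K)) * Real.pi
  set D : ℝ := 4 * ‖h 0‖ * Real.exp (3 / 2 * (B * K)) * Real.pi
  have hE : 0 < E := by positivity
  have hD : 0 < D := by positivity
  have hfact : ∀ k : ℕ, (k.factorial : ℝ) ≤ D * E ^ k := by
    intro k
    set x : ℂ := 2 * (k + 1 : ℕ) - 1 / 2
    have hx1 : h x = xiEntire (2 * (k + 1 : ℕ)) := by simp only [h, x]; ring_nf
    have hx2 : h (-x) = h x := by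
      simp only [h]; rw [← xiEntire_one_sub (x + 1 / 2)]; ring_nf
    have hxn : ‖x‖ = 2 * k + 3 / 2 := by
      have : x = ((2 * k + 3 / 2 : ℝ) : ℂ) := by simp only [x]; push_cast; ring
      rw [this, norm_real, Real.norm_of_nonneg (by positivity)]
    have h1 := hbound x
    rw [hx2, norm_mul, hxn] at h1
    have h2 : ‖h x‖ ≤ ‖h 0‖ * Real.exp (B * K * (2 * k + 3 / 2)) := by
      refine abs_le_of_sq_le_sq' ?_ (by positivity) |>.2
      rw [mul_pow, ← Real.exp_nat_mul, sq]
      refine h1.trans (le_of_eq ?_)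
      congr 2
      push_cast; ring
    have h3 : (k.factorial : ℝ) / (4 * Real.pi ^ (k + 1)) ≤ ‖h x‖ := by
      have hre : (2 : ℝ) ≤ (2 * (k + 1 : ℕ) : ℂ).re := by simp
      rw [hx1, xiEntire_eq (by linarith), norm_mul, norm_mul]
      have h4 := norm_riemannZeta₁_ge hre
      have h5 : ‖Gammaℝ (2 * (k + 1 : ℕ))‖ = k.factorial / Real.pi ^ (k + 1) := by
        rw [Gammaℝ_def, mul_div_cancel_left₀ _ two_ne_zero]
        rw [show -(2 * ((k + 1 : ℕ) : ℂ)) / 2 = -((k + 1 : ℕ) : ℂ) by ring, cpow_neg, cpow_natCast]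
        push_cast
        rw [Gamma_nat_eq_factorial, norm_mul, norm_inv, norm_pow, norm_real,
          Real.norm_of_nonneg Real.pi_pos.le, Complex.norm_natCast]
        field_simp
      have h6 : 1 ≤ ‖(2 * (k + 1 : ℕ) : ℂ)‖ := by
        have := abs_re_le_norm (2 * (k + 1 : ℕ) : ℂ)
        rw [abs_of_nonneg (by linarith)] at this
        linarith
      rw [h5]
      calc _ = 1 * (k.factorial / Real.pi ^ (k + 1)) * (1 / 4) := by field_simp
        _ ≤ _ := by gcongr
    have h4 := h3.trans h2
    rw [div_le_iff₀ (by positivity)] at h4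
    refine h4.trans (le_of_eq ?_)
    simp only [D, E]
    rw [mul_pow, ← Real.exp_nat_mul,
      show B * K * (2 * k + 3 / 2) = 3 / 2 * (B * K) + k * (2 * (B * K)) by ring, Real.exp_add]
    ring
  have hlim := (FloorSemiring.tendsto_pow_div_factorial_atTop E).const_mul D
  rw [mul_zero] at hlim
  obtain ⟨k, hk⟩ := (hlim.eventually_lt_const one_pos).exists
  have h1 := hfact k
  have h2 : (0 : ℝ) < k.factorial := by positivity
  rw [mul_div_assoc', div_lt_one h2] at hk
  linarith

end ManyZeros

section LaplaceL2
open Complex Set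

/-- Shifting a vertical line of integration. -/
lemma integral_vertical_eq_of_bound {F : ℂ → ℂ} {a b C : ℝ} (hab : a ≤ b)
    (hF : ∀ z : ℂ, a ≤ z.re → z.re ≤ b → DifferentiableAt ℂ F z)
    (hC : ∀ z : ℂ, a ≤ z.re → z.re ≤ b → ‖F z‖ ≤ C * (1 + z.im ^ 2)⁻¹) :
    ∫ t : ℝ, F (a + t * I) = ∫ t : ℝ, F (b + t * I) := by
  have hinteg : ∀ x : ℝ, a ≤ x → x ≤ b → Integrable (fun t : ℝ ↦ F (x + t * I)) := by
    intro x hax hxb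
    refine (integrable_inv_one_add_sq.const_mul C).mono' ?_ (ae_of_all _ fun t ↦ ?_)
    · refine Continuous.aestronglyMeasurable (continuous_iff_continuousAt.mpr fun t ↦ ?_)
      exact ContinuousAt.comp (f := fun t : ℝ ↦ (x + t * I : ℂ))
        (hF _ (by simpa using hax) (by simpa using hxb)).continuousAt (by fun_prop)
    · simpa using hC (x + t * I) (by simpa using hax) (by simpa using hxb)
  have hlim : ∀ x : ℝ, a ≤ x → x ≤ b → Tendsto
      (fun n : ℕ ↦ ∫ t in (-(n : ℝ))..n, F (x + t * I)) atTop (nhds (∫ t : ℝ, F (x + t * I))) :=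
    fun x hax hxb ↦ intervalIntegral_tendsto_integral (hinteg x hax hxb)
      (tendsto_neg_atTop_atBot.comp tendsto_natCast_atTop_atTop) tendsto_natCast_atTop_atTop
  have hrect : ∀ n : ℕ, ‖(∫ t in (-(n : ℝ))..n, F (b + t * I)) -
      ∫ t in (-(n : ℝ))..n, F (a + t * I)‖ ≤ 2 * (C * (1 + (n : ℝ) ^ 2)⁻¹ * |b - a|) := by
    intro n
    have h := integral_boundary_rect_eq_zero_of_differentiableOn F (a + (-(n : ℝ) : ℝ) * I)
      (b + (n : ℝ) * I) (by
        intro z hz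
        rw [mem_reProdIm] at hz
        have h1 := hz.1
        simp only [add_re, ofReal_re, mul_re, I_re, I_im, mul_zero, ofReal_im, sub_zero,
          mul_one, add_zero, uIcc_of_le hab, mem_Icc] at h1
        exact (hF z h1.1 h1.2).differentiableWithinAt)
    simp only [add_re, ofReal_re, mul_re, I_re, I_im, mul_zero, ofReal_im, sub_zero,
      mul_one, add_zero, add_im, mul_im, zero_add] at h
    have hh : ∀ y : ℝ, y ^ 2 = (n : ℝ) ^ 2 → ‖∫ x in a..b, F (x + y * I)‖ ≤
        C * (1 + (n : ℝ) ^ 2)⁻¹ * |b - a| := by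
      intro y hy
      refine intervalIntegral.norm_integral_le_of_norm_le_const fun x hx ↦ ?_
      rw [uIoc_of_le hab] at hx
      have := hC (x + y * I) (by simpa using hx.1.le) (by simpa using hx.2)
      simpa [hy] using this
    have h1 := hh (-(n : ℝ)) (by ring)
    have h2 := hh n rfl
    have h3 : I • ((∫ t in (-(n : ℝ))..n, F (b + t * I)) - ∫ t in (-(n : ℝ))..n, F (a + t * I)) =
        (∫ x in a..b, F (x + (n : ℝ) * I)) - ∫ x in a..b, F (x + (-(n : ℝ) : ℝ) * I) := by
      rw [smul_sub]
      linear_combination h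
    have h4 := norm_sub_le (∫ x in a..b, F (x + (n : ℝ) * I))
      (∫ x in a..b, F (x + (-(n : ℝ) : ℝ) * I))
    rw [← h3, norm_smul, norm_I, one_mul] at h4
    linarith
  have hz : Tendsto (fun n : ℕ ↦ 2 * (C * (1 + (n : ℝ) ^ 2)⁻¹ * |b - a|)) atTop (nhds 0) := by
    have h1 : Tendsto (fun n : ℕ ↦ (1 + (n : ℝ) ^ 2)⁻¹) atTop (nhds 0) := by
      refine tendsto_inv_atTop_zero.comp (tendsto_atTop_add_const_left _ _ ?_)
      exact (tendsto_pow_atTop two_ne_zero).comp tendsto_natCast_atTop_atTop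
    simpa using ((h1.const_mul C).mul_const |b - a|).const_mul 2
  have h1 := squeeze_zero_norm hrect hz
  have h2 := (hlim b hab le_rfl).sub (hlim a le_rfl hab)
  exact (sub_eq_zero.mp (tendsto_nhds_unique h2 h1)).symm

lemma integrable_mul_cexp {φ : ℝ → ℂ} (hφ : Continuous φ) (hs : HasCompactSupport φ) (w : ℂ) :
    Integrable (fun u : ℝ ↦ φ u * exp (w * u)) :=
  Continuous.integrable_of_hasCompactSupport (by fun_prop) hs.mul_right

lemma mul_integral_cexp {φ : ℝ → ℂ} (hφ : ContDiff ℝ 1 φ) (hs : HasCompactSupport φ) (w : ℂ) :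
    w * ∫ u : ℝ, φ u * exp (w * u) = -∫ u : ℝ, deriv φ u * exp (w * u) := by
  have hd : ∀ u : ℝ, HasDerivAt (fun u : ℝ ↦ exp (w * u)) (exp (w * u) * w) u := by
    intro u
    have := ((hasDerivAt_id (u : ℂ)).const_mul w).cexp.comp_ofReal
    simpa using this
  have h := integral_mul_deriv_eq_deriv_mul_of_integrable (u := φ) (u' := deriv φ)
    (v := fun u : ℝ ↦ exp (w * u)) (v' := fun u : ℝ ↦ exp (w * u) * w)
    (fun u _ ↦ (hφ.differentiable one_ne_zero u).hasDerivAt) (fun u _ ↦ hd u)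
    (Continuous.integrable_of_hasCompactSupport
      (by have := hφ.continuous; fun_prop) hs.mul_right)
    (integrable_mul_cexp (hφ.continuous_deriv le_rfl) hs.deriv w)
    (integrable_mul_cexp hφ.continuous hs w)
  rw [← h, ← integral_const_mul]
  congr 1; ext u; ring

lemma differentiable_integral_cexp {φ : ℝ → ℂ} (hφ : Continuous φ) (hs : HasCompactSupport φ) :
    Differentiable ℂ fun w ↦ ∫ u : ℝ, φ u * exp (w * u) := by
  intro w
  have hc : Continuous fun u : ℝ ↦ ‖φ u‖ * (|u| * Real.exp ((‖w‖ + 1) * |u|)) := by fun_prop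
  refine (hasDerivAt_integral_of_dominated_loc_of_deriv_le (𝕜 := ℂ) (μ := volume)
    (F := fun w (u : ℝ) ↦ φ u * exp (w * u))
    (F' := fun w (u : ℝ) ↦ φ u * (exp (w * u) * u)) (s := Metric.ball w 1)
    (bound := fun u ↦ ‖φ u‖ * (|u| * Real.exp ((‖w‖ + 1) * |u|)))
    (Metric.ball_mem_nhds w one_pos) ?_ (integrable_mul_cexp hφ hs w) ?_ ?_
    (hc.integrable_of_hasCompactSupport hs.norm.mul_right) ?_).2.differentiableAt
  · exact Eventually.of_forall fun w ↦ (integrable_mul_cexp hφ hs w).aestronglyMeasurable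
  · exact Continuous.aestronglyMeasurable (by fun_prop)
  · refine ae_of_all _ fun u z hz ↦ ?_
    rw [norm_mul, norm_mul, norm_real, norm_exp, Real.norm_eq_abs, mul_comm (Real.exp _)]
    gcongr
    rw [re_mul_ofReal]
    refine (le_abs_self _).trans ?_
    rw [abs_mul]
    gcongr
    refine (abs_re_le_norm z).trans ?_
    have := norm_sub_norm_le z w
    rw [Metric.mem_ball, dist_eq_norm] at hz
    linarith
  · refine ae_of_all _ fun u z hz ↦ ?_
    have := ((hasDerivAt_id z).mul_const (u : ℂ)).cexp.const_mul (φ u)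
    simpa using this

lemma exists_norm_integral_cexp_le {φ : ℝ → ℂ} (hφ : ContDiff ℝ 2 φ) (hs : HasCompactSupport φ)
    (c : ℝ) : ∃ C, ∀ w : ℂ, 0 ≤ w.re → w.re ≤ c →
      ‖∫ u : ℝ, φ u * exp (w * u)‖ ≤ C * (1 + w.im ^ 2)⁻¹ := by
  have hφ1 : ContDiff ℝ 1 φ := hφ.of_le (by norm_num)
  have hd1 : ContDiff ℝ 1 (deriv φ) := by
    have : ContDiff ℝ (1 + 1) φ := by norm_num; exact hφ
    exact (contDiff_succ_iff_deriv.mp this).2.2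
  set ψ := deriv (deriv φ)
  have hψc : Continuous ψ := hd1.continuous_deriv le_rfl
  have hψs : HasCompactSupport ψ := hs.deriv.deriv
  have hbd : ∀ χ : ℝ → ℂ, Continuous χ → HasCompactSupport χ → ∀ w : ℂ, 0 ≤ w.re → w.re ≤ c →
      ‖∫ u : ℝ, χ u * exp (w * u)‖ ≤ ∫ u : ℝ, ‖χ u‖ * Real.exp (c * |u|) := by
    intro χ hχ hχs w h0 hc
    refine norm_integral_le_of_norm_le (Continuous.integrable_of_hasCompactSupport
      (by fun_prop) hχs.norm.mul_right) (ae_of_all _ fun u ↦ ?_)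
    rw [norm_mul, norm_exp, re_mul_ofReal]
    refine mul_le_mul_of_nonneg_left (Real.exp_le_exp.mpr ?_) (norm_nonneg _)
    exact (mul_le_mul_of_nonneg_left (le_abs_self u) h0).trans
      (mul_le_mul_of_nonneg_right hc (abs_nonneg u))
  refine ⟨(∫ u : ℝ, ‖φ u‖ * Real.exp (c * |u|)) + ∫ u : ℝ, ‖ψ u‖ * Real.exp (c * |u|),
    fun w h0 hc ↦ ?_⟩
  have h1 := hbd φ hφ.continuous hs w h0 hc
  have h2 := hbd ψ hψc hψs w h0 hc
  have h3 : w ^ 2 * ∫ u : ℝ, φ u * exp (w * u) = ∫ u : ℝ, ψ u * exp (w * u) := by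
    rw [sq, mul_assoc, mul_integral_cexp hφ1 hs, mul_neg, mul_integral_cexp hd1 hs.deriv, neg_neg]
  rw [← h3, norm_mul, norm_pow] at h2
  have h4 : w.im ^ 2 ≤ ‖w‖ ^ 2 := by
    rw [← sq_abs w.im]; gcongr; exact abs_im_le_norm w
  rw [← div_eq_mul_inv, le_div_iff₀ (by positivity)]
  nlinarith [mul_le_mul_of_nonneg_right h4 (norm_nonneg (∫ u : ℝ, φ u * exp (w * u)))]

open FourierTransform SchwartzMap in
lemma norm_integral_mul_le_of_laplace {q : ℝ → ℂ} {H : ℂ → ℂ} {C σ b : ℝ} (hσb : σ ≤ b)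
    (hq : Integrable fun u : ℝ ↦ q u * exp (-b * u))
    (hH : ∀ z : ℂ, σ ≤ z.re → z.re ≤ b → DifferentiableAt ℂ H z)
    (hHC : ∀ z : ℂ, σ ≤ z.re → z.re ≤ b → ‖H z‖ ≤ C)
    (hlap : ∀ t : ℝ, H (b + t * I) = ∫ u : ℝ, q u * exp (-(b + t * I) * u))
    (hH2 : Integrable fun t : ℝ ↦ ‖H (σ + t * I)‖ ^ 2)
    {φ : ℝ → ℂ} (hφ : ContDiff ℝ (⊤ : ℕ∞) φ) (hs : HasCompactSupport φ) :
    ‖∫ u : ℝ, q u * exp (-σ * u) * φ u‖ ≤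
      1 / 2 * ((2 * Real.pi)⁻¹ * (∫ t : ℝ, ‖H (σ + t * I)‖ ^ 2) + ∫ u : ℝ, ‖φ u‖ ^ 2) := by
  set E : ℂ → ℂ := fun w ↦ ∫ u : ℝ, φ u * exp (w * u)
  have hφ2 : ContDiff ℝ 2 φ := hφ.of_le (WithTop.coe_le_coe.mpr (le_top : (2 : ℕ∞) ≤ ⊤))
  have hEd : Differentiable ℂ E := differentiable_integral_cexp hφ.continuous hs
  obtain ⟨C', hC'⟩ := exists_norm_integral_cexp_le hφ2 hs (b - σ)
  have hC0 : 0 ≤ C := (norm_nonneg _).trans (hHC σ (by simp) (by simpa using hσb))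
  have hshift := integral_vertical_eq_of_bound (F := fun z ↦ H z * E (z - σ)) (C := C * C') hσb
    (fun z h1 h2 ↦ (hH z h1 h2).mul (by fun_prop)) (fun z h1 h2 ↦ by
      rw [norm_mul, mul_assoc]
      have := hC' (z - σ) (by simpa using h1) (by simpa using h2)
      simp only [sub_im, ofReal_im, sub_zero] at this
      exact mul_le_mul (hHC z h1 h2) this (norm_nonneg _) hC0)
  simp only [add_sub_cancel_left] at hshift
  set φb : ℝ → ℂ := fun u ↦ φ u * exp ((b - σ) * u)
  have hφbs : HasCompactSupport φb := hs.mul_right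
  have hφbc : ContDiff ℝ (⊤ : ℕ∞) φb := by
    refine hφ.mul ?_
    have : ContDiff ℝ (⊤ : ℕ∞) fun u : ℝ ↦ ((b - σ) * u : ℂ) :=
      contDiff_const.mul ofRealCLM.contDiff
    exact this.cexp
  set Φb := hφbs.toSchwartzMap hφbc
  set Φ := hs.toSchwartzMap hφ
  have hinv : ∀ t : ℝ, 𝓕⁻ Φ t = E (2 * Real.pi * t * I) := by
    intro t
    rw [SchwartzMap.fourierInv_coe, Real.fourierInv_eq']
    refine integral_congr_ae (ae_of_all _ fun u ↦ ?_)
    simp only [Φ, smul_eq_mul, RCLike.inner_apply, conj_trivial]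
    rw [mul_comm]
    congr 2
    push_cast; ring
  have hinvb : ∀ t : ℝ, 𝓕⁻ Φb t = E (b + (2 * Real.pi * t : ℝ) * I - σ) := by
    intro t
    rw [SchwartzMap.fourierInv_coe, Real.fourierInv_eq']
    refine integral_congr_ae (ae_of_all _ fun u ↦ ?_)
    simp only [smul_eq_mul, RCLike.inner_apply, conj_trivial]
    change _ * (φ u * exp ((b - σ) * u)) = _
    rw [mul_comm, mul_assoc, ← exp_add]
    congr 2
    push_cast; ring
  set qb : ℝ → ℂ := fun u ↦ q u * exp (-b * u)
  have hfour : ∀ t : ℝ, 𝓕 qb t = H (b + (2 * Real.pi * t : ℝ) * I) := by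
    intro t
    rw [hlap, Real.fourier_eq']
    refine integral_congr_ae (ae_of_all _ fun u ↦ ?_)
    simp only [qb, smul_eq_mul, RCLike.inner_apply, conj_trivial]
    rw [mul_comm, mul_assoc, ← exp_add]
    congr 2
    push_cast; ring
  have hpi : (0 : ℝ) < 2 * Real.pi := by positivity
  have hparseval : ∫ t : ℝ, H (b + t * I) * E (b + t * I - σ) =
      (2 * Real.pi) * ∫ u : ℝ, q u * exp (-σ * u) * φ u := by
    have h1 := Measure.integral_comp_mul_left
      (fun t : ℝ ↦ H (b + t * I) * E (b + t * I - σ)) (2 * Real.pi)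
    have h2 : ∫ t : ℝ, 𝓕 qb t • (𝓕⁻ Φb) t = ∫ u : ℝ, qb u • 𝓕 (⇑(𝓕⁻ Φb : 𝓢(ℝ, ℂ))) u := by
      have := VectorFourier.integral_fourierIntegral_smul_eq_flip (μ := volume) (ν := volume)
        (L := innerₗ ℝ) Real.continuous_fourierChar continuous_inner hq (𝓕⁻ Φb).integrable
      rw [flip_innerₗ] at this
      exact this
    have h3 : ∀ u, 𝓕 (⇑(𝓕⁻ Φb : 𝓢(ℝ, ℂ))) u = φb u := by
      intro u
      rw [← SchwartzMap.fourier_coe, FourierTransform.fourier_fourierInv_eq]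
      rfl
    simp only [hfour, hinvb, h3, smul_eq_mul] at h2
    rw [h2] at h1
    rw [abs_of_pos (inv_pos.mpr hpi)] at h1
    have h4 : ∫ u : ℝ, qb u * φb u = ∫ u : ℝ, q u * exp (-σ * u) * φ u := by
      refine integral_congr_ae (ae_of_all _ fun u ↦ ?_)
      simp only [qb, φb]
      rw [show (-σ * u : ℂ) = -b * u + (b - σ) * u by ring, exp_add]; ring
    rw [← h4, h1, real_smul]
    push_cast
    rw [← mul_assoc, mul_inv_cancel₀ (by exact_mod_cast hpi.ne'), one_mul]
  have hEL2 : ∫ t : ℝ, ‖E (t * I)‖ ^ 2 = 2 * Real.pi * ∫ u : ℝ, ‖φ u‖ ^ 2 := by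
    have h1 := Measure.integral_comp_mul_left (fun t : ℝ ↦ ‖E (t * I)‖ ^ 2) (2 * Real.pi)
    have h2 := SchwartzMap.integral_norm_sq_fourier (𝓕⁻ Φ)
    rw [FourierTransform.fourier_fourierInv_eq] at h2
    have h3 : ∀ t : ℝ, ‖E ((2 * Real.pi * t : ℝ) * I)‖ ^ 2 = ‖𝓕⁻ Φ t‖ ^ 2 := by
      intro t; rw [hinv]; push_cast; rfl
    simp only [h3] at h1
    rw [← h2] at h1
    have h4 : ∫ u, ‖Φ u‖ ^ 2 = ∫ u, ‖φ u‖ ^ 2 := rfl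
    rw [← h4, h1, abs_of_pos (inv_pos.mpr hpi), smul_eq_mul, mul_inv_cancel_left₀ hpi.ne']
  have hEint : Integrable fun t : ℝ ↦ ‖E (t * I)‖ ^ 2 := by
    have h1 : Integrable fun t : ℝ ↦ ‖𝓕⁻ Φ t‖ ^ 2 := by
      have := ((𝓕⁻ Φ).memLp 2 volume).integrable_norm_pow two_ne_zero
      simpa using this
    have h2 := h1.comp_mul_left' (R := (2 * Real.pi)⁻¹) (by positivity)
    refine h2.congr (ae_of_all _ fun t ↦ ?_)
    simp only [hinv]
    congr 3
    push_cast
    field_simp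
  have hnorm : ‖∫ t : ℝ, H (σ + t * I) * E (t * I)‖ ≤
      1 / 2 * ((∫ t : ℝ, ‖H (σ + t * I)‖ ^ 2) + ∫ t : ℝ, ‖E (t * I)‖ ^ 2) := by
    rw [← integral_add hH2 hEint, ← integral_const_mul]
    refine norm_integral_le_of_norm_le ((hH2.add hEint).const_mul _) (ae_of_all _ fun t ↦ ?_)
    simp only [norm_mul]
    nlinarith [sq_nonneg (‖H (σ + t * I)‖ - ‖E (t * I)‖)]
  rw [hshift, hparseval, hEL2, norm_mul] at hnorm
  have h2pi : ‖(2 * Real.pi : ℂ)‖ = 2 * Real.pi := by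
    rw [show (2 * Real.pi : ℂ) = ((2 * Real.pi : ℝ) : ℂ) by push_cast; rfl, norm_real,
      Real.norm_of_nonneg hpi.le]
  rw [h2pi] at hnorm
  refine le_of_mul_le_mul_left (hnorm.trans (le_of_eq ?_)) hpi
  generalize (∫ t : ℝ, ‖H (σ + t * I)‖ ^ 2) = A
  field_simp

lemma MeasureTheory.MemLp.exists_contDiff_integral_norm_sub_sq_le {v : ℝ → ℂ} (hv : MemLp v 2)
    {η : ℝ} (hη : 0 < η) : ∃ g : ℝ → ℂ, HasCompactSupport g ∧ ContDiff ℝ (⊤ : ℕ∞) g ∧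
      Integrable (fun u ↦ ‖v u - g u‖ ^ 2) ∧ ∫ u, ‖v u - g u‖ ^ 2 ≤ η ^ 2 := by
  obtain ⟨g, hgs, hgc, hg⟩ := hv.exist_eLpNorm_sub_le (by simp) (by norm_num) hη
  have hm : MemLp (v - g) 2 := hv.sub (hgc.continuous.memLp_of_hasCompactSupport hgs)
  refine ⟨g, hgs, hgc, by simpa using hm.integrable_norm_pow two_ne_zero, ?_⟩
  rw [hm.eLpNorm_eq_integral_rpow_norm two_ne_zero (by simp),
    ENNReal.ofReal_le_ofReal_iff hη.le] at hg
  simp only [ENNReal.toReal_ofNat, Real.rpow_ofNat, Pi.sub_apply] at hg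
  have h0 : 0 ≤ ∫ u, ‖v u - g u‖ ^ 2 := integral_nonneg fun u ↦ by positivity
  calc _ = ((∫ u, ‖v u - g u‖ ^ 2) ^ (2 : ℝ)⁻¹) ^ 2 := by
        rw [← Real.rpow_natCast, ← Real.rpow_mul h0]; norm_num
    _ ≤ η ^ 2 := by gcongr

/-- A weighted `L²` bound for a function whose Laplace transform continues analytically. -/
theorem integral_norm_sq_le_of_laplace {q : ℝ → ℂ} {H : ℂ → ℂ} {A a C σ b : ℝ} (hσb : σ ≤ b)
    (hab : a < b) (hqm : AEStronglyMeasurable q) (hq0 : ∀ u < 0, q u = 0)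
    (hqA : ∀ u, 0 ≤ u → ‖q u‖ ≤ A * Real.exp (a * u))
    (hH : ∀ z : ℂ, σ ≤ z.re → z.re ≤ b → DifferentiableAt ℂ H z)
    (hHC : ∀ z : ℂ, σ ≤ z.re → z.re ≤ b → ‖H z‖ ≤ C)
    (hlap : ∀ t : ℝ, H (b + t * I) = ∫ u : ℝ, q u * exp (-(b + t * I) * u))
    (hH2 : Integrable fun t : ℝ ↦ ‖H (σ + t * I)‖ ^ 2) (T : ℝ) (hT : 0 ≤ T) :
    ∫ u in Ioc 0 T, (‖q u‖ * Real.exp (-σ * u)) ^ 2 ≤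
      (2 * Real.pi)⁻¹ * ∫ t : ℝ, ‖H (σ + t * I)‖ ^ 2 := by
  have hA : 0 ≤ A := by
    have := (norm_nonneg _).trans (hqA 0 le_rfl)
    simpa using this
  have hexpm : ∀ c : ℝ, AEStronglyMeasurable (fun u : ℝ ↦ q u * exp (c * u)) := fun c ↦
    hqm.mul (Continuous.aestronglyMeasurable (by fun_prop))
  have hnexp : ∀ c u : ℝ, ‖exp (c * u : ℂ)‖ = Real.exp (c * u) := fun c u ↦ by
    rw [norm_exp]; simp
  have hq : Integrable fun u : ℝ ↦ q u * exp (-b * u) := by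
    have h1 : Integrable (fun u : ℝ ↦ (Ioi (0 : ℝ)).indicator
        (fun u ↦ A * Real.exp (-(b - a) * u)) u) := by
      rw [integrable_indicator_iff measurableSet_Ioi]
      exact (exp_neg_integrableOn_Ioi 0 (by linarith)).const_mul A
    refine h1.mono' (by simpa using hexpm (-b)) ?_
    have h0 : ∀ᵐ u : ℝ, u ≠ 0 := by simp [ae_iff]
    filter_upwards [h0] with u hu
    rcases lt_or_gt_of_ne hu with hu | hu
    · simp [hq0 u hu, hu.le]
    · rw [indicator_of_mem (mem_Ioi.mpr hu), norm_mul, ← ofReal_neg, hnexp]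
      calc _ ≤ A * Real.exp (a * u) * Real.exp (-b * u) := by gcongr; exact hqA u hu.le
        _ = _ := by rw [mul_assoc, ← Real.exp_add]; ring_nf
  set Q : ℝ → ℂ := fun u ↦ q u * exp (-σ * u)
  have hQm : AEStronglyMeasurable Q := by simpa [Q] using hexpm (-σ)
  have hQn : ∀ u, ‖Q u‖ = ‖q u‖ * Real.exp (-σ * u) := fun u ↦ by
    simp only [Q]; rw [norm_mul, ← ofReal_neg, hnexp]
  set R : ℝ := T + 2
  set B : ℝ := A * Real.exp (|a| * R) * Real.exp (|σ| * R)
  have hB : 0 ≤ B := by positivity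
  have hQB : ∀ u, |u| ≤ R → ‖Q u‖ ≤ B := by
    intro u hu
    rcases lt_or_ge u 0 with h | h
    · simp [Q, hq0 u h, hB]
    · rw [hQn]
      have hexp : ∀ c : ℝ, Real.exp (c * u) ≤ Real.exp (|c| * R) := fun c ↦ by
        refine Real.exp_le_exp.mpr ((le_abs_self _).trans ?_)
        rw [abs_mul]
        gcongr
      have h1 := hexp (-σ)
      rw [abs_neg] at h1
      calc _ ≤ A * Real.exp (a * u) * Real.exp (-σ * u) := by gcongr; exact hqA u h
        _ ≤ _ := by
          exact mul_le_mul (mul_le_mul_of_nonneg_left (hexp a) hA) h1 (by positivity) (by positivity)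
  set J : ℝ := ∫ u in Ioc 0 T, (‖q u‖ * Real.exp (-σ * u)) ^ 2
  set M : ℝ := (2 * Real.pi)⁻¹ * ∫ t : ℝ, ‖H (σ + t * I)‖ ^ 2
  set v : ℝ → ℂ := (Ioc 0 T).indicator fun u ↦ (starRingEnd ℂ) (Q u)
  set K : Set ℝ := Icc (-R) R
  have hR : 0 < R := by simp only [R]; linarith
  have hTK : Ioc 0 T ⊆ K := fun u hu ↦ ⟨by linarith [hu.1], by simp only [R]; linarith [hu.2]⟩
  have hvm : AEStronglyMeasurable v :=
    (continuous_conj.comp_aestronglyMeasurable hQm).indicator measurableSet_Ioc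
  have hkint : ∀ c : ℝ, Integrable (K.indicator fun _ ↦ c) := fun c ↦ by
    rw [integrable_indicator_iff measurableSet_Icc]
    exact integrableOn_const (by simp)
  have hvB : ∀ u, ‖v u‖ ^ 2 ≤ K.indicator (fun _ ↦ B ^ 2) u := by
    intro u
    by_cases hu : u ∈ Ioc 0 T
    · rw [indicator_of_mem (hTK hu)]
      simp only [v, indicator_of_mem hu, RCLike.norm_conj]
      have := hQB u (abs_le.mpr (hTK hu))
      gcongr
    · simp only [v, indicator_of_notMem hu, norm_zero]
      exact (by norm_num : (0 : ℝ) ^ 2 = 0).le.trans (indicator_nonneg (fun _ _ ↦ by positivity) u)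
  have hv2 : Integrable fun u ↦ ‖v u‖ ^ 2 :=
    (hkint (B ^ 2)).mono' (hvm.norm.pow 2) (ae_of_all _ fun u ↦ by
      rw [Real.norm_of_nonneg (by positivity)]; exact hvB u)
  have hvL : MemLp v 2 := (memLp_two_iff_integrable_sq_norm hvm).mpr hv2
  have hvJ : ∫ u, ‖v u‖ ^ 2 = J := by
    simp only [J]
    rw [← integral_indicator measurableSet_Ioc]
    congr 1; ext u
    by_cases hu : u ∈ Ioc 0 T
    · simp only [v, indicator_of_mem hu, RCLike.norm_conj, hQn]
    · simp [v, indicator_of_notMem hu]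
  have hQv : ∀ u, Q u * v u = ((‖v u‖ ^ 2 : ℝ) : ℂ) := by
    intro u
    by_cases hu : u ∈ Ioc 0 T
    · simp only [v, indicator_of_mem hu, RCLike.norm_conj]
      rw [mul_conj, normSq_eq_norm_sq]
    · simp [v, indicator_of_notMem hu]
  have hJ0 : 0 ≤ J := hvJ ▸ integral_nonneg fun u ↦ by positivity
  let χ : ContDiffBump (T / 2) := ⟨T / 2 + 1, T / 2 + 2, by linarith, by linarith⟩
  set D : ℝ := B ^ 2 * (2 * R) + 1
  have hD : 0 ≤ D := by positivity
  have key : ∀ η : ℝ, 0 < η →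
      J ≤ 1 / 2 * (M + ((1 + η) * J + (1 + 1 / η) * η ^ 2)) + η * D := by
    intro η hη
    obtain ⟨g, hgs, hgc, hgi, hg⟩ := hvL.exists_contDiff_integral_norm_sub_sq_le hη
    set φ : ℝ → ℂ := fun u ↦ (χ u : ℂ) * g u
    have hφs : HasCompactSupport φ := hgs.mul_left
    have hφc : ContDiff ℝ (⊤ : ℕ∞) φ := (ofRealCLM.contDiff.comp χ.contDiff).mul hgc
    have hmain := norm_integral_mul_le_of_laplace hσb hq hH hHC hlap hH2 hφc hφs
    set e : ℝ → ℂ := fun u ↦ φ u - v u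
    have hem : AEStronglyMeasurable e := hφc.continuous.aestronglyMeasurable.sub hvm
    have hχv : ∀ u, (χ u : ℂ) * v u = v u := by
      intro u
      by_cases hu : u ∈ Ioc 0 T
      · rw [χ.one_of_mem_closedBall]
        · simp
        · rw [Real.closedBall_eq_Icc]
          exact ⟨by simp only [χ]; linarith [hu.1], by simp only [χ]; linarith [hu.2]⟩
      · simp [v, indicator_of_notMem hu]
    have hee : ∀ u, ‖e u‖ ^ 2 ≤ ‖v u - g u‖ ^ 2 := by
      intro u
      have : e u = (χ u : ℂ) * (g u - v u) := by simp only [e, φ]; rw [mul_sub, hχv]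
      rw [this, norm_mul, norm_real, Real.norm_of_nonneg χ.nonneg, norm_sub_rev (v u)]
      refine pow_le_pow_left₀ (mul_nonneg χ.nonneg (norm_nonneg _)) ?_ 2
      exact mul_le_of_le_one_left (norm_nonneg _) χ.le_one
    have hei : Integrable fun u ↦ ‖e u‖ ^ 2 := hgi.mono' (hem.norm.pow 2) (ae_of_all _ fun u ↦ by
      rw [Real.norm_of_nonneg (by positivity)]; exact hee u)
    have he2 : ∫ u, ‖e u‖ ^ 2 ≤ η ^ 2 := (integral_mono hei hgi hee).trans hg
    have heK : ∀ u, u ∉ K → e u = 0 := by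
      intro u hu
      have h1 : χ u = 0 := by
        by_contra hne
        have : u ∈ Function.support χ := hne
        rw [χ.support_eq, Real.ball_eq_Ioo] at this
        simp only [χ] at this
        exact hu ⟨by simp only [R]; linarith [this.1], by simp only [R]; linarith [this.2]⟩
      have h2 : u ∉ Ioc 0 T := fun h ↦ hu (hTK h)
      simp [e, φ, h1, v, indicator_of_notMem h2]
    have hQe : ∀ u, ‖Q u * e u‖ ≤ η * K.indicator (fun _ ↦ B ^ 2) u + 1 / η * ‖e u‖ ^ 2 := by
      intro u
      by_cases hu : u ∈ K
      · rw [indicator_of_mem hu, norm_mul]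
        have h1 := hQB u (abs_le.mpr hu)
        have h2 : ‖Q u‖ * ‖e u‖ ≤ B * ‖e u‖ := by gcongr
        have h3 : 0 ≤ 1 / η * (η * B - ‖e u‖) ^ 2 := by positivity
        have h4 : 1 / η * (η * B - ‖e u‖) ^ 2 =
            η * B ^ 2 + 1 / η * ‖e u‖ ^ 2 - 2 * (B * ‖e u‖) := by field_simp; ring
        have h5 : 0 ≤ B * ‖e u‖ := by positivity
        linarith
      · simp [heK u hu, indicator_of_notMem hu]
    have hQei' := ((hkint (B ^ 2)).const_mul η).add (hei.const_mul (1 / η))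
    have hQei : Integrable fun u ↦ Q u * e u := hQei'.mono' (hQm.mul hem) (ae_of_all _ hQe)
    have hQe2 : ‖∫ u, Q u * e u‖ ≤ η * D := by
      refine (norm_integral_le_of_norm_le hQei' (ae_of_all _ hQe)).trans ?_
      simp only [Pi.add_apply]
      rw [integral_add ((hkint _).const_mul η) (hei.const_mul _), integral_const_mul,
        integral_const_mul, integral_indicator measurableSet_Icc, setIntegral_const]
      have h1 : volume.real K = 2 * R := by
        simp only [K]
        rw [Real.volume_real_Icc_of_le (by linarith)]; ring
      rw [h1, smul_eq_mul]
      have h2 : 1 / η * (∫ u, ‖e u‖ ^ 2) ≤ 1 / η * η ^ 2 := by gcongr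
      have h3 : 1 / η * η ^ 2 = η := by field_simp
      simp only [D]
      linarith
    have hφ2 : ∫ u, ‖φ u‖ ^ 2 ≤ (1 + η) * J + (1 + 1 / η) * η ^ 2 := by
      have hpt : ∀ u, ‖φ u‖ ^ 2 ≤ (1 + η) * ‖v u‖ ^ 2 + (1 + 1 / η) * ‖e u‖ ^ 2 := by
        intro u
        have h1 : φ u = v u + e u := by simp [e]
        have h2 : ‖φ u‖ ≤ ‖v u‖ + ‖e u‖ := h1 ▸ norm_add_le _ _
        have h3 : ‖φ u‖ ^ 2 ≤ (‖v u‖ + ‖e u‖) ^ 2 := by gcongr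
        have h4 : 0 ≤ 1 / η * (η * ‖v u‖ - ‖e u‖) ^ 2 := by positivity
        have h5 : 1 / η * (η * ‖v u‖ - ‖e u‖) ^ 2 =
            η * ‖v u‖ ^ 2 + 1 / η * ‖e u‖ ^ 2 - 2 * (‖v u‖ * ‖e u‖) := by field_simp; ring
        nlinarith
      have hi := (hv2.const_mul (1 + η)).add (hei.const_mul (1 + 1 / η))
      have hφi : Integrable fun u ↦ ‖φ u‖ ^ 2 := hi.mono'
        (hφc.continuous.aestronglyMeasurable.norm.pow 2) (ae_of_all _ fun u ↦ by
          rw [Real.norm_of_nonneg (by positivity)]; exact hpt u)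
      refine (integral_mono hφi hi hpt).trans ?_
      simp only [Pi.add_apply]
      rw [integral_add (hv2.const_mul _) (hei.const_mul _), integral_const_mul,
        integral_const_mul, hvJ]
      gcongr
    have hsum : ((J : ℝ) : ℂ) = (∫ u, Q u * φ u) - ∫ u, Q u * e u := by
      have h1 : Integrable fun u ↦ Q u * v u := by
        simp only [hQv]; exact hv2.ofReal
      have h2 : ∫ u, Q u * φ u = (∫ u, Q u * v u) + ∫ u, Q u * e u := by
        rw [← integral_add h1 hQei]
        congr 1; ext u; simp only [e]; ring
      rw [h2, add_sub_cancel_right]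
      simp only [hQv]
      rw [integral_complex_ofReal, hvJ]
    have hJn : J = ‖((J : ℝ) : ℂ)‖ := by rw [norm_real, Real.norm_of_nonneg hJ0]
    rw [hJn, hsum]
    refine (norm_sub_le _ _).trans ?_
    rw [← hsum, ← hJn]
    refine add_le_add (hmain.trans ?_) hQe2
    gcongr
  have hlim : Tendsto (fun η : ℝ ↦ 1 / 2 * (M + ((1 + η) * J + (1 + 1 / η) * η ^ 2)) + η * D)
      (nhdsWithin 0 (Ioi 0)) (nhds (1 / 2 * (M + ((1 + 0) * J + (0 ^ 2 + 0))) + 0 * D)) := by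
    have h1 : Tendsto (fun η : ℝ ↦ 1 / 2 * (M + ((1 + η) * J + (η ^ 2 + η))) + η * D)
        (nhdsWithin 0 (Ioi 0)) (nhds (1 / 2 * (M + ((1 + 0) * J + (0 ^ 2 + 0))) + 0 * D)) :=
      (Continuous.tendsto (by fun_prop) 0).mono_left nhdsWithin_le_nhds
    refine h1.congr' ?_
    filter_upwards [self_mem_nhdsWithin] with η hη
    have : η ≠ 0 := ne_of_gt hη
    field_simp
  have := ge_of_tendsto hlim (by filter_upwards [self_mem_nhdsWithin] with η hη using key η hη)
  linarith

end LaplaceL2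

theorem integral_Ioi_one_eq_integral_exp {E : Type*} [NormedAddCommGroup E] [NormedSpace ℝ E]
    (g : ℝ → E) :
    ∫ t in Set.Ioi (1 : ℝ), g t = ∫ u in Set.Ioi (0 : ℝ), Real.exp u • g (Real.exp u) := by
  have himg : Real.exp '' Set.Ioi 0 = Set.Ioi 1 := by
    ext t
    constructor
    · rintro ⟨u, hu, rfl⟩
      exact Real.one_lt_exp_iff.mpr hu
    · intro ht
      exact ⟨Real.log t, Real.log_pos ht, Real.exp_log (one_pos.trans ht)⟩
  rw [← himg, integral_image_eq_integral_abs_deriv_smul measurableSet_Ioi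
    (fun x _ ↦ (Real.hasDerivAt_exp x).hasDerivWithinAt) Real.exp_injective.injOn]
  simp [Real.abs_exp]

theorem measurable_psi : Measurable Chebyshev.psi := Chebyshev.psi_mono.measurable

theorem exists_psi_exp_le : ∃ A : ℝ, 0 < A ∧ ∀ u : ℝ, Chebyshev.psi (Real.exp u) ≤ A * Real.exp u := by
  refine ⟨Real.log 4 + 4, by positivity, fun u ↦ ?_⟩
  exact Chebyshev.psi_le_const_mul_self (Real.exp_pos u).le

theorem integrableOn_psi_mul_exp {s : ℂ} (hs : 1 < s.re) :
    IntegrableOn (fun u : ℝ ↦ (Chebyshev.psi (Real.exp u) : ℂ) * Complex.exp (-s * u))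
      (Set.Ioi 0) := by
  obtain ⟨A, hA, hA'⟩ := exists_psi_exp_le
  have h1 : IntegrableOn (fun u : ℝ ↦ A * Real.exp ((1 - s.re) * u)) (Set.Ioi 0) :=
    (integrableOn_exp_mul_Ioi (by linarith) 0).const_mul A
  refine h1.mono' ?_ ?_
  · apply Measurable.aestronglyMeasurable
    have := measurable_psi.comp Real.measurable_exp
    exact (Complex.measurable_ofReal.comp this).mul (by fun_prop)
  · refine Eventually.of_forall fun u ↦ ?_
    rw [norm_mul, Complex.norm_exp, Complex.norm_real, Real.norm_of_nonneg (Chebyshev.psi_nonneg _)]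
    have : (-s * (u : ℂ)).re = -s.re * u := by simp
    rw [this]
    calc Chebyshev.psi (Real.exp u) * Real.exp (-s.re * u)
        ≤ A * Real.exp u * Real.exp (-s.re * u) := by
          gcongr
          exact hA' u
      _ = _ := by rw [mul_assoc, ← Real.exp_add]; ring_nf

theorem laplace_psi {s : ℂ} (hs : 1 < s.re) :
    ∫ u in Set.Ioi (0 : ℝ), (Chebyshev.psi (Real.exp u) : ℂ) * Complex.exp (-s * u) =
      -(deriv riemannZeta s / riemannZeta s) / s := by
  have hs0 : s ≠ 0 := by rintro rfl; simp at hs; linarith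
  have hsum : ∀ n : ℕ, ∑ k ∈ Finset.Icc 1 n, ArithmeticFunction.vonMangoldt k
      = Chebyshev.psi n := by
    intro n
    rw [Chebyshev.psi, Nat.floor_natCast]
    rfl
  have h := LSeries_eq_mul_integral_of_nonneg (fun n ↦ ArithmeticFunction.vonMangoldt n)
    zero_le_one hs ?_ (fun n ↦ ArithmeticFunction.vonMangoldt_nonneg)
  · rw [ArithmeticFunction.LSeries_vonMangoldt_eq_deriv_riemannZeta_div hs] at h
    rw [← neg_div, h, mul_div_cancel_left₀ _ hs0, integral_Ioi_one_eq_integral_exp]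
    refine setIntegral_congr_fun measurableSet_Ioi fun u _ ↦ ?_
    have h1 : (∑ k ∈ Finset.Icc 1 ⌊Real.exp u⌋₊, (ArithmeticFunction.vonMangoldt k : ℂ))
        = (Chebyshev.psi (Real.exp u) : ℂ) := by
      rw [Chebyshev.psi_eq_psi_coe_floor, ← hsum]
      push_cast
      rfl
    have h2 : ((Real.exp u : ℝ) : ℂ) ^ (-(s + 1)) = Complex.exp (-(s + 1) * u) := by
      rw [Complex.cpow_def_of_ne_zero (by exact_mod_cast (Real.exp_pos u).ne'),
        ← Complex.ofReal_log (Real.exp_pos u).le, Real.log_exp, mul_comm]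
    rw [h1, h2, Complex.real_smul, mul_left_comm, Complex.ofReal_exp, ← Complex.exp_add]
    ring_nf
  · refine Asymptotics.IsBigO.of_bound (Real.log 4 + 4) (Eventually.of_forall fun n ↦ ?_)
    rw [hsum, Real.norm_of_nonneg (Chebyshev.psi_nonneg _), Real.rpow_one,
      Real.norm_of_nonneg n.cast_nonneg]
    exact Chebyshev.psi_le_const_mul_self n.cast_nonneg

/-- The normalised error term in the prime number theorem for `ψ`, on the logarithmic scale. -/
noncomputable def psiError (u : ℝ) : ℝ :=
  if 0 ≤ u then (Chebyshev.psi (Real.exp u) - Real.exp u) * Real.exp (-u / 2) else 0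

theorem measurable_psiError : Measurable psiError := by
  have := measurable_psi.comp Real.measurable_exp
  refine Measurable.ite measurableSet_Ici ?_ measurable_const
  exact (this.sub Real.measurable_exp).mul (by fun_prop)

theorem exists_abs_psiError_le : ∃ A : ℝ, 0 < A ∧ ∀ u : ℝ, |psiError u| ≤ A * Real.exp (u / 2) := by
  obtain ⟨A, hA, hA'⟩ := exists_psi_exp_le
  refine ⟨A + 1, by positivity, fun u ↦ ?_⟩
  unfold psiError
  split_ifs
  · rw [abs_mul, Real.abs_exp]
    have h1 : |Chebyshev.psi (Real.exp u) - Real.exp u| ≤ (A + 1) * Real.exp u := by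
      have := hA' u
      have := Chebyshev.psi_nonneg (Real.exp u)
      have := Real.exp_pos u
      rw [abs_le]
      constructor <;> nlinarith
    calc _ ≤ (A + 1) * Real.exp u * Real.exp (-u / 2) := by gcongr
      _ = _ := by rw [mul_assoc, ← Real.exp_add]; ring_nf
  · simp only [abs_zero]; positivity

theorem logDeriv_riemannZeta₁ {s : ℂ} (hs : 1 < s.re) :
    logDeriv riemannZeta₁ s = 1 / (s - 1) + deriv riemannZeta s / riemannZeta s := by
  have hs1 : s ≠ 1 := by rintro rfl; simp at hs
  have hz : riemannZeta s ≠ 0 := riemannZeta_ne_zero_of_one_le_re hs.le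
  have heq : riemannZeta₁ =ᶠ[nhds s] fun z ↦ (z - 1) * riemannZeta z := by
    filter_upwards [isOpen_ne.mem_nhds hs1] with z hz
    rw [riemannZeta_eq_inv_sub_mul hz, ← mul_assoc, mul_inv_cancel₀ (sub_ne_zero.mpr hz), one_mul]
  have hd : HasDerivAt (fun z ↦ (z - 1) * riemannZeta z)
      (1 * riemannZeta s + (s - 1) * deriv riemannZeta s) s :=
    ((hasDerivAt_id s).sub_const 1).mul (differentiableAt_riemannZeta hs1).hasDerivAt
  rw [logDeriv_apply, heq.deriv_eq, hd.deriv, heq.eq_of_nhds]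
  have := sub_ne_zero.mpr hs1
  field_simp

theorem laplace_psiError {z : ℂ} (hz : 1 / 2 < z.re) :
    ∫ u : ℝ, (psiError u : ℂ) * Complex.exp (-z * u) =
      -(1 / (z + 1 / 2)) * (1 + logDeriv riemannZeta₁ (z + 1 / 2)) := by
  set s := z + 1 / 2 with hs
  have hsre : 1 < s.re := by
    rw [hs]; simp; norm_num at hz ⊢; linarith
  have hs0 : s ≠ 0 := by intro h; rw [h] at hsre; simp at hsre; linarith
  have hs1 : s - 1 ≠ 0 := by
    intro h; rw [sub_eq_zero.mp h] at hsre; simp at hsre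
  have h1 : (fun u : ℝ ↦ (psiError u : ℂ) * Complex.exp (-z * u)) =
      (Set.Ici (0 : ℝ)).indicator fun u : ℝ ↦
        (Chebyshev.psi (Real.exp u) : ℂ) * Complex.exp (-s * u) - Complex.exp ((1 - s) * u) := by
    ext u
    by_cases hu : 0 ≤ u
    · rw [Set.indicator_of_mem (Set.mem_Ici.mpr hu), psiError, if_pos hu]
      push_cast
      rw [sub_mul, sub_mul, mul_assoc, ← Complex.exp_add, mul_assoc, ← Complex.exp_add,
        ← Complex.exp_add, hs]
      ring_nf
    · rw [Set.indicator_of_notMem (by simpa using hu), psiError, if_neg hu]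
      simp
  rw [h1, integral_indicator measurableSet_Ici, integral_Ici_eq_integral_Ioi,
    integral_sub (integrableOn_psi_mul_exp hsre), laplace_psi hsre,
    integral_exp_mul_complex_Ioi (by simpa using hsre), logDeriv_riemannZeta₁ hsre]
  · have : 1 - s ≠ 0 := by rw [← neg_sub]; exact neg_ne_zero.mpr hs1
    have h3 : 1 - s = -(s - 1) := by ring
    simp only [Complex.ofReal_zero, mul_zero, Complex.exp_zero]
    rw [h3]
    field_simp
    ring
  · exact integrableOn_exp_mul_complex_Ioi (by simpa using hsre) 0

theorem finite_critical_zeros (N : ℕ) :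
    {ρ : ℂ | riemannZeta₁ ρ = 0 ∧ ρ.re = 1 / 2 ∧ |ρ.im| ≤ N}.Finite := by
  refine (finite_zeros_of_differentiable (c := 2) differentiable_riemannZeta₁ ?_
    (isCompact_closedBall (0 : ℂ) (N + 1))).subset ?_
  · intro h
    have := norm_riemannZeta₁_ge (s := 2) (by simp)
    rw [h] at this
    norm_num at this
  · rintro ρ ⟨h1, h2, h3⟩
    refine ⟨?_, h1⟩
    rw [mem_closedBall_zero_iff]
    have := Complex.norm_le_abs_re_add_abs_im ρ
    rw [h2, abs_of_pos (by norm_num)] at this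
    linarith

/-- The zeros of `ζ` on the critical line of height at most `N`. -/
noncomputable def criticalZeros (N : ℕ) : Finset ℂ := (finite_critical_zeros N).toFinset

theorem mem_criticalZeros {N : ℕ} {ρ : ℂ} :
    ρ ∈ criticalZeros N ↔ riemannZeta₁ ρ = 0 ∧ ρ.re = 1 / 2 ∧ |ρ.im| ≤ N := by
  simp [criticalZeros]

/-- The Laplace transform of the normalised error term, with the contribution of the zeros in `S`
removed. -/
noncomputable def laplaceResidual (S : Finset ℂ) (z : ℂ) : ℂ :=
  -(1 / (z + 1 / 2)) * (1 + logDeriv riemannZeta₁ (z + 1 / 2)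
    - ∑ ρ ∈ S, (zetaOrder ρ : ℂ) / (z + 1 / 2 - ρ) - ∑ ρ ∈ S, (zetaOrder ρ : ℂ) / ρ)

theorem exists_laplaceResidual_block_bound
    (hRH : ∀ ρ, riemannZeta₁ ρ = 0 → 0 < ρ.re → ρ.re = 1 / 2) :
    ∃ C : ℝ, 0 < C ∧ ∀ S : Finset ℂ, (∀ ρ ∈ S, riemannZeta₁ ρ = 0 ∧ ρ.re = 1 / 2) →
      ∃ K : ℝ, 0 ≤ K ∧ ∀ n : ℤ, ∃ W : Finset ℂ,
        (∀ ρ ∈ W, riemannZeta₁ ρ = 0 ∧ ρ.re = 1 / 2 ∧ |ρ.im - (n + 1 / 2)| ≤ 1.7 ∧ ρ ∉ S) ∧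
        (∑ ρ ∈ W, (zetaOrder ρ : ℝ)) ≤ C * Real.log (3 + |(n : ℝ) + 1 / 2|) ∧
        ∀ z : ℂ, 0 < z.re → z.re ≤ 1 → n ≤ z.im → z.im ≤ n + 1 →
          ‖laplaceResidual S z‖ ≤ (1 / ‖z + 1 / 2‖) * (K * Real.log (3 + |(n : ℝ) + 1 / 2|) +
            ‖∑ ρ ∈ W, (zetaOrder ρ : ℂ) / (z + 1 / 2 - ρ)‖) := by
  classical
  obtain ⟨C, hC, hloc⟩ := exists_zeta_local_bound
  refine ⟨C, hC, fun S hS ↦ ?_⟩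
  refine ⟨C + 1 + ∑ ρ ∈ S, (zetaOrder ρ : ℝ) / ‖ρ‖ + 4 * ∑ ρ ∈ S, (zetaOrder ρ : ℝ),
    by positivity, fun n ↦ ?_⟩
  set c : ℂ := ⟨2, n + 1 / 2⟩ with hc
  have hfin := finite_zeros_of_differentiable (c := 2) differentiable_riemannZeta₁ (by
    intro h
    have := norm_riemannZeta₁_ge (s := 2) (by simp)
    rw [h] at this
    norm_num at this) (isCompact_closedBall c 1.7)
  set Z := hfin.toFinset with hZ
  have hZmem : ∀ z, z ∈ Z ↔ riemannZeta₁ z = 0 ∧ ‖z - c‖ ≤ 1.7 := by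
    intro z
    rw [hZ, Set.Finite.mem_toFinset, Set.mem_ofPred_eq, Metric.mem_closedBall, dist_eq_norm, and_comm]
  obtain ⟨hsum, hld⟩ := hloc c rfl Z hZmem
  set L := Real.log (3 + |(n : ℝ) + 1 / 2|) with hL
  have hL1 : 1 ≤ L := by
    rw [hL, Real.le_log_iff_exp_le (by positivity)]
    have := Real.exp_one_lt_d9
    have := abs_nonneg ((n : ℝ) + 1 / 2)
    linarith
  have hZre : ∀ z ∈ Z, z.re = 1 / 2 := by
    intro z hz
    obtain ⟨h1, h2⟩ := (hZmem z).1 hz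
    refine hRH z h1 ?_
    have := (Complex.abs_re_le_norm (z - c)).trans h2
    rw [abs_le] at this
    have h3 : (z - c).re = z.re - 2 := by simp [hc]
    rw [h3] at this
    norm_num at this
    linarith
  refine ⟨Z \ S, ?_, ?_, ?_⟩
  · intro ρ hρ
    obtain ⟨h1, h2⟩ := Finset.mem_sdiff.1 hρ
    refine ⟨((hZmem ρ).1 h1).1, hZre ρ h1, ?_, h2⟩
    have := (Complex.abs_im_le_norm (ρ - c)).trans ((hZmem ρ).1 h1).2
    simpa [hc] using this
  · refine le_trans (Finset.sum_le_sum_of_subset_of_nonneg Finset.sdiff_subset ?_) hsum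
    intros; positivity
  intro z hz0 hz1 hn0 hn1
  set s := z + 1 / 2 with hs
  have hsre : s.re = z.re + 1 / 2 := by simp [hs]
  have hsim : s.im = z.im := by simp [hs]
  have hsc : ‖s - c‖ ≤ 1.6 := by
    rw [Complex.norm_def]
    apply Real.sqrt_le_iff.2 ⟨by norm_num, ?_⟩
    rw [Complex.normSq_apply]
    have h1 : (s - c).re = z.re - 3 / 2 := by simp [hsre, hc]; ring
    have h2 : (s - c).im = z.im - (n + 1 / 2) := by simp [hsim, hc]
    rw [h1, h2]
    nlinarith
  have hs0 : riemannZeta₁ s ≠ 0 := by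
    intro h
    have := hRH s h (by rw [hsre]; linarith)
    rw [hsre] at this
    linarith
  have hmain := hld s hsc hs0
  have hdecomp : (∑ ρ ∈ Z, (zetaOrder ρ : ℂ) / (s - ρ)) - ∑ ρ ∈ S, (zetaOrder ρ : ℂ) / (s - ρ) =
      (∑ ρ ∈ Z \ S, (zetaOrder ρ : ℂ) / (s - ρ)) - ∑ ρ ∈ S \ Z, (zetaOrder ρ : ℂ) / (s - ρ) := by
    rw [← Finset.sum_sdiff_sub_sum_sdiff]
  have hfar : ‖∑ ρ ∈ S \ Z, (zetaOrder ρ : ℂ) / (s - ρ)‖ ≤ 4 * ∑ ρ ∈ S, (zetaOrder ρ : ℝ) := by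
    have hstep : ‖∑ ρ ∈ S \ Z, (zetaOrder ρ : ℂ) / (s - ρ)‖ ≤
        ∑ ρ ∈ S \ Z, 4 * (zetaOrder ρ : ℝ) := by
      refine norm_sum_le_of_le _ fun ρ hρ ↦ ?_
      obtain ⟨h1, h2⟩ := Finset.mem_sdiff.1 hρ
      obtain ⟨h3, h4⟩ := hS ρ h1
      have h5 : 1.7 < ‖ρ - c‖ := by
        by_contra hcon
        exact h2 ((hZmem ρ).2 ⟨h3, not_lt.1 hcon⟩)
      have h6 : (1.7 : ℝ) ^ 2 < ‖ρ - c‖ ^ 2 := by gcongr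
      rw [Complex.sq_norm, Complex.normSq_apply] at h6
      have h7 : (ρ - c).re = -(3 / 2) := by simp [hc, h4]; norm_num
      have h8 : (ρ - c).im = ρ.im - (n + 1 / 2) := by simp [hc]
      rw [h7, h8] at h6
      have h9 : 0.8 < |ρ.im - (n + 1 / 2)| := by
        apply lt_of_pow_lt_pow_left₀ 2 (abs_nonneg _)
        rw [sq_abs]
        nlinarith
      have h10 : 0.3 ≤ |s.im - ρ.im| := by
        rw [hsim]
        have : |z.im - (n + 1 / 2)| ≤ 1 / 2 := by rw [abs_le]; constructor <;> linarith
        have h11 := abs_sub_abs_le_abs_sub (ρ.im - (n + 1 / 2)) (z.im - (n + 1 / 2))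
        rw [abs_sub_comm]
        have h12 : ρ.im - (n + 1 / 2) - (z.im - (n + 1 / 2)) = ρ.im - z.im := by ring
        rw [h12] at h11
        norm_num at h9 ⊢
        linarith
      have h11 : 0.3 ≤ ‖s - ρ‖ := by
        refine h10.trans ?_
        simpa using Complex.abs_im_le_norm (s - ρ)
      rw [norm_div, Complex.norm_natCast, div_le_iff₀ ((by norm_num : (0 : ℝ) < 0.3).trans_le h11)]
      have : (0 : ℝ) ≤ zetaOrder ρ := by positivity
      nlinarith
    refine hstep.trans ?_
    rw [← Finset.mul_sum]
    gcongr
    exact Finset.sdiff_subset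
  have hrho : ‖∑ ρ ∈ S, (zetaOrder ρ : ℂ) / ρ‖ ≤ ∑ ρ ∈ S, (zetaOrder ρ : ℝ) / ‖ρ‖ := by
    refine norm_sum_le_of_le _ fun ρ _ ↦ ?_
    rw [norm_div, Complex.norm_natCast]
  rw [laplaceResidual, ← hs, norm_mul, norm_neg, norm_div, norm_one]
  refine mul_le_mul_of_nonneg_left ?_ (by positivity)
  set A := ∑ ρ ∈ S, (zetaOrder ρ : ℝ) / ‖ρ‖
  set B := ∑ ρ ∈ S, (zetaOrder ρ : ℝ)
  have hA : 0 ≤ A := by positivity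
  have hB : 0 ≤ B := by positivity
  have heq : 1 + logDeriv riemannZeta₁ s - ∑ ρ ∈ S, (zetaOrder ρ : ℂ) / (s - ρ)
      - ∑ ρ ∈ S, (zetaOrder ρ : ℂ) / ρ =
      1 + (logDeriv riemannZeta₁ s - ∑ ρ ∈ Z, (zetaOrder ρ : ℂ) / (s - ρ)) +
      (∑ ρ ∈ Z \ S, (zetaOrder ρ : ℂ) / (s - ρ)) + (-(∑ ρ ∈ S \ Z, (zetaOrder ρ : ℂ) / (s - ρ))) +
      (-∑ ρ ∈ S, (zetaOrder ρ : ℂ) / ρ) := by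
    linear_combination hdecomp
  rw [heq]
  refine (norm_add_le _ _).trans ?_
  refine (add_le_add_left (norm_add_le _ _) _).trans ?_
  refine (add_le_add_left (add_le_add_left (norm_add_le _ _) _) _).trans ?_
  refine (add_le_add_left (add_le_add_left (add_le_add_left (norm_add_le _ _) _) _) _).trans ?_
  rw [norm_neg, norm_neg, norm_one]
  nlinarith [mul_le_mul_of_nonneg_left hL1 hA, mul_le_mul_of_nonneg_left hL1 hB]

theorem log_three_add_abs_le {n : ℤ} {x : ℝ} (h0 : n ≤ x) (h1 : x ≤ n + 1) :
    Real.log (3 + |(n : ℝ) + 1 / 2|) ≤ 5 / 2 + |x| := by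
  have h := Real.log_le_sub_one_of_pos (x := 3 + |(n : ℝ) + 1 / 2|) (by positivity)
  have h2 : |(n : ℝ) + 1 / 2| ≤ |x| + 1 / 2 := by
    have h3 : (n : ℝ) + 1 / 2 = x + ((n : ℝ) + 1 / 2 - x) := by ring
    rw [h3]
    refine (abs_add_le _ _).trans ?_
    gcongr
    rw [abs_le]
    constructor <;> linarith
  linarith

theorem laplaceResidual_bounded
    (hRH : ∀ ρ, riemannZeta₁ ρ = 0 → 0 < ρ.re → ρ.re = 1 / 2) {S : Finset ℂ}
    (hS : ∀ ρ ∈ S, riemannZeta₁ ρ = 0 ∧ ρ.re = 1 / 2) {σ : ℝ} (hσ : 0 < σ) :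
    ∃ B : ℝ, ∀ z : ℂ, σ ≤ z.re → z.re ≤ 1 → ‖laplaceResidual S z‖ ≤ B := by
  obtain ⟨C, hC, h⟩ := exists_laplaceResidual_block_bound hRH
  obtain ⟨K, hK, h⟩ := h S hS
  refine ⟨6 * (K + C / σ), fun z hz0 hz1 ↦ ?_⟩
  obtain ⟨W, hW, hWsum, hb⟩ := h ⌊z.im⌋
  have hb := hb z (hσ.trans_le hz0) hz1 (Int.floor_le _) (Int.lt_floor_add_one _).le
  set L := Real.log (3 + |(⌊z.im⌋ : ℝ) + 1 / 2|) with hL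
  have hL0 : 0 ≤ L := Real.log_nonneg (by linarith [abs_nonneg ((⌊z.im⌋ : ℝ) + 1 / 2)])
  have hLz : L ≤ 5 / 2 + |z.im| :=
    log_three_add_abs_le (Int.floor_le _) (Int.lt_floor_add_one _).le
  have hsre : (z + 1 / 2).re = z.re + 1 / 2 := by simp
  have hsim : (z + 1 / 2).im = z.im := by simp
  have h1 : 1 / 2 ≤ ‖z + 1 / 2‖ := by
    have := Complex.re_le_norm (z + 1 / 2)
    rw [hsre] at this
    linarith
  have h2 : |z.im| ≤ ‖z + 1 / 2‖ := by
    have := Complex.abs_im_le_norm (z + 1 / 2)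
    rwa [hsim] at this
  have hsum : ‖∑ ρ ∈ W, (zetaOrder ρ : ℂ) / (z + 1 / 2 - ρ)‖ ≤ C * L / σ := by
    have : ‖∑ ρ ∈ W, (zetaOrder ρ : ℂ) / (z + 1 / 2 - ρ)‖ ≤ ∑ ρ ∈ W, (zetaOrder ρ : ℝ) / σ := by
      refine norm_sum_le_of_le _ fun ρ hρ ↦ ?_
      rw [norm_div, Complex.norm_natCast]
      gcongr
      have h3 := Complex.re_le_norm (z + 1 / 2 - ρ)
      rw [Complex.sub_re, hsre, (hW ρ hρ).2.1] at h3
      linarith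
    refine this.trans ?_
    rw [← Finset.sum_div]
    gcongr
  calc ‖laplaceResidual S z‖ ≤ (1 / ‖z + 1 / 2‖) * (K * L + C * L / σ) := by
        refine hb.trans ?_
        gcongr
    _ = (L / ‖z + 1 / 2‖) * (K + C / σ) := by ring
    _ ≤ 6 * (K + C / σ) := by
        gcongr
        rw [div_le_iff₀ (by linarith)]
        linarith

theorem integral_inv_sq_add_sq_le {σ : ℝ} (hσ : 0 < σ) (γ : ℝ) :
    Integrable (fun t : ℝ ↦ 1 / (σ ^ 2 + (t - γ) ^ 2)) ∧
      ∫ t : ℝ, 1 / (σ ^ 2 + (t - γ) ^ 2) = Real.pi / σ := by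
  have h1 : (fun t : ℝ ↦ 1 / (σ ^ 2 + (t - γ) ^ 2)) =
      fun t ↦ (fun y : ℝ ↦ (σ ^ 2)⁻¹ * (1 + (y / σ) ^ 2)⁻¹) (t - γ) := by
    ext t
    field_simp
  constructor
  · rw [h1]
    exact ((integrable_inv_one_add_sq.comp_div hσ.ne').const_mul _).comp_sub_right γ
  · rw [h1, integral_sub_right_eq_self (fun y : ℝ ↦ (σ ^ 2)⁻¹ * (1 + (y / σ) ^ 2)⁻¹),
      integral_const_mul, Measure.integral_comp_div (fun y : ℝ ↦ (1 + y ^ 2)⁻¹),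
      integral_univ_inv_one_add_sq, abs_of_pos hσ, smul_eq_mul]
    field_simp

theorem laplaceResidual_block_integral_le
    (hRH : ∀ ρ, riemannZeta₁ ρ = 0 → 0 < ρ.re → ρ.re = 1 / 2) :
    ∃ C : ℝ, 0 < C ∧ ∀ N : ℕ, ∃ K : ℝ, 0 ≤ K ∧ ∀ σ : ℝ, 0 < σ → σ ≤ 1 → ∀ n : ℤ,
      ∫⁻ t in Set.Ico (n : ℝ) (n + 1), ENNReal.ofReal
          (‖laplaceResidual (criticalZeros N) (σ + t * Complex.I)‖ ^ 2) ≤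
        ENNReal.ofReal (Real.log (3 + |(n : ℝ) + 1 / 2|) ^ 2 / (1 + (n : ℝ) ^ 2) *
          (K + (if (N : ℝ) < |(n : ℝ)| + 3 then C / σ else 0))) := by
  obtain ⟨C, hC, h⟩ := exists_laplaceResidual_block_bound hRH
  refine ⟨24 * C ^ 2 * Real.pi, by positivity, fun N ↦ ?_⟩
  obtain ⟨K, hK, h⟩ := h (criticalZeros N) fun ρ hρ ↦
    ⟨(mem_criticalZeros.1 hρ).1, (mem_criticalZeros.1 hρ).2.1⟩
  refine ⟨24 * K ^ 2, by positivity, fun σ hσ hσ1 n ↦ ?_⟩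
  obtain ⟨W, hW, hWsum, hb⟩ := h n
  set L := Real.log (3 + |(n : ℝ) + 1 / 2|) with hL
  have hL0 : 0 ≤ L := Real.log_nonneg (by linarith [abs_nonneg ((n : ℝ) + 1 / 2)])
  set D : ℝ := 24 / (1 + (n : ℝ) ^ 2) with hD
  have hpt : ∀ t ∈ Set.Ico (n : ℝ) (n + 1),
      ‖laplaceResidual (criticalZeros N) (σ + t * Complex.I)‖ ^ 2 ≤
        D * (K ^ 2 * L ^ 2 + C * L * ∑ ρ ∈ W, (zetaOrder ρ : ℝ) * (1 / (σ ^ 2 + (t - ρ.im) ^ 2))) := by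
    rintro t ⟨ht0, ht1⟩
    have hb := hb (σ + t * Complex.I) (by simpa using hσ) (by simpa using hσ1)
      (by simpa using ht0) (by simpa using ht1.le)
    set s : ℂ := σ + t * Complex.I + 1 / 2 with hs
    have hsre : s.re = σ + 1 / 2 := by simp [hs]
    have hsim : s.im = t := by simp [hs]
    have hs2 : 1 / 4 + t ^ 2 ≤ ‖s‖ ^ 2 := by
      rw [Complex.sq_norm, Complex.normSq_apply, hsre, hsim]
      nlinarith
    have hn2 : 1 + (n : ℝ) ^ 2 ≤ 12 * ‖s‖ ^ 2 := by
      have : (n : ℝ) ^ 2 ≤ 2 * t ^ 2 + 2 := by nlinarith [sq_nonneg (2 * t - n), sq_nonneg (t + (t - n))]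
      nlinarith [sq_nonneg t]
    have hcs : ‖∑ ρ ∈ W, (zetaOrder ρ : ℂ) / (s - ρ)‖ ^ 2 ≤
        C * L * ∑ ρ ∈ W, (zetaOrder ρ : ℝ) * (1 / (σ ^ 2 + (t - ρ.im) ^ 2)) := by
      have h1 : ‖∑ ρ ∈ W, (zetaOrder ρ : ℂ) / (s - ρ)‖ ≤ ∑ ρ ∈ W, (zetaOrder ρ : ℝ) / ‖s - ρ‖ := by
        refine norm_sum_le_of_le _ fun ρ _ ↦ ?_
        rw [norm_div, Complex.norm_natCast]
      have h2 : ∀ ρ ∈ W, ‖s - ρ‖ ^ 2 = σ ^ 2 + (t - ρ.im) ^ 2 := by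
        intro ρ hρ
        rw [Complex.sq_norm, Complex.normSq_apply, Complex.sub_re, Complex.sub_im, hsre, hsim,
          (hW ρ hρ).2.1]
        ring
      calc ‖∑ ρ ∈ W, (zetaOrder ρ : ℂ) / (s - ρ)‖ ^ 2
          ≤ (∑ ρ ∈ W, (zetaOrder ρ : ℝ) / ‖s - ρ‖) ^ 2 := by gcongr
        _ ≤ (∑ ρ ∈ W, (zetaOrder ρ : ℝ)) *
            ∑ ρ ∈ W, (zetaOrder ρ : ℝ) * (1 / (σ ^ 2 + (t - ρ.im) ^ 2)) := by
          refine Finset.sum_sq_le_sum_mul_sum_of_sq_le_mul W (fun _ _ ↦ by positivity)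
            (fun _ _ ↦ by positivity) fun ρ hρ ↦ le_of_eq ?_
          rw [← h2 ρ hρ]
          ring
        _ ≤ _ := by gcongr
    have hspos : 0 < ‖s‖ ^ 2 := by nlinarith [sq_nonneg t]
    calc ‖laplaceResidual (criticalZeros N) (σ + t * Complex.I)‖ ^ 2
        ≤ ((1 / ‖s‖) * (K * L + ‖∑ ρ ∈ W, (zetaOrder ρ : ℂ) / (s - ρ)‖)) ^ 2 := by gcongr
      _ = (1 / ‖s‖ ^ 2) * (K * L + ‖∑ ρ ∈ W, (zetaOrder ρ : ℂ) / (s - ρ)‖) ^ 2 := by ring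
      _ ≤ (12 / (1 + (n : ℝ) ^ 2)) *
          (2 * (K ^ 2 * L ^ 2 + ‖∑ ρ ∈ W, (zetaOrder ρ : ℂ) / (s - ρ)‖ ^ 2)) := by
        refine mul_le_mul ?_ ?_ (by positivity) (by positivity)
        · rw [div_le_div_iff₀ hspos (by positivity)]
          linarith
        · nlinarith [sq_nonneg (K * L - ‖∑ ρ ∈ W, (zetaOrder ρ : ℂ) / (s - ρ)‖)]
      _ = D * (K ^ 2 * L ^ 2 + ‖∑ ρ ∈ W, (zetaOrder ρ : ℂ) / (s - ρ)‖ ^ 2) := by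
        rw [hD]; ring
      _ ≤ _ := by gcongr
  set g : ℝ → ℝ := fun t ↦
    D * (K ^ 2 * L ^ 2 + C * L * ∑ ρ ∈ W, (zetaOrder ρ : ℝ) * (1 / (σ ^ 2 + (t - ρ.im) ^ 2))) with hg
  have hsumint : Integrable fun t : ℝ ↦
      ∑ ρ ∈ W, (zetaOrder ρ : ℝ) * (1 / (σ ^ 2 + (t - ρ.im) ^ 2)) :=
    integrable_finsetSum _ fun ρ _ ↦ (integral_inv_sq_add_sq_le hσ ρ.im).1.const_mul _
  have hgint : IntegrableOn g (Set.Ico (n : ℝ) (n + 1)) := by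
    refine Integrable.const_mul (Integrable.add ?_ ?_) _
    · exact integrableOn_const (by simp)
    · exact (hsumint.const_mul _).integrableOn
  have hg0 : ∀ t, 0 ≤ g t := fun t ↦ by positivity
  calc ∫⁻ t in Set.Ico (n : ℝ) (n + 1), ENNReal.ofReal
          (‖laplaceResidual (criticalZeros N) (σ + t * Complex.I)‖ ^ 2)
      ≤ ∫⁻ t in Set.Ico (n : ℝ) (n + 1), ENNReal.ofReal (g t) :=
        setLIntegral_mono' measurableSet_Ico fun t ht ↦ ENNReal.ofReal_le_ofReal (hpt t ht)
    _ = ENNReal.ofReal (∫ t in Set.Ico (n : ℝ) (n + 1), g t) :=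
        (ofReal_integral_eq_lintegral_ofReal hgint (Eventually.of_forall hg0)).symm
    _ ≤ _ := by
      refine ENNReal.ofReal_le_ofReal ?_
      have h1 : ∫ t in Set.Ico (n : ℝ) (n + 1), g t =
          D * (K ^ 2 * L ^ 2 + C * L * ∫ t in Set.Ico (n : ℝ) (n + 1),
            ∑ ρ ∈ W, (zetaOrder ρ : ℝ) * (1 / (σ ^ 2 + (t - ρ.im) ^ 2))) := by
        rw [hg, integral_const_mul, integral_add, integral_const_mul (C * L)]
        · simp
        · exact integrableOn_const (by simp)
        · exact (hsumint.const_mul _).integrableOn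
      have h2 : ∫ t in Set.Ico (n : ℝ) (n + 1),
            ∑ ρ ∈ W, (zetaOrder ρ : ℝ) * (1 / (σ ^ 2 + (t - ρ.im) ^ 2)) ≤
            (∑ ρ ∈ W, (zetaOrder ρ : ℝ)) * (Real.pi / σ) := by
        refine (setIntegral_le_integral hsumint (Eventually.of_forall fun t ↦ ?_)).trans ?_
        · simp only [Pi.zero_apply]; positivity
        · rw [integral_finsetSum _ fun ρ _ ↦ (integral_inv_sq_add_sq_le hσ ρ.im).1.const_mul _,
            Finset.sum_mul]
          refine Finset.sum_le_sum fun ρ _ ↦ ?_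
          rw [integral_const_mul, (integral_inv_sq_add_sq_le hσ ρ.im).2]
      have h3 : (∑ ρ ∈ W, (zetaOrder ρ : ℝ)) ≤ if (N : ℝ) < |(n : ℝ)| + 3 then C * L else 0 := by
        split_ifs with hN
        · exact hWsum
        · have : W = ∅ := by
            by_contra hne
            obtain ⟨ρ, hρ⟩ := Finset.nonempty_iff_ne_empty.2 hne
            obtain ⟨h4, h5, h6, h7⟩ := hW ρ hρ
            refine h7 (mem_criticalZeros.2 ⟨h4, h5, ?_⟩)
            have h8 : ρ.im = (ρ.im - (n + 1 / 2)) + n + 1 / 2 := by ring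
            rw [h8]
            refine (abs_add_le _ _).trans ?_
            have := abs_add_le (ρ.im - (n + 1 / 2)) n
            rw [abs_of_pos (show (0 : ℝ) < 1 / 2 by norm_num)]
            norm_num at h6 hN ⊢
            linarith
          simp [this]
      rw [h1]
      calc _ ≤ D * (K ^ 2 * L ^ 2 + C * L *
              ((if (N : ℝ) < |(n : ℝ)| + 3 then C * L else 0) * (Real.pi / σ))) := by
            gcongr
            refine h2.trans ?_
            gcongr
        _ = _ := by
            rw [hD]
            split_ifs <;> ring

theorem summable_log_sq_div :
    Summable fun n : ℤ ↦ Real.log (3 + |(n : ℝ) + 1 / 2|) ^ 2 / (1 + (n : ℝ) ^ 2) := by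
  have h := ((Real.summable_one_div_int_add_rpow (1 / 2) (7 / 4)).2 (by norm_num)).mul_left
    (128 * (7 : ℝ) ^ (1 / 4 : ℝ))
  refine Summable.of_nonneg_of_le (fun n ↦ by positivity) (fun n ↦ ?_) h
  set a := |(n : ℝ) + 1 / 2| with ha
  have ha2 : a ^ 2 = ((n : ℝ) + 1 / 2) ^ 2 := sq_abs _
  have hhalf : 1 / 2 ≤ a := by
    rcases le_or_gt 0 n with hn | hn
    · have : (0 : ℝ) ≤ n := by exact_mod_cast hn
      rw [ha, abs_of_nonneg (by linarith)]
      linarith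
    · have : (n : ℝ) ≤ -1 := by exact_mod_cast Int.le_sub_one_of_lt hn
      rw [ha, abs_of_nonpos (by linarith)]
      linarith
  have hapos : 0 < a := by linarith
  have hlog0 : 0 ≤ Real.log (3 + a) := Real.log_nonneg (by linarith)
  have h1 : Real.log (3 + a) ^ 2 ≤ 64 * ((7 : ℝ) ^ (1 / 4 : ℝ) * a ^ (1 / 4 : ℝ)) := by
    have h2 : Real.log (3 + a) ≤ 8 * (7 * a) ^ (1 / 8 : ℝ) := by
      refine (Real.log_le_log (by linarith) (show 3 + a ≤ 7 * a by linarith)).trans ?_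
      have := Real.log_le_rpow_div (x := 7 * a) (ε := 1 / 8) (by positivity) (by norm_num)
      linarith
    calc Real.log (3 + a) ^ 2 ≤ (8 * (7 * a) ^ (1 / 8 : ℝ)) ^ 2 := by gcongr
      _ = 64 * (7 * a) ^ (1 / 4 : ℝ) := by
        rw [mul_pow, ← Real.rpow_natCast ((7 * a) ^ (1 / 8 : ℝ)), ← Real.rpow_mul (by positivity)]
        norm_num
      _ = _ := by rw [Real.mul_rpow (by norm_num) hapos.le]
  have h3 : a ^ 2 / 2 ≤ 1 + (n : ℝ) ^ 2 := by
    rw [ha2]; nlinarith [sq_nonneg ((n : ℝ) - 1 / 2)]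
  have h4 : a ^ (1 / 4 : ℝ) = a ^ 2 * (1 / a ^ (7 / 4 : ℝ)) := by
    rw [mul_one_div, ← Real.rpow_two, ← Real.rpow_sub hapos]
    norm_num
  calc Real.log (3 + a) ^ 2 / (1 + (n : ℝ) ^ 2)
      ≤ 64 * ((7 : ℝ) ^ (1 / 4 : ℝ) * a ^ (1 / 4 : ℝ)) / (a ^ 2 / 2) := by gcongr
    _ = 128 * (7 : ℝ) ^ (1 / 4 : ℝ) * (1 / a ^ (7 / 4 : ℝ)) := by
      rw [h4]
      field_simp
      norm_num

theorem integrable_and_integral_le_of_block {g : ℝ → ℝ} (hg : AEStronglyMeasurable g)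
    (hg0 : ∀ t, 0 ≤ g t) {a : ℤ → ℝ} (ha0 : ∀ n, 0 ≤ a n) (ha : Summable a)
    (h : ∀ n : ℤ, ∫⁻ t in Set.Ico (n : ℝ) (n + 1), ENNReal.ofReal (g t) ≤ ENNReal.ofReal (a n)) :
    Integrable g ∧ ∫ t, g t ≤ ∑' n, a n := by
  have h1 : ∫⁻ t, ENNReal.ofReal (g t) ≤ ENNReal.ofReal (∑' n, a n) := by
    rw [← setLIntegral_univ, ← iUnion_Ico_intCast, lintegral_iUnion (fun _ ↦ measurableSet_Ico)
      (Set.pairwise_disjoint_Ico_intCast ℝ), ENNReal.ofReal_tsum_of_nonneg ha0 ha]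
    exact ENNReal.tsum_le_tsum h
  constructor
  · refine ⟨hg, ?_⟩
    rw [HasFiniteIntegral]
    refine lt_of_le_of_lt ?_ (h1.trans_lt ENNReal.ofReal_lt_top)
    refine lintegral_mono fun t ↦ ?_
    rw [← ofReal_norm, Real.norm_of_nonneg (hg0 t)]
  · rw [integral_eq_lintegral_of_nonneg_ae (Eventually.of_forall hg0) hg]
    exact ENNReal.toReal_le_of_le_ofReal (tsum_nonneg ha0) h1

theorem differentiableAt_laplaceResidual
    (hRH : ∀ ρ, riemannZeta₁ ρ = 0 → 0 < ρ.re → ρ.re = 1 / 2) {S : Finset ℂ}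
    (hS : ∀ ρ ∈ S, riemannZeta₁ ρ = 0 ∧ ρ.re = 1 / 2) {z : ℂ} (hz : 0 < z.re) :
    DifferentiableAt ℂ (laplaceResidual S) z := by
  have hsre : (z + 1 / 2).re = z.re + 1 / 2 := by simp
  have h0 : z + 1 / 2 ≠ 0 := by
    intro h
    rw [h, Complex.zero_re] at hsre
    linarith
  have hf : riemannZeta₁ (z + 1 / 2) ≠ 0 := by
    intro h
    have := hRH _ h (by rw [hsre]; linarith)
    rw [hsre] at this
    linarith
  have hρ : ∀ ρ ∈ S, z + 1 / 2 - ρ ≠ 0 := by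
    intro ρ hρ h
    have := congrArg Complex.re h
    rw [Complex.sub_re, hsre, (hS ρ hρ).2, Complex.zero_re] at this
    linarith
  have hld : DifferentiableAt ℂ (fun z : ℂ ↦ logDeriv riemannZeta₁ (z + 1 / 2)) z := by
    have h1 : DifferentiableAt ℂ (logDeriv riemannZeta₁) (z + 1 / 2) := by
      refine DifferentiableAt.div ?_ (differentiable_riemannZeta₁ _) hf
      exact (differentiable_riemannZeta₁.contDiff (n := 2)).differentiable_deriv_two _
    exact DifferentiableAt.comp (f := fun z : ℂ ↦ z + 1 / 2) z h1 (by fun_prop)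
  unfold laplaceResidual
  refine DifferentiableAt.fun_mul ?_ ?_
  · refine DifferentiableAt.fun_neg (DifferentiableAt.fun_div ?_ ?_ ?_)
    exacts [by fun_prop, by fun_prop, h0]
  · refine DifferentiableAt.fun_sub (DifferentiableAt.fun_sub (by fun_prop) ?_) (by fun_prop)
    refine DifferentiableAt.fun_sum fun ρ hρS ↦ ?_
    refine DifferentiableAt.fun_div ?_ ?_ ?_
    exacts [by fun_prop, by fun_prop, hρ ρ hρS]

/-- The contribution of the zeros in `S` to the explicit formula. -/
noncomputable def zeroSum (S : Finset ℂ) (u : ℝ) : ℂ :=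
  -∑ ρ ∈ S, (zetaOrder ρ : ℂ) / ρ * Complex.exp (ρ.im * u * Complex.I)

theorem continuous_zeroSum (S : Finset ℂ) : Continuous (zeroSum S) := by
  unfold zeroSum; fun_prop

theorem norm_zeroSum_le (S : Finset ℂ) (u : ℝ) :
    ‖zeroSum S u‖ ≤ ∑ ρ ∈ S, (zetaOrder ρ : ℝ) / ‖ρ‖ := by
  rw [zeroSum, norm_neg]
  refine norm_sum_le_of_le _ fun ρ _ ↦ ?_
  rw [norm_mul, norm_div, Complex.norm_natCast, ← Complex.ofReal_mul, Complex.norm_exp_ofReal_mul_I,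
    mul_one]

theorem integrable_psiError_mul_exp {z : ℂ} (hz : 1 / 2 < z.re) :
    Integrable fun u : ℝ ↦ (psiError u : ℂ) * Complex.exp (-z * u) := by
  obtain ⟨A, hA, hA'⟩ := exists_abs_psiError_le
  have h1 : IntegrableOn (fun u : ℝ ↦ A * Real.exp ((1 / 2 - z.re) * u)) (Set.Ici 0) :=
    (integrableOn_Ici_iff_integrableOn_Ioi).2
      ((integrableOn_exp_mul_Ioi (by linarith) 0).const_mul A)
  refine (h1.integrable_indicator measurableSet_Ici).mono' ?_ ?_
  · exact ((Complex.measurable_ofReal.comp measurable_psiError).mul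
      (by fun_prop)).aestronglyMeasurable
  · refine Eventually.of_forall fun u ↦ ?_
    by_cases hu : 0 ≤ u
    · rw [Set.indicator_of_mem (Set.mem_Ici.2 hu), norm_mul, Complex.norm_exp, Complex.norm_real,
        Real.norm_eq_abs]
      have : (-z * (u : ℂ)).re = -z.re * u := by simp
      rw [this]
      calc |psiError u| * Real.exp (-z.re * u)
          ≤ A * Real.exp (u / 2) * Real.exp (-z.re * u) := by gcongr; exact hA' u
        _ = _ := by rw [mul_assoc, ← Real.exp_add]; ring_nf
    · rw [Set.indicator_of_notMem (by simpa using hu), psiError, if_neg hu]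
      simp

theorem laplace_psiError_sub_zeroSum {S : Finset ℂ} (hS : ∀ ρ ∈ S, ρ.re = 1 / 2) {z : ℂ}
    (hz : 1 / 2 < z.re) :
    ∫ u : ℝ, (Set.Ici (0 : ℝ)).indicator (fun u ↦ (psiError u : ℂ) - zeroSum S u) u *
      Complex.exp (-z * u) = laplaceResidual S z := by
  have hexp : ∀ ρ : ℂ, ((ρ.im * Complex.I - z : ℂ)).re < 0 := fun ρ ↦ by simp; linarith
  have h1 : (fun u : ℝ ↦ (Set.Ici (0 : ℝ)).indicator (fun u ↦ (psiError u : ℂ) - zeroSum S u) u *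
      Complex.exp (-z * u)) = fun u : ℝ ↦ (psiError u : ℂ) * Complex.exp (-z * u) +
      (Set.Ici (0 : ℝ)).indicator (fun u : ℝ ↦ ∑ ρ ∈ S, (zetaOrder ρ : ℂ) / ρ *
        Complex.exp ((ρ.im * Complex.I - z) * u)) u := by
    ext u
    by_cases hu : 0 ≤ u
    · simp only [Set.indicator_of_mem (Set.mem_Ici.2 hu), zeroSum]
      rw [sub_neg_eq_add, add_mul, Finset.sum_mul]
      congr 1
      refine Finset.sum_congr rfl fun ρ _ ↦ ?_
      rw [mul_assoc, ← Complex.exp_add]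
      ring_nf
    · have hu' : u ∉ Set.Ici (0 : ℝ) := by simpa using hu
      simp only [Set.indicator_of_notMem hu', psiError, if_neg hu]
      simp
  have hinteg : ∀ ρ ∈ S, IntegrableOn (fun u : ℝ ↦ (zetaOrder ρ : ℂ) / ρ *
        Complex.exp ((ρ.im * Complex.I - z) * u)) (Set.Ioi 0) := fun ρ _ ↦
    (integrableOn_exp_mul_complex_Ioi (hexp ρ) 0).const_mul _
  have hinteg' : IntegrableOn (fun u : ℝ ↦ ∑ ρ ∈ S, (zetaOrder ρ : ℂ) / ρ *
        Complex.exp ((ρ.im * Complex.I - z) * u)) (Set.Ici 0) :=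
    (integrableOn_Ici_iff_integrableOn_Ioi).2 (integrable_finsetSum _ hinteg)
  rw [h1, integral_add (integrable_psiError_mul_exp hz)
    (hinteg'.integrable_indicator measurableSet_Ici), laplace_psiError hz,
    integral_indicator measurableSet_Ici, integral_Ici_eq_integral_Ioi,
    integral_finsetSum _ hinteg, laplaceResidual, sub_sub, ← Finset.sum_add_distrib, mul_sub,
    sub_eq_add_neg]
  congr 1
  rw [neg_mul, neg_neg, Finset.mul_sum]
  refine Finset.sum_congr rfl fun ρ hρ ↦ ?_
  have hsre : (z + 1 / 2).re = z.re + 1 / 2 := by simp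
  have h0 : z + 1 / 2 ≠ 0 := by
    intro h
    rw [h, Complex.zero_re] at hsre
    linarith
  have hρ0 : ρ ≠ 0 := by
    rintro rfl
    have := hS 0 hρ
    norm_num at this
  have hz' : z + 1 / 2 - ρ = -(ρ.im * Complex.I - z) := by
    apply Complex.ext
    · simp [hS ρ hρ]
    · simp
  have hne : (ρ.im * Complex.I - z : ℂ) ≠ 0 := by
    intro h
    have := hexp ρ
    rw [h] at this
    simp at this
  have hne2 : z + 1 / 2 - ρ ≠ 0 := by rw [hz']; exact neg_ne_zero.2 hne
  have hneg : (ρ.im * Complex.I - z : ℂ) = -(z + 1 / 2 - ρ) := by rw [hz', neg_neg]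
  rw [integral_const_mul, integral_exp_mul_complex_Ioi (hexp ρ)]
  simp only [Complex.ofReal_zero, mul_zero, Complex.exp_zero]
  rw [hneg, neg_div_neg_eq]
  clear hz' hneg hsre
  generalize z + 1 / 2 = s at *
  field_simp
  ring

theorem exists_psiError_mean_square_bound
    (hRH : ∀ ρ, riemannZeta₁ ρ = 0 → 0 < ρ.re → ρ.re = 1 / 2) :
    ∃ τ : ℕ → ℝ, Tendsto τ atTop (nhds 0) ∧ ∀ N : ℕ, ∃ K : ℝ, ∀ U : ℝ, 1 ≤ U →
      (1 / U) * ∫ u in Set.Ioc 0 U, ‖(psiError u : ℂ) - zeroSum (criticalZeros N) u‖ ^ 2 ≤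
        K / U + τ N := by
  obtain ⟨C, hC, hblock⟩ := laplaceResidual_block_integral_le hRH
  set a : ℤ → ℝ := fun n ↦ Real.log (3 + |(n : ℝ) + 1 / 2|) ^ 2 / (1 + (n : ℝ) ^ 2) with ha
  have ha0 : ∀ n, 0 ≤ a n := fun n ↦ by positivity
  have hasum : Summable a := summable_log_sq_div
  set b : ℕ → ℤ → ℝ := fun N n ↦ if (N : ℝ) < |(n : ℝ)| + 3 then a n else 0 with hb
  have hb0 : ∀ N n, 0 ≤ b N n := fun N n ↦ by
    rw [hb]; dsimp only; split_ifs; exacts [ha0 n, le_rfl]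
  have hba : ∀ N n, b N n ≤ a n := fun N n ↦ by
    rw [hb]; dsimp only; split_ifs; exacts [le_rfl, ha0 n]
  have hbsum : ∀ N, Summable (b N) := fun N ↦ Summable.of_nonneg_of_le (hb0 N) (hba N) hasum
  have htail : Tendsto (fun N ↦ ∑' n, b N n) atTop (nhds 0) := by
    have := tendsto_tsum_of_dominated_convergence (𝓕 := atTop) (f := b) (g := fun _ ↦ 0) hasum
      (fun n ↦ ?_) (Eventually.of_forall fun N n ↦ ?_)
    · simpa using this
    · refine tendsto_const_nhds.congr' ?_
      obtain ⟨M, hM⟩ := exists_nat_ge (|(n : ℝ)| + 3)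
      filter_upwards [eventually_ge_atTop M] with N hN
      have : (M : ℝ) ≤ N := by exact_mod_cast hN
      rw [hb]; dsimp only
      rw [if_neg (by linarith)]
    · rw [Real.norm_of_nonneg (hb0 N n)]
      exact hba N n
  set E : ℝ := Real.exp 2 * (2 * Real.pi)⁻¹ with hE
  have hE0 : 0 ≤ E := by positivity
  refine ⟨fun N ↦ E * C * ∑' n, b N n, by simpa using htail.const_mul (E * C), fun N ↦ ?_⟩
  obtain ⟨K, hK, hK'⟩ := hblock N
  refine ⟨E * K * ∑' n, a n, fun U hU ↦ ?_⟩
  set S := criticalZeros N with hS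
  have hS1 : ∀ ρ ∈ S, riemannZeta₁ ρ = 0 ∧ ρ.re = 1 / 2 := fun ρ hρ ↦
    ⟨(mem_criticalZeros.1 hρ).1, (mem_criticalZeros.1 hρ).2.1⟩
  have hU0 : 0 < U := by linarith
  set σ := 1 / U with hσ
  have hσ0 : 0 < σ := by positivity
  have hσ1 : σ ≤ 1 := by rw [hσ, div_le_one hU0]; exact hU
  have hmeas : AEStronglyMeasurable fun t : ℝ ↦ ‖laplaceResidual S (σ + t * Complex.I)‖ ^ 2 := by
    refine Continuous.aestronglyMeasurable (Continuous.pow (Continuous.norm ?_) 2)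
    rw [continuous_iff_continuousAt]
    intro t
    have h1 : ContinuousAt (laplaceResidual S) (σ + t * Complex.I) :=
      (differentiableAt_laplaceResidual hRH hS1 (by simpa using hσ0)).continuousAt
    exact ContinuousAt.comp (f := fun t : ℝ ↦ (σ + t * Complex.I : ℂ)) h1 (by fun_prop)
  have hblk := integrable_and_integral_le_of_block hmeas (fun t ↦ by positivity)
    (a := fun n ↦ K * a n + C / σ * b N n)
    (fun n ↦ add_nonneg (mul_nonneg hK (ha0 n)) (mul_nonneg (by positivity) (hb0 N n)))
    ((hasum.mul_left K).add ((hbsum N).mul_left (C / σ))) (fun n ↦ by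
      refine (hK' σ hσ0 hσ1 n).trans (le_of_eq ?_)
      congr 1
      rw [ha, hb]
      dsimp only
      split_ifs <;> ring)
  rw [((hasum.mul_left K).tsum_add ((hbsum N).mul_left (C / σ))), tsum_mul_left,
    tsum_mul_left] at hblk
  obtain ⟨B, hB⟩ := laplaceResidual_bounded hRH hS1 hσ0
  obtain ⟨A, hA, hA'⟩ := exists_abs_psiError_le
  set D := ∑ ρ ∈ S, (zetaOrder ρ : ℝ) / ‖ρ‖ with hD
  have hD0 : 0 ≤ D := by positivity
  have hqm : Measurable ((Set.Ici (0 : ℝ)).indicator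
      fun u ↦ (psiError u : ℂ) - zeroSum S u) :=
    ((Complex.measurable_ofReal.comp measurable_psiError).sub
      (continuous_zeroSum S).measurable).indicator measurableSet_Ici
  have hqle : ∀ u, 0 ≤ u → ‖(Set.Ici (0 : ℝ)).indicator
      (fun u ↦ (psiError u : ℂ) - zeroSum S u) u‖ ≤ (A + D) * Real.exp (1 / 2 * u) := by
    intro u hu
    rw [Set.indicator_of_mem (Set.mem_Ici.2 hu)]
    refine (norm_sub_le _ _).trans ?_
    rw [Complex.norm_real, Real.norm_eq_abs, add_mul]
    refine add_le_add ?_ ?_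
    · refine (hA' u).trans (le_of_eq ?_)
      ring_nf
    · refine (norm_zeroSum_le S u).trans ?_
      exact le_mul_of_one_le_right hD0 (Real.one_le_exp (by positivity))
  have hlapl := integral_norm_sq_le_of_laplace (b := 1) (a := 1 / 2) hσ1 (by norm_num)
    hqm.aestronglyMeasurable (fun u hu ↦ Set.indicator_of_notMem (by simpa using hu) _)
    hqle (fun z h1 _ ↦ differentiableAt_laplaceResidual hRH hS1 (hσ0.trans_le h1)) hB
    (fun t ↦ (laplace_psiError_sub_zeroSum (fun ρ hρ ↦ (hS1 ρ hρ).2) (by simp; norm_num)).symm)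
    hblk.1 U hU0.le
  have hcmp : ∫ u in Set.Ioc 0 U, ‖(psiError u : ℂ) - zeroSum S u‖ ^ 2 ≤
      Real.exp 2 * ∫ u in Set.Ioc 0 U, (‖(Set.Ici (0 : ℝ)).indicator
        (fun u ↦ (psiError u : ℂ) - zeroSum S u) u‖ * Real.exp (-σ * u)) ^ 2 := by
    rw [← integral_const_mul]
    refine integral_mono_of_nonneg (Eventually.of_forall fun u ↦ by positivity) ?_ ?_
    · refine Integrable.const_mul ?_ _
      refine Measure.integrableOn_of_bounded (M := ((A + D) * Real.exp (1 / 2 * U)) ^ 2) (by simp)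
        ?_ ?_
      · exact ((hqm.norm.mul (by fun_prop)).pow_const 2).aestronglyMeasurable
      · filter_upwards [ae_restrict_mem measurableSet_Ioc] with u hu
        rw [Real.norm_of_nonneg (by positivity)]
        have h1 : Real.exp (-σ * u) ≤ 1 := Real.exp_le_one_iff.2 (by nlinarith [hu.1])
        have h2 := hqle u hu.1.le
        have h3 : Real.exp (1 / 2 * u) ≤ Real.exp (1 / 2 * U) :=
          Real.exp_le_exp.2 (by linarith [hu.2])
        refine pow_le_pow_left₀ (by positivity) ?_ 2
        calc _ ≤ (A + D) * Real.exp (1 / 2 * u) * 1 := by gcongr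
          _ ≤ _ := by rw [mul_one]; exact mul_le_mul_of_nonneg_left h3 (by positivity)
    · filter_upwards [ae_restrict_mem measurableSet_Ioc] with u hu
      rw [Set.indicator_of_mem (Set.mem_Ici.2 hu.1.le), mul_pow, ← Real.exp_nat_mul, mul_left_comm,
        ← Real.exp_add]
      refine le_mul_of_one_le_right (by positivity) (Real.one_le_exp ?_)
      have : σ * u ≤ 1 := by rw [hσ, one_div_mul_eq_div, div_le_one hU0]; exact hu.2
      push_cast
      linarith
  have hfin : ∫ u in Set.Ioc 0 U, ‖(psiError u : ℂ) - zeroSum S u‖ ^ 2 ≤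
      E * (K * ∑' n, a n + C / σ * ∑' n, b N n) := by
    refine hcmp.trans ?_
    rw [hE, mul_assoc]
    refine mul_le_mul_of_nonneg_left (hlapl.trans ?_) (by positivity)
    exact mul_le_mul_of_nonneg_left hblk.2 (by positivity)
  calc (1 / U) * ∫ u in Set.Ioc 0 U, ‖(psiError u : ℂ) - zeroSum S u‖ ^ 2
      ≤ (1 / U) * (E * (K * ∑' n, a n + C / σ * ∑' n, b N n)) := by gcongr
    _ = _ := by
      rw [hσ]
      field_simp

theorem tendsto_average_weight_mul {g w : ℝ → ℝ} {K M : ℝ} (hg0 : ∀ u, 0 ≤ g u)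
    (hgi : ∀ U, IntegrableOn g (Set.Ioc 0 U)) (hgK : ∀ U, 0 ≤ U → ∫ u in Set.Ioc 0 U, g u ≤ K * (1 + U))
    (hw0 : ∀ u, 0 ≤ w u) (hwM : ∀ u, w u ≤ M) (hw : Tendsto w atTop (nhds 0)) :
    Tendsto (fun U : ℝ ↦ (1 / U) * ∫ u in Set.Ioc 0 U, w u * g u) atTop (nhds 0) := by
  have hK : 0 ≤ K := by simpa using hgK 0 le_rfl
  have hM : 0 ≤ M := (hw0 0).trans (hwM 0)
  rw [Metric.tendsto_atTop]
  intro ε hε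
  set η := ε / (4 * (K + 1)) with hη
  have hη0 : 0 < η := by positivity
  obtain ⟨T, hT⟩ := eventually_atTop.1 (hw.eventually (gt_mem_nhds hη0))
  set T' := max T 0
  set Q := M * (K * (1 + T')) with hQ
  have hT'0 : 0 ≤ T' := le_max_right _ _
  have hQ0 : 0 ≤ Q := by positivity
  refine ⟨max (max 1 T') (4 * Q / ε + 1), fun U hU ↦ ?_⟩
  have hU1 : 1 ≤ U := (le_max_left _ _).trans ((le_max_left _ _).trans hU)
  have hUT : T' ≤ U := (le_max_right _ _).trans ((le_max_left _ _).trans hU)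
  have hUQ : 4 * Q / ε < U := by linarith [(le_max_right _ _).trans hU]
  have hU0 : 0 < U := by linarith
  have hnn : 0 ≤ ∫ u in Set.Ioc 0 U, w u * g u :=
    integral_nonneg fun u ↦ mul_nonneg (hw0 u) (hg0 u)
  rw [Real.dist_eq, sub_zero, abs_of_nonneg (by positivity)]
  have hind : Integrable ((Set.Ioc 0 T').indicator fun u ↦ M * g u) :=
    (integrable_indicator_iff measurableSet_Ioc).2 ((hgi T').const_mul M)
  have hle : ∫ u in Set.Ioc 0 U, w u * g u ≤
      ∫ u in Set.Ioc 0 U, ((Set.Ioc 0 T').indicator (fun u ↦ M * g u) u + η * g u) := by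
    refine integral_mono_of_nonneg (Eventually.of_forall fun u ↦ mul_nonneg (hw0 u) (hg0 u)) ?_ ?_
    · refine Integrable.add ?_ ((hgi U).const_mul η)
      exact hind.integrableOn
    · filter_upwards [ae_restrict_mem measurableSet_Ioc] with u hu
      by_cases huT : u ≤ T'
      · rw [Set.indicator_of_mem (show u ∈ Set.Ioc 0 T' from ⟨hu.1, huT⟩)]
        have := mul_le_mul_of_nonneg_right (hwM u) (hg0 u)
        have := mul_nonneg hη0.le (hg0 u)
        linarith
      · rw [Set.indicator_of_notMem (fun h ↦ huT h.2), zero_add]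
        exact mul_le_mul_of_nonneg_right
          (hT u ((le_max_left _ _).trans (not_le.1 huT).le)).le (hg0 u)
  have hval : ∫ u in Set.Ioc 0 U, ((Set.Ioc 0 T').indicator (fun u ↦ M * g u) u + η * g u) ≤
      Q + η * (K * (1 + U)) := by
    rw [integral_add, setIntegral_indicator measurableSet_Ioc,
      Set.inter_eq_self_of_subset_right (Set.Ioc_subset_Ioc_right hUT), integral_const_mul,
      integral_const_mul]
    · exact add_le_add (mul_le_mul_of_nonneg_left (hgK T' hT'0) hM)
        (mul_le_mul_of_nonneg_left (hgK U hU0.le) hη0.le)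
    · exact hind.integrableOn
    · exact (hgi U).const_mul η
  have hηK : η * K ≤ ε / 4 := by
    rw [hη, div_mul_eq_mul_div, div_le_div_iff₀ (by positivity) (by norm_num)]
    nlinarith
  rw [div_lt_iff₀ hε] at hUQ
  rw [one_div_mul_eq_div, div_lt_iff₀ hU0]
  nlinarith

theorem integral_triangle_swap {a h : ℝ → ℝ} {U : ℝ} (ha : IntegrableOn a (Set.Ioc 0 U))
    (hh : IntegrableOn h (Set.Ioc 0 U)) :
    IntegrableOn (fun u ↦ a u * ∫ v in Set.Ioc 0 u, h v) (Set.Ioc 0 U) ∧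
      ∫ u in Set.Ioc 0 U, a u * ∫ v in Set.Ioc 0 u, h v =
        ∫ v in Set.Ioc 0 U, h v * ∫ u in Set.Icc v U, a u := by
  set μ := volume.restrict (Set.Ioc 0 U)
  set f : ℝ → ℝ → ℝ := fun u v ↦ {p : ℝ × ℝ | p.2 ≤ p.1}.indicator (fun p ↦ a p.1 * h p.2) (u, v)
  have hf : Integrable (Function.uncurry f) (μ.prod μ) :=
    (Integrable.mul_prod ha hh).indicator (measurableSet_le measurable_snd measurable_fst)
  have h1 : ∀ u ∈ Set.Ioc 0 U, ∫ v, f u v ∂μ = a u * ∫ v in Set.Ioc 0 u, h v := by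
    intro u hu
    have : f u = (Set.Iic u).indicator fun v ↦ a u * h v := by
      ext v
      simp [f, Set.indicator_apply]
    rw [this, setIntegral_indicator measurableSet_Iic, integral_const_mul]
    congr 3
    ext v
    simp only [Set.mem_inter_iff, Set.mem_Ioc, Set.mem_Iic]
    constructor
    · rintro ⟨⟨h1, _⟩, h3⟩; exact ⟨h1, h3⟩
    · rintro ⟨h1, h3⟩; exact ⟨⟨h1, h3.trans hu.2⟩, h3⟩
  have h2 : ∀ v ∈ Set.Ioc 0 U, ∫ u, f u v ∂μ = h v * ∫ u in Set.Icc v U, a u := by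
    intro v hv
    have : (fun u ↦ f u v) = (Set.Ici v).indicator fun u ↦ h v * a u := by
      ext u
      simp [f, Set.indicator_apply, mul_comm]
    rw [this, setIntegral_indicator measurableSet_Ici, integral_const_mul]
    congr 3
    ext u
    simp only [Set.mem_inter_iff, Set.mem_Ioc, Set.mem_Ici, Set.mem_Icc]
    constructor
    · rintro ⟨⟨_, h1⟩, h3⟩; exact ⟨h3, h1⟩
    · rintro ⟨h1, h3⟩; exact ⟨⟨hv.1.trans_le h1, h3⟩, h1⟩
  constructor
  · refine hf.integral_prod_left.congr ?_
    filter_upwards [ae_restrict_mem measurableSet_Ioc] with u hu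
    exact h1 u hu
  · rw [← setIntegral_congr_fun measurableSet_Ioc h1, ← setIntegral_congr_fun measurableSet_Ioc h2]
    exact integral_integral_swap hf

theorem integral_mul_exp_neg_half_le {v U : ℝ} (hv : 0 ≤ v) :
    ∫ u in Set.Icc v U, u * Real.exp (-u / 2) ≤ (2 * v + 4) * Real.exp (-v / 2) := by
  rcases le_or_gt v U with hvU | hvU
  · rw [integral_Icc_eq_integral_Ioc, ← intervalIntegral.integral_of_le hvU]
    have hd : ∀ x ∈ Set.uIcc v U, HasDerivAt (fun x : ℝ ↦ -(2 * x + 4) * Real.exp (-x / 2))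
        (x * Real.exp (-x / 2)) x := by
      intro x _
      have h1 : HasDerivAt (fun x : ℝ ↦ Real.exp (-x / 2)) (Real.exp (-x / 2) * (-1 / 2)) x :=
        ((hasDerivAt_neg x).div_const 2).exp
      have h2 : HasDerivAt (fun x : ℝ ↦ -(2 * x + 4)) (-(2 * 1)) x :=
        (((hasDerivAt_id x).const_mul 2).add_const 4).neg
      refine (h2.fun_mul h1).congr_deriv ?_
      ring
    rw [intervalIntegral.integral_eq_sub_of_hasDerivAt hd
      ((by fun_prop : Continuous fun x : ℝ ↦ x * Real.exp (-x / 2)).intervalIntegrable _ _)]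
    have : 0 ≤ (2 * U + 4) * Real.exp (-U / 2) := by
      have : 0 ≤ U := hv.trans hvU
      positivity
    linarith
  · rw [Set.Icc_eq_empty (not_le.2 hvU)]
    simp
    positivity

/-- The normalised error term `(log x) x^{-1/2} (π(x) - Li(x))` at `x = exp u`. -/
noncomputable def primeError (u : ℝ) : ℝ :=
  if Real.log 2 ≤ u then
    u * Real.exp (-u / 2) * ((primePi (Real.exp u) : ℝ) - Li (Real.exp u)) else 0

theorem intervalIntegrable_one_div_log {a b : ℝ} (ha : 1 < a) (hb : 1 < b) :
    IntervalIntegrable (fun t ↦ 1 / Real.log t) volume a b := by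
  refine ContinuousOn.intervalIntegrable fun x hx ↦ ContinuousAt.continuousWithinAt ?_
  have hx1 : 1 < x := lt_of_lt_of_le (lt_min ha hb) hx.1
  have : Real.log x ≠ 0 := (Real.log_pos hx1).ne'
  exact continuousAt_const.div (Real.continuousAt_log (by linarith)) this

theorem Li_eq {x : ℝ} (hx : 2 ≤ x) :
    Li x = x / Real.log x - 2 / Real.log 2 + ∫ t in (2 : ℝ)..x, 1 / Real.log t ^ 2 := by
  have h1 := intervalIntegrable_one_div_log (a := 2) (b := x) (by norm_num) (by linarith)
  have h2 := Chebyshev.intervalIntegrable_one_div_log_sq (a := 2) (b := x) (by norm_num)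
    (by linarith)
  have hd : ∀ t ∈ Set.uIcc 2 x, HasDerivAt (fun t : ℝ ↦ t / Real.log t)
      (1 / Real.log t - 1 / Real.log t ^ 2) t := by
    intro t ht
    rw [Set.uIcc_of_le hx] at ht
    have ht0 : t ≠ 0 := by linarith [ht.1]
    have hl : Real.log t ≠ 0 := (Real.log_pos (by linarith [ht.1])).ne'
    refine ((hasDerivAt_id t).fun_div (Real.hasDerivAt_log ht0) hl).congr_deriv ?_
    simp only [id]
    field_simp
  have h3 := intervalIntegral.integral_eq_sub_of_hasDerivAt hd (h1.sub h2)
  rw [intervalIntegral.integral_sub h1 h2] at h3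
  rw [Li]
  linarith

theorem log_mul_primePi_sub_Li {x : ℝ} (hx : 2 ≤ x) :
    Real.log x * ((primePi x : ℝ) - Li x) = (Chebyshev.theta x - x) +
      Real.log x * ((∫ t in (2 : ℝ)..x, (Chebyshev.theta t - t) / (t * Real.log t ^ 2))
        + 2 / Real.log 2) := by
  have hl : Real.log x ≠ 0 := (Real.log_pos (by linarith)).ne'
  have h1 : IntervalIntegrable (fun t ↦ Chebyshev.theta t / (t * Real.log t ^ 2)) volume 2 x := by
    rw [intervalIntegrable_iff_integrableOn_Icc_of_le hx]
    exact Chebyshev.integrableOn_theta_div_id_mul_log_sq x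
  have h2 := Chebyshev.intervalIntegrable_one_div_log_sq (a := 2) (b := x) (by norm_num)
    (by linarith)
  have h3 : ∫ t in (2 : ℝ)..x, (Chebyshev.theta t - t) / (t * Real.log t ^ 2) =
      (∫ t in (2 : ℝ)..x, Chebyshev.theta t / (t * Real.log t ^ 2)) -
        ∫ t in (2 : ℝ)..x, 1 / Real.log t ^ 2 := by
    rw [← intervalIntegral.integral_sub h1 h2]
    refine intervalIntegral.integral_congr fun t ht ↦ ?_
    rw [Set.uIcc_of_le hx] at ht
    have ht0 : t ≠ 0 := by linarith [ht.1]
    have hl : Real.log t ≠ 0 := (Real.log_pos (by linarith [ht.1])).ne'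
    field_simp
  rw [h3, Li_eq hx, primePi, Chebyshev.primeCounting_eq_theta_div_log_add_integral hx]
  field_simp
  ring

theorem measurable_primeError : Measurable primeError := by
  have hmono : Monotone fun x : ℝ ↦ Li (max 2 x) := by
    intro x y hxy
    have hx2 : 2 ≤ max 2 x := le_max_left _ _
    have hxy' : max 2 x ≤ max 2 y := max_le_max le_rfl hxy
    have h := intervalIntegral.integral_add_adjacent_intervals
      (intervalIntegrable_one_div_log (a := 2) (b := max 2 x) (by norm_num) (by linarith))
      (intervalIntegrable_one_div_log (a := max 2 x) (b := max 2 y) (by linarith) (by linarith))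
    have h2 : 0 ≤ ∫ t in max 2 x..max 2 y, 1 / Real.log t := by
      refine intervalIntegral.integral_nonneg hxy' fun t ht ↦ ?_
      have := Real.log_nonneg (x := t) (by linarith [ht.1])
      positivity
    simp only [Li]
    linarith
  have hLi : Measurable fun u : ℝ ↦ Li (max 2 (Real.exp u)) :=
    hmono.measurable.comp Real.measurable_exp
  have hpi : Measurable fun u : ℝ ↦ (primePi (Real.exp u) : ℝ) := by
    unfold primePi
    have h1 : Measurable fun n : ℕ ↦ (n.primeCounting : ℝ) := measurable_of_countable _
    exact h1.comp (Nat.measurable_floor.comp Real.measurable_exp)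
  have heq : primeError = fun u ↦ if Real.log 2 ≤ u then
      u * Real.exp (-u / 2) * ((primePi (Real.exp u) : ℝ) - Li (max 2 (Real.exp u))) else 0 := by
    ext u
    unfold primeError
    split_ifs with hu
    · rw [max_eq_right]
      rwa [← Real.log_le_iff_le_exp (by norm_num)]
    · rfl
  rw [heq]
  refine Measurable.ite measurableSet_Ici ?_ measurable_const
  exact Measurable.mul (by fun_prop) (hpi.sub hLi)

theorem integrableOn_Ioc_of_measurable_of_bound {g : ℝ → ℝ} (hg : Measurable g) {U B : ℝ}
    (hB : ∀ u ∈ Set.Ioc 0 U, |g u| ≤ B) : IntegrableOn g (Set.Ioc 0 U) := by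
  refine Measure.integrableOn_of_bounded (M := B) (by simp) hg.aestronglyMeasurable ?_
  filter_upwards [ae_restrict_mem measurableSet_Ioc] with u hu
  exact hB u hu

theorem integrableOn_psiError (U : ℝ) : IntegrableOn psiError (Set.Ioc 0 U) := by
  obtain ⟨A, hA, hA'⟩ := exists_abs_psiError_le
  refine integrableOn_Ioc_of_measurable_of_bound measurable_psiError
    (B := A * Real.exp (U / 2)) fun u hu ↦ (hA' u).trans ?_
  exact mul_le_mul_of_nonneg_left (Real.exp_le_exp.2 (by linarith [hu.2])) hA.le

theorem integrableOn_sq_norm_psiError_sub_zeroSum (S : Finset ℂ) (U : ℝ) :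
    IntegrableOn (fun u ↦ ‖(psiError u : ℂ) - zeroSum S u‖ ^ 2) (Set.Ioc 0 U) := by
  obtain ⟨A, hA, hA'⟩ := exists_abs_psiError_le
  have hm : Measurable fun u ↦ ‖(psiError u : ℂ) - zeroSum S u‖ ^ 2 :=
    (((Complex.measurable_ofReal.comp measurable_psiError).sub
      (continuous_zeroSum S).measurable).norm).pow_const 2
  refine integrableOn_Ioc_of_measurable_of_bound hm
    (B := (A * Real.exp (U / 2) + ∑ ρ ∈ S, (zetaOrder ρ : ℝ) / ‖ρ‖) ^ 2) fun u hu ↦ ?_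
  rw [abs_of_nonneg (by positivity)]
  refine pow_le_pow_left₀ (norm_nonneg _) ((norm_sub_le _ _).trans ?_) 2
  rw [Complex.norm_real, Real.norm_eq_abs]
  refine add_le_add ((hA' u).trans ?_) (norm_zeroSum_le S u)
  exact mul_le_mul_of_nonneg_left (Real.exp_le_exp.2 (by linarith [hu.2])) hA.le

theorem exists_integral_abs_psiError_le
    (hRH : ∀ ρ, riemannZeta₁ ρ = 0 → 0 < ρ.re → ρ.re = 1 / 2) :
    ∃ K : ℝ, ∀ U : ℝ, 0 ≤ U → ∫ u in Set.Ioc 0 U, |psiError u| ≤ K * (1 + U) := by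
  obtain ⟨τ, _, hτ⟩ := exists_psiError_mean_square_bound hRH
  obtain ⟨K, hK⟩ := hτ 0
  set S := criticalZeros 0
  set D := ∑ ρ ∈ S, (zetaOrder ρ : ℝ) / ‖ρ‖ with hD
  have hD0 : 0 ≤ D := by positivity
  obtain ⟨A, hA, hA'⟩ := exists_abs_psiError_le
  have hbig : ∀ U : ℝ, 1 ≤ U →
      ∫ u in Set.Ioc 0 U, |psiError u| ≤ (|K| + |τ 0| + 1 + D) * U := by
    intro U hU
    have hU0 : 0 < U := by linarith
    have hinteg := integrableOn_sq_norm_psiError_sub_zeroSum S U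
    have h1 : ∫ u in Set.Ioc 0 U, |psiError u| ≤
        ∫ u in Set.Ioc 0 U, (‖(psiError u : ℂ) - zeroSum S u‖ ^ 2 + (1 + D)) := by
      refine integral_mono (integrableOn_psiError U).abs
        (hinteg.add (integrableOn_const (by simp))) fun u ↦ ?_
      have h2 : |psiError u| ≤ ‖(psiError u : ℂ) - zeroSum S u‖ + D := by
        have h3 : ‖(psiError u : ℂ)‖ ≤ ‖(psiError u : ℂ) - zeroSum S u‖ + ‖zeroSum S u‖ := by
          simpa using norm_add_le ((psiError u : ℂ) - zeroSum S u) (zeroSum S u)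
        rw [Complex.norm_real, Real.norm_eq_abs] at h3
        linarith [norm_zeroSum_le S u]
      show |psiError u| ≤ ‖(psiError u : ℂ) - zeroSum S u‖ ^ 2 + (1 + D)
      nlinarith [sq_nonneg (‖(psiError u : ℂ) - zeroSum S u‖ - 1),
        norm_nonneg ((psiError u : ℂ) - zeroSum S u)]
    refine h1.trans ?_
    rw [integral_add hinteg (integrableOn_const (by simp))]
    have h4 := hK U hU
    rw [one_div_mul_eq_div, div_le_iff₀ hU0] at h4
    have h5 : (K / U + τ 0) * U ≤ (|K| + |τ 0|) * U := by
      refine mul_le_mul_of_nonneg_right (add_le_add ?_ (le_abs_self _)) hU0.le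
      rw [div_le_iff₀ hU0]
      nlinarith [le_abs_self K, abs_nonneg K]
    simp only [integral_const, MeasurableSet.univ, measureReal_restrict_apply, Set.univ_inter,
      smul_eq_mul]
    rw [Real.volume_real_Ioc_of_le hU0.le]
    linarith
  refine ⟨|K| + |τ 0| + 1 + D, fun U hU ↦ ?_⟩
  refine le_trans ?_ (hbig (1 + U) (by linarith))
  exact setIntegral_mono_set (integrableOn_psiError _).abs
    (Eventually.of_forall fun u ↦ abs_nonneg _)
    (Set.Ioc_subset_Ioc_right (by linarith)).eventuallyLE

theorem exists_abs_one_sub_psi_sub_theta_le :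
    ∃ C : ℝ, 0 < C ∧ ∀ u : ℝ, 0 ≤ u →
      |1 - Real.exp (-u / 2) * (Chebyshev.psi (Real.exp u) - Chebyshev.theta (Real.exp u))| ≤
        Real.exp (-u / 4) * |psiError (u / 2)| + C * Real.exp (-u / 6) := by
  obtain ⟨A, hA, hA'⟩ := exists_psi_exp_le
  refine ⟨2 * A, by positivity, fun u hu ↦ ?_⟩
  set R := Chebyshev.psi (Real.exp u) - Chebyshev.theta (Real.exp u)
  have hup := Chebyshev.psi_sub_theta_le_psi_add_psi_add_psi (Real.exp u)
  have hlo := Chebyshev.psi_sub_theta_ge_psi_add_psi_add_psi (Real.exp_pos u).le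
  simp only [← Real.exp_mul] at hup hlo
  have h3 := hA' (u * 3⁻¹)
  have h5 := hA' (u * 5⁻¹)
  have h53 : Real.exp (u * 5⁻¹) ≤ Real.exp (u * 3⁻¹) := Real.exp_le_exp.2 (by linarith)
  have hp3 := Chebyshev.psi_nonneg (Real.exp (u * 3⁻¹))
  have hp7 := Chebyshev.psi_nonneg (Real.exp (u * 7⁻¹))
  have hR : |R - Chebyshev.psi (Real.exp (u * 2⁻¹))| ≤ 2 * A * Real.exp (u * 3⁻¹) := by
    rw [abs_of_nonneg (by linarith)]
    nlinarith
  have hmain : Real.exp (-u / 2) * Chebyshev.psi (Real.exp (u * 2⁻¹)) =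
      1 + Real.exp (-u / 4) * psiError (u / 2) := by
    have e1 : Real.exp (-u / 2) = Real.exp (-u / 4) * Real.exp (-(u / 2) / 2) := by
      rw [← Real.exp_add]; ring_nf
    have e2 : Real.exp (-u / 2) * Real.exp (u / 2) = 1 := by
      rw [← Real.exp_add, ← Real.exp_zero]; ring_nf
    rw [psiError, if_pos (by positivity), ← div_eq_mul_inv]
    linear_combination (Chebyshev.psi (Real.exp (u / 2)) - Real.exp (u / 2)) * e1 + e2
  have hdec : 1 - Real.exp (-u / 2) * R = -(Real.exp (-u / 4) * psiError (u / 2)) -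
      Real.exp (-u / 2) * (R - Chebyshev.psi (Real.exp (u * 2⁻¹))) := by
    linear_combination -hmain
  rw [hdec]
  refine (abs_sub _ _).trans ?_
  rw [abs_neg, abs_mul, Real.abs_exp, abs_mul, Real.abs_exp]
  refine add_le_add le_rfl ?_
  calc Real.exp (-u / 2) * |R - Chebyshev.psi (Real.exp (u * 2⁻¹))|
      ≤ Real.exp (-u / 2) * (2 * A * Real.exp (u * 3⁻¹)) := by gcongr
    _ = 2 * A * Real.exp (-u / 6) := by
      rw [mul_left_comm, ← Real.exp_add]
      ring_nf

theorem exists_abs_theta_sub_le :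
    ∃ C : ℝ, 0 < C ∧ ∀ v : ℝ, 0 ≤ v → |Chebyshev.theta (Real.exp v) - Real.exp v| ≤
      Real.exp (v / 2) * (|psiError v| + C) := by
  obtain ⟨C, hC⟩ := Chebyshev.psi_sub_theta_le_mul_sqrt
  refine ⟨|C| + 1, by positivity, fun v hv ↦ ?_⟩
  have h1 := hC (Real.exp v)
  have hs : √(Real.exp v) = Real.exp (v / 2) := by rw [Real.exp_half]
  rw [hs] at h1
  have h0 : 0 ≤ Chebyshev.psi (Real.exp v) - Chebyshev.theta (Real.exp v) :=
    sub_nonneg.2 (Chebyshev.theta_le_psi _)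
  have h2 : Chebyshev.psi (Real.exp v) - Real.exp v = Real.exp (v / 2) * psiError v := by
    have e1 : Real.exp (v / 2) * Real.exp (-v / 2) = 1 := by
      rw [← Real.exp_add, ← Real.exp_zero]; ring_nf
    rw [psiError, if_pos hv]
    linear_combination -(Chebyshev.psi (Real.exp v) - Real.exp v) * e1
  have h3 : Chebyshev.theta (Real.exp v) - Real.exp v = Real.exp (v / 2) * psiError v -
      (Chebyshev.psi (Real.exp v) - Chebyshev.theta (Real.exp v)) := by rw [← h2]; ring
  rw [h3]
  refine (abs_sub _ _).trans ?_
  rw [abs_mul, Real.abs_exp, abs_of_nonneg h0, mul_add]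
  have := Real.exp_pos (v / 2)
  nlinarith [le_abs_self C]

/-- The integrand that majorises the secondary term in `π - Li`. -/
noncomputable def secondaryDensity (C v : ℝ) : ℝ :=
  (Set.Ioi (Real.log 2)).indicator
    (fun v ↦ Real.exp (v / 2) * (|psiError v| + C) / v ^ 2) v

theorem integrableOn_secondaryDensity {C : ℝ} (hC : 0 < C) (U : ℝ) :
    IntegrableOn (secondaryDensity C) (Set.Ioc 0 U) := by
  obtain ⟨A, hA, hA'⟩ := exists_abs_psiError_le
  have hm : Measurable (secondaryDensity C) := by
    refine Measurable.indicator ?_ measurableSet_Ioi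
    have := measurable_psiError
    fun_prop
  refine integrableOn_Ioc_of_measurable_of_bound hm
    (B := Real.exp (U / 2) * (A * Real.exp (U / 2) + C) / Real.log 2 ^ 2) fun u hu ↦ ?_
  have hl2 : 0 < Real.log 2 := Real.log_pos (by norm_num)
  unfold secondaryDensity
  by_cases h : u ∈ Set.Ioi (Real.log 2)
  · rw [Set.indicator_of_mem h, abs_of_nonneg (by positivity)]
    have h1 : Real.exp (u / 2) ≤ Real.exp (U / 2) := Real.exp_le_exp.2 (by linarith [hu.2])
    have h2 : |psiError u| ≤ A * Real.exp (U / 2) :=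
      (hA' u).trans (mul_le_mul_of_nonneg_left h1 hA.le)
    have h3 : Real.log 2 ^ 2 ≤ u ^ 2 := pow_le_pow_left₀ hl2.le (le_of_lt h) 2
    refine div_le_div₀ (by positivity) ?_ (by positivity) h3
    exact mul_le_mul h1 (by linarith) (by positivity) (by positivity)
  · rw [Set.indicator_of_notMem h, abs_zero]
    positivity

theorem exists_abs_primeError_sub_le :
    ∃ C₁ C₂ : ℝ, 0 < C₁ ∧ 0 < C₂ ∧ ∀ u : ℝ, Real.log 2 ≤ u →
      |primeError u - (psiError u - 1)| ≤ Real.exp (-u / 4) * |psiError (u / 2)| +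
        (C₁ * Real.exp (-u / 6) + 3 * (u * Real.exp (-u / 2))) +
        u * Real.exp (-u / 2) * ∫ v in Set.Ioc 0 u, secondaryDensity C₂ v := by
  obtain ⟨C₁, hC₁, h1⟩ := exists_abs_one_sub_psi_sub_theta_le
  obtain ⟨C₂, hC₂, h2⟩ := exists_abs_theta_sub_le
  refine ⟨C₁, C₂, hC₁, hC₂, fun u hu ↦ ?_⟩
  have hl2 : 0 < Real.log 2 := Real.log_pos (by norm_num)
  have hu0 : 0 < u := hl2.trans_le hu
  have hx : 2 ≤ Real.exp u := by rwa [← Real.log_le_iff_le_exp (by norm_num)]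
  have hid := log_mul_primePi_sub_Li hx
  rw [Real.log_exp] at hid
  set I := ∫ t in (2 : ℝ)..Real.exp u, (Chebyshev.theta t - t) / (t * Real.log t ^ 2) with hI
  set J := ∫ v in Set.Ioc 0 u, secondaryDensity C₂ v with hJ
  have hIJ : |I| ≤ J := by
    have himg : Real.exp '' Set.Ioc (Real.log 2) u = Set.Ioc 2 (Real.exp u) := by
      ext t
      constructor
      · rintro ⟨v, hv, rfl⟩
        exact ⟨(Real.log_lt_iff_lt_exp (by norm_num)).1 hv.1, Real.exp_le_exp.2 hv.2⟩
      · rintro ⟨ht1, ht2⟩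
        have ht0 : 0 < t := by linarith
        exact ⟨Real.log t, ⟨Real.log_lt_log (by norm_num) ht1, (Real.log_le_iff_le_exp ht0).2 ht2⟩,
          Real.exp_log ht0⟩
    have hJ' : J = ∫ v in Set.Ioc (Real.log 2) u,
        Real.exp (v / 2) * (|psiError v| + C₂) / v ^ 2 := by
      rw [hJ]
      unfold secondaryDensity
      rw [setIntegral_indicator measurableSet_Ioi]
      congr 2
      ext v
      simp only [Set.mem_inter_iff, Set.mem_Ioc, Set.mem_Ioi]
      constructor
      · rintro ⟨⟨_, h1⟩, h3⟩; exact ⟨h3, h1⟩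
      · rintro ⟨h1, h3⟩; exact ⟨⟨hl2.trans h1, h3⟩, h1⟩
    have hJint : IntegrableOn (fun v ↦ Real.exp (v / 2) * (|psiError v| + C₂) / v ^ 2)
        (Set.Ioc (Real.log 2) u) := by
      have h := (integrableOn_secondaryDensity hC₂ u).mono_set
        (Set.Ioc_subset_Ioc_left hl2.le : Set.Ioc (Real.log 2) u ⊆ Set.Ioc 0 u)
      refine h.congr_fun (fun v hv ↦ ?_) measurableSet_Ioc
      rw [secondaryDensity, Set.indicator_of_mem (Set.mem_Ioi.2 hv.1)]
    rw [hI, intervalIntegral.integral_of_le hx, ← himg,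
      integral_image_eq_integral_abs_deriv_smul measurableSet_Ioc
      (fun x _ ↦ (Real.hasDerivAt_exp x).hasDerivWithinAt) Real.exp_injective.injOn, hJ',
      ← Real.norm_eq_abs]
    refine norm_integral_le_of_norm_le hJint ?_
    filter_upwards [ae_restrict_mem measurableSet_Ioc] with v hv
    have hv0 : 0 < v := hl2.trans hv.1
    have hev := Real.exp_pos v
    rw [Real.log_exp, Real.abs_exp, smul_eq_mul]
    rw [norm_mul, norm_div, norm_mul, Real.norm_of_nonneg hev.le, Real.norm_of_nonneg (sq_nonneg v),
      ← mul_div_assoc, mul_div_mul_left _ _ hev.ne', Real.norm_eq_abs]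
    exact div_le_div_of_nonneg_right (h2 v hv0.le) (sq_nonneg v)
  have hF : primeError u - (psiError u - 1) =
      (1 - Real.exp (-u / 2) * (Chebyshev.psi (Real.exp u) - Chebyshev.theta (Real.exp u))) +
      u * Real.exp (-u / 2) * (I + 2 / Real.log 2) := by
    rw [primeError, if_pos hu, psiError, if_pos hu0.le]
    linear_combination Real.exp (-u / 2) * hid
  rw [hF]
  refine (abs_add_le _ _).trans ?_
  rw [abs_mul, abs_of_nonneg (show 0 ≤ u * Real.exp (-u / 2) by positivity)]
  have h3 : |I + 2 / Real.log 2| ≤ J + 3 := by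
    refine (abs_add_le _ _).trans (add_le_add hIJ ?_)
    rw [abs_of_pos (by positivity), div_le_iff₀ hl2]
    have := Real.log_two_gt_d9
    linarith
  have h4 := mul_le_mul_of_nonneg_left h3 (show 0 ≤ u * Real.exp (-u / 2) by positivity)
  have h5 := h1 u hu0.le
  linarith

theorem integrableOn_weight_mul {g w : ℝ → ℝ} {M U : ℝ} (hg : IntegrableOn g (Set.Ioc 0 U))
    (hw : Measurable w) (hw0 : ∀ u, 0 ≤ w u) (hwM : ∀ u, w u ≤ M) :
    IntegrableOn (fun u ↦ w u * g u) (Set.Ioc 0 U) := by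
  refine (hg.norm.const_mul M).mono' (hw.aestronglyMeasurable.mul hg.aestronglyMeasurable) ?_
  refine Eventually.of_forall fun u ↦ ?_
  rw [norm_mul, Real.norm_of_nonneg (hw0 u)]
  exact mul_le_mul_of_nonneg_right (hwM u) (norm_nonneg _)

/-- The weight that controls the averaged secondary term in `π - Li`. -/
noncomputable def secondaryWeight (v : ℝ) : ℝ :=
  (Set.Ioi (Real.log 2)).indicator (fun v ↦ (2 * v + 4) / v ^ 2) v

theorem secondaryWeight_nonneg (v : ℝ) : 0 ≤ secondaryWeight v := by
  have hl2 : 0 < Real.log 2 := Real.log_pos (by norm_num)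
  refine Set.indicator_nonneg (fun v hv ↦ ?_) v
  have : 0 < v := hl2.trans hv
  positivity

theorem secondaryWeight_le (v : ℝ) :
    secondaryWeight v ≤ 2 / Real.log 2 + 4 / Real.log 2 ^ 2 := by
  have hl2 : 0 < Real.log 2 := Real.log_pos (by norm_num)
  refine Set.indicator_le' (f := fun v ↦ (2 * v + 4) / v ^ 2)
    (g := fun _ ↦ 2 / Real.log 2 + 4 / Real.log 2 ^ 2) (fun v hv ↦ ?_) (fun _ _ ↦ by positivity) v
  have hv : Real.log 2 < v := hv
  have hv0 : 0 < v := hl2.trans hv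
  have e : (2 * v + 4) / v ^ 2 = 2 / v + 4 / v ^ 2 := by field_simp
  rw [e]
  exact add_le_add (div_le_div_of_nonneg_left (by norm_num) hl2 hv.le)
    (div_le_div_of_nonneg_left (by norm_num) (by positivity) (pow_le_pow_left₀ hl2.le hv.le 2))

theorem measurable_secondaryWeight : Measurable secondaryWeight :=
  Measurable.indicator (by fun_prop) measurableSet_Ioi

theorem tendsto_secondaryWeight : Tendsto secondaryWeight atTop (nhds 0) := by
  have h : Tendsto (fun v : ℝ ↦ 2 / v + 4 / v ^ 2) atTop (nhds (0 + 0)) :=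
    (tendsto_const_nhds.div_atTop tendsto_id).add
      (tendsto_const_nhds.div_atTop (tendsto_pow_atTop two_ne_zero))
  rw [add_zero] at h
  refine h.congr' ?_
  filter_upwards [eventually_gt_atTop (Real.log 2), eventually_gt_atTop 0] with v hv hv0
  rw [secondaryWeight, Set.indicator_of_mem (Set.mem_Ioi.2 hv)]
  field_simp

theorem integral_secondaryDensity_le {C : ℝ} (hC : 0 < C) (U : ℝ) :
    IntegrableOn (fun u ↦ u * Real.exp (-u / 2) * ∫ v in Set.Ioc 0 u, secondaryDensity C v)
      (Set.Ioc 0 U) ∧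
    ∫ u in Set.Ioc 0 U, u * Real.exp (-u / 2) * ∫ v in Set.Ioc 0 u, secondaryDensity C v ≤
      ∫ v in Set.Ioc 0 U, secondaryWeight v * (|psiError v| + C) := by
  have hl2 : 0 < Real.log 2 := Real.log_pos (by norm_num)
  have ha : IntegrableOn (fun u : ℝ ↦ u * Real.exp (-u / 2)) (Set.Ioc 0 U) :=
    Continuous.integrableOn_Ioc (by fun_prop)
  obtain ⟨h1, h2⟩ := integral_triangle_swap ha (integrableOn_secondaryDensity hC U)
  refine ⟨h1, ?_⟩
  rw [h2]
  have hgi : IntegrableOn (fun v ↦ secondaryWeight v * (|psiError v| + C)) (Set.Ioc 0 U) :=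
    integrableOn_weight_mul ((integrableOn_psiError U).abs.add (integrableOn_const (by simp)))
      measurable_secondaryWeight secondaryWeight_nonneg secondaryWeight_le
  refine integral_mono_of_nonneg ?_ hgi ?_
  · filter_upwards [ae_restrict_mem measurableSet_Ioc] with v hv
    refine mul_nonneg ?_ (setIntegral_nonneg measurableSet_Icc fun u hu ↦ ?_)
    · exact Set.indicator_nonneg (fun v _ ↦ by positivity) v
    · have : 0 < u := hv.1.trans_le hu.1
      positivity
  · filter_upwards [ae_restrict_mem measurableSet_Ioc] with v hv
    by_cases h : v ∈ Set.Ioi (Real.log 2)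
    · rw [secondaryDensity, Set.indicator_of_mem h, secondaryWeight, Set.indicator_of_mem h]
      have hv0 := hv.1
      refine (mul_le_mul_of_nonneg_left (integral_mul_exp_neg_half_le hv.1.le)
        (by positivity)).trans_eq ?_
      have e : Real.exp (v / 2) * Real.exp (-v / 2) = 1 := by
        rw [← Real.exp_add, ← Real.exp_zero]; ring_nf
      rw [div_mul_eq_mul_div, div_mul_eq_mul_div]
      congr 1
      linear_combination ((|psiError v| + C) * (2 * v + 4)) * e
    · rw [secondaryDensity, Set.indicator_of_notMem h, secondaryWeight, Set.indicator_of_notMem h]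
      simp

theorem setIntegral_Ioc_comp_half {f : ℝ → ℝ} {U : ℝ} (hU : 0 ≤ U) :
    ∫ u in Set.Ioc 0 U, f (u / 2) = 2 * ∫ u in Set.Ioc 0 (U / 2), f u := by
  rw [← intervalIntegral.integral_of_le hU, ← intervalIntegral.integral_of_le (by positivity),
    intervalIntegral.integral_comp_div _ two_ne_zero]
  simp

/-- In the mean, the prime counting error differs from the `ψ` error by the bias `-1`. -/
theorem tendsto_average_abs_primeError_sub
    (hRH : ∀ ρ : ℂ, riemannZeta₁ ρ = 0 → 0 < ρ.re → ρ.re = 1 / 2) :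
    (∀ U, IntegrableOn (fun u ↦ |primeError u - (psiError u - 1)|) (Set.Ioc 0 U)) ∧
    Tendsto (fun U : ℝ ↦ (1 / U) * ∫ u in Set.Ioc 0 U, |primeError u - (psiError u - 1)|)
      atTop (nhds 0) := by
  have hl2 : 0 < Real.log 2 := Real.log_pos (by norm_num)
  obtain ⟨C₁, C₂, hC₁, hC₂, hmain⟩ := exists_abs_primeError_sub_le
  obtain ⟨K, hK⟩ := exists_integral_abs_psiError_le hRH
  set g : ℝ → ℝ := fun u ↦ |psiError u| + (C₂ + 1) with hg
  set w₁ : ℝ → ℝ := fun u ↦ Real.exp (-|u| / 4)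
  set w₂ : ℝ → ℝ := fun u ↦ C₁ * Real.exp (-|u| / 6) + 3 * (|u| * Real.exp (-|u| / 2)) +
    (Set.Iio (Real.log 2)).indicator 1 u
  have hK0 : 0 ≤ K := by simpa using hK 0 le_rfl
  have hind0 (u : ℝ) : 0 ≤ (Set.Iio (Real.log 2)).indicator (1 : ℝ → ℝ) u :=
    Set.indicator_nonneg (fun _ _ ↦ zero_le_one) u
  have hind1 (u : ℝ) : (Set.Iio (Real.log 2)).indicator (1 : ℝ → ℝ) u ≤ 1 :=
    Set.indicator_le' (fun _ _ ↦ le_rfl) (fun _ _ ↦ zero_le_one) u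
  have hexp1 (c u : ℝ) (hc : 0 < c) : Real.exp (-|u| / c) ≤ 1 :=
    Real.exp_le_one_iff.2 (div_nonpos_of_nonpos_of_nonneg (by simp) hc.le)
  have hueu (u : ℝ) : |u| * Real.exp (-|u| / 2) ≤ 2 := by
    have h1 := Real.add_one_le_exp (|u| / 2)
    have e : Real.exp (|u| / 2) * Real.exp (-|u| / 2) = 1 := by
      rw [← Real.exp_add, ← Real.exp_zero]; ring_nf
    have := Real.exp_pos (-|u| / 2)
    nlinarith
  have hw₁0 (u : ℝ) : 0 ≤ w₁ u := (Real.exp_pos _).le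
  have hw₁1 (u : ℝ) : w₁ u ≤ 1 := hexp1 4 u (by norm_num)
  have hw₂0 (u : ℝ) : 0 ≤ w₂ u := add_nonneg (by positivity) (hind0 u)
  have hw₂1 (u : ℝ) : w₂ u ≤ C₁ + 3 * 2 + 1 := by
    refine add_le_add (add_le_add ?_ ?_) (hind1 u)
    · exact mul_le_of_le_one_right hC₁.le (hexp1 6 u (by norm_num))
    · exact mul_le_mul_of_nonneg_left (hueu u) (by norm_num)
  have hw₁m : Measurable w₁ := by fun_prop
  have hw₂m : Measurable w₂ :=
    Measurable.add (by fun_prop) (measurable_one.indicator measurableSet_Iio)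
  have htexp (c : ℝ) (hc : 0 < c) : Tendsto (fun u : ℝ ↦ Real.exp (-|u| / c)) atTop (nhds 0) := by
    refine Real.tendsto_exp_atBot.comp ?_
    simp only [neg_div]
    exact tendsto_neg_atTop_atBot.comp (tendsto_abs_atTop_atTop.atTop_div_const hc)
  have hw₁t : Tendsto w₁ atTop (nhds 0) := htexp 4 (by norm_num)
  have hw₂t : Tendsto w₂ atTop (nhds 0) := by
    have h1 : Tendsto (fun u : ℝ ↦ |u| * Real.exp (-|u| / 2)) atTop (nhds 0) := by
      have h := (Real.tendsto_pow_mul_exp_neg_atTop_nhds_zero 1).comp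
        ((tendsto_abs_atTop_atTop (G := ℝ)).atTop_div_const (zero_lt_two' ℝ))
      have h' := h.const_mul 2
      rw [mul_zero] at h'
      refine h'.congr fun u ↦ ?_
      simp only [Function.comp, pow_one, neg_div]
      ring
    have h2 : Tendsto ((Set.Iio (Real.log 2)).indicator (1 : ℝ → ℝ)) atTop (nhds 0) := by
      refine tendsto_const_nhds.congr' ?_
      filter_upwards [eventually_ge_atTop (Real.log 2)] with u hu
      rw [Set.indicator_of_notMem (by simpa using hu)]
    simpa using (((htexp 6 (by norm_num)).const_mul C₁).add (h1.const_mul 3)).add h2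
  have hgi (U : ℝ) : IntegrableOn g (Set.Ioc 0 U) :=
    (integrableOn_psiError U).abs.add (integrableOn_const (by simp))
  have hg0 (u : ℝ) : 0 ≤ g u := by positivity
  have hg1 (u : ℝ) : 1 ≤ g u := by
    have := abs_nonneg (psiError u)
    simp only [hg]
    linarith
  have hgK (U : ℝ) (hU : 0 ≤ U) : ∫ u in Set.Ioc 0 U, g u ≤ (K + C₂ + 1) * (1 + U) := by
    rw [hg, integral_add (integrableOn_psiError U).abs (integrableOn_const (by simp)),
      setIntegral_const, Real.volume_real_Ioc_of_le hU, smul_eq_mul]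
    nlinarith [hK U hU]
  have hh0 (u : ℝ) : 0 ≤ |psiError (u / 2)| := abs_nonneg _
  have hhi (U : ℝ) : IntegrableOn (fun u ↦ |psiError (u / 2)|) (Set.Ioc 0 U) := by
    obtain ⟨A, hA, hA'⟩ := exists_abs_psiError_le
    refine integrableOn_Ioc_of_measurable_of_bound (B := A * Real.exp (U / 2)) ?_ fun u hu ↦ ?_
    · exact (measurable_psiError.comp (measurable_id.div_const 2)).abs
    · rw [abs_abs]
      refine (hA' _).trans (mul_le_mul_of_nonneg_left (Real.exp_le_exp.2 ?_) hA.le)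
      linarith [hu.1, hu.2]
  have hhK (U : ℝ) (hU : 0 ≤ U) : ∫ u in Set.Ioc 0 U, |psiError (u / 2)| ≤ 2 * K * (1 + U) := by
    rw [setIntegral_Ioc_comp_half (f := fun u ↦ |psiError u|) hU]
    nlinarith [hK (U / 2) (by positivity)]
  have t₁ := tendsto_average_weight_mul hh0 hhi hhK hw₁0 hw₁1 hw₁t
  have t₂ := tendsto_average_weight_mul hg0 hgi hgK hw₂0 hw₂1 hw₂t
  have t₃ := tendsto_average_weight_mul hg0 hgi hgK secondaryWeight_nonneg secondaryWeight_le
    tendsto_secondaryWeight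
  set T : ℝ → ℝ := fun u ↦ u * Real.exp (-u / 2) * ∫ v in Set.Ioc 0 u, secondaryDensity C₂ v with hT
  have hTi (U : ℝ) : IntegrableOn T (Set.Ioc 0 U) := (integral_secondaryDensity_le hC₂ U).1
  have i₁ (U : ℝ) := integrableOn_weight_mul (hhi U) hw₁m hw₁0 hw₁1
  have i₂ (U : ℝ) := integrableOn_weight_mul (hgi U) hw₂m hw₂0 hw₂1
  have i₃ (U : ℝ) := integrableOn_weight_mul (hgi U) measurable_secondaryWeight
    secondaryWeight_nonneg secondaryWeight_le
  have hpt (u : ℝ) (hu : 0 < u) : |primeError u - (psiError u - 1)| ≤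
      w₁ u * |psiError (u / 2)| + w₂ u * g u + T u := by
    have hT0 : 0 ≤ T u := by
      refine mul_nonneg (by positivity) (setIntegral_nonneg measurableSet_Ioc fun v _ ↦ ?_)
      exact Set.indicator_nonneg (fun v _ ↦ by positivity) v
    by_cases h : Real.log 2 ≤ u
    · refine (hmain u h).trans (add_le_add (add_le_add ?_ ?_) le_rfl)
      · simp only [w₁, abs_of_pos hu]; exact le_rfl
      · refine le_trans (le_of_eq ?_) (le_mul_of_one_le_right (hw₂0 u) (hg1 u))
        simp only [w₂]
        rw [abs_of_pos hu, Set.indicator_of_notMem (by simpa using h), add_zero]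
    · have h1 : 1 ≤ w₂ u := by
        simp only [w₂]
        rw [Set.indicator_of_mem (by simpa using h), Pi.one_apply]
        have : 0 ≤ C₁ * Real.exp (-|u| / 6) + 3 * (|u| * Real.exp (-|u| / 2)) := by positivity
        linarith
      have h2 : g u ≤ w₂ u * g u := le_mul_of_one_le_left (hg0 u) h1
      have h3 : 0 ≤ w₁ u * |psiError (u / 2)| := mul_nonneg (hw₁0 u) (abs_nonneg _)
      have h4 : |primeError u - (psiError u - 1)| ≤ g u := by
        rw [primeError, if_neg h, zero_sub, abs_neg]
        refine (abs_sub _ _).trans ?_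
        simp only [hg, abs_one]
        linarith
      linarith
  have hinteg (U : ℝ) : IntegrableOn (fun u ↦ |primeError u - (psiError u - 1)|) (Set.Ioc 0 U) := by
    refine (((i₁ U).add (i₂ U)).add (hTi U)).mono' ?_ ?_
    · exact ((measurable_primeError.sub (measurable_psiError.sub_const 1)).abs).aestronglyMeasurable
    · filter_upwards [ae_restrict_mem measurableSet_Ioc] with u hu
      rw [Real.norm_eq_abs, abs_abs]
      exact hpt u hu.1
  refine ⟨hinteg, ?_⟩
  have hlim := (t₁.add t₂).add t₃
  rw [add_zero, add_zero] at hlim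
  refine tendsto_of_tendsto_of_tendsto_of_le_of_le' tendsto_const_nhds hlim ?_ ?_
  · filter_upwards [eventually_gt_atTop 0] with U hU
    exact mul_nonneg (by positivity) (integral_nonneg fun u ↦ abs_nonneg _)
  · filter_upwards [eventually_gt_atTop 0] with U hU
    rw [← mul_add, ← mul_add]
    refine mul_le_mul_of_nonneg_left ?_ (by positivity)
    calc ∫ u in Set.Ioc 0 U, |primeError u - (psiError u - 1)|
        ≤ ∫ u in Set.Ioc 0 U, (w₁ u * |psiError (u / 2)| + w₂ u * g u + T u) :=
          setIntegral_mono_on (hinteg U) (((i₁ U).add (i₂ U)).add (hTi U)) measurableSet_Ioc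
            fun u hu ↦ hpt u hu.1
      _ = (∫ u in Set.Ioc 0 U, w₁ u * |psiError (u / 2)|) + (∫ u in Set.Ioc 0 U, w₂ u * g u) +
          ∫ u in Set.Ioc 0 U, T u := by
          rw [integral_add (f := fun u ↦ w₁ u * |psiError (u / 2)| + w₂ u * g u)
            ((i₁ U).add (i₂ U)) (hTi U), integral_add (i₁ U) (i₂ U)]
      _ ≤ _ := by
          refine add_le_add le_rfl ((integral_secondaryDensity_le hC₂ U).2.trans ?_)
          have hgi' : IntegrableOn (fun v ↦ |psiError v| + C₂) (Set.Ioc 0 U) :=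
            (integrableOn_psiError U).abs.add (integrableOn_const (by simp))
          refine setIntegral_mono_on (integrableOn_weight_mul hgi' measurable_secondaryWeight
            secondaryWeight_nonneg secondaryWeight_le) (i₃ U) measurableSet_Ioc fun u _ ↦ ?_
          refine mul_le_mul_of_nonneg_left ?_ (secondaryWeight_nonneg u)
          simp only [hg]
          linarith

/-- The linear flow on a torus with frequencies `θ`. -/
noncomputable def torusFlow {ι : Type*} (θ : ι → ℝ) (u : ℝ) (i : ι) : UnitAddCircle :=
  ((θ i * u / (2 * Real.pi) : ℝ) : UnitAddCircle)

theorem continuous_torusFlow {ι : Type*} (θ : ι → ℝ) : Continuous (torusFlow θ) :=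
  continuous_pi fun i ↦ (AddCircle.continuous_mk' 1).comp (by fun_prop)

theorem fourier_torusFlow {ι : Type*} (θ : ι → ℝ) (u : ℝ) (i : ι) (n : ℤ) :
    fourier n (torusFlow θ u i) = Complex.exp (n * θ i * u * Complex.I) := by
  rw [torusFlow, fourier_coe_apply]
  congr 1
  have : (Real.pi : ℂ) ≠ 0 := by exact_mod_cast Real.pi_ne_zero
  push_cast
  field_simp

theorem tendsto_average_exp {a : ℝ} (ha : a ≠ 0) :
    Tendsto (fun U : ℝ ↦ (U⁻¹ : ℂ) * ∫ u in Set.Ioc 0 U, Complex.exp (a * u * Complex.I))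
      atTop (nhds 0) := by
  have hc : (a * Complex.I : ℂ) ≠ 0 := mul_ne_zero (by exact_mod_cast ha) Complex.I_ne_zero
  refine squeeze_zero_norm' (a := fun U ↦ U⁻¹ * (2 / |a|)) ?_ ?_
  · filter_upwards [eventually_gt_atTop 0] with U hU
    have h : ∫ u in Set.Ioc 0 U, Complex.exp (a * u * Complex.I) =
        (Complex.exp (a * Complex.I * U) - Complex.exp (a * Complex.I * (0 : ℝ))) /
          (a * Complex.I) := by
      rw [← intervalIntegral.integral_of_le hU.le, ← integral_exp_mul_complex hc]
      congr 1
      ext u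
      ring_nf
    rw [h, norm_mul, norm_div, norm_mul, norm_inv, Complex.norm_I, Complex.norm_real,
      Complex.norm_real, mul_one, Real.norm_eq_abs, Real.norm_eq_abs, abs_of_pos hU]
    refine mul_le_mul_of_nonneg_left ?_ (by positivity)
    refine div_le_div_of_nonneg_right ((norm_sub_le _ _).trans_eq ?_) (abs_nonneg a)
    have e (x : ℝ) : ‖Complex.exp (a * Complex.I * x)‖ = 1 := by
      rw [← Complex.norm_exp_ofReal_mul_I (a * x)]
      push_cast
      ring_nf
    rw [e, e]
    norm_num
  · simpa using tendsto_inv_atTop_zero.mul_const (2 / |a|)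

theorem sum_int_mul_ne_zero {d : Type*} [Fintype d] {θ : d → ℝ} (hθ : LinearIndependent ℚ θ)
    {n : d → ℤ} (hn : n ≠ 0) : ∑ i, (n i : ℝ) * θ i ≠ 0 := by
  intro h
  refine hn (funext fun i ↦ ?_)
  have := Fintype.linearIndependent_iff.1 hθ (fun i ↦ (n i : ℚ)) (by simpa [Rat.smul_def] using h) i
  exact_mod_cast this

theorem integral_mFourier_eq_zero {d : Type*} [Fintype d] {n : d → ℤ} (hn : n ≠ 0) :
    ∫ x, UnitAddTorus.mFourier n x
      ∂(Measure.pi fun _ : d ↦ (AddCircle.haarAddCircle : Measure UnitAddCircle)) = 0 := by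
  obtain ⟨i, hi⟩ := Function.ne_iff.1 hn
  simp only [UnitAddTorus.mFourier, ContinuousMap.coe_mk]
  rw [integral_fintype_prod_eq_prod]
  refine Finset.prod_eq_zero (Finset.mem_univ i) ?_
  exact integral_eq_zero_of_add_right_eq_neg (fourier_add_half_inv_index hi one_pos)

/-- Weyl equidistribution of the linear flow with rationally independent frequencies. -/
theorem tendsto_average_torusFlow {d : Type*} [Fintype d] {θ : d → ℝ}
    (hθ : LinearIndependent ℚ θ) (f : C(UnitAddTorus d, ℂ)) :
    Tendsto (fun U : ℝ ↦ (U⁻¹ : ℂ) * ∫ u in Set.Ioc 0 U, f (torusFlow θ u)) atTop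
      (nhds (∫ x, f x
        ∂(Measure.pi fun _ : d ↦ (AddCircle.haarAddCircle : Measure UnitAddCircle)))) := by
  set μ := Measure.pi fun _ : d ↦ (AddCircle.haarAddCircle : Measure UnitAddCircle) with hμ
  have hcont (f : C(UnitAddTorus d, ℂ)) : Continuous fun u ↦ f (torusFlow θ u) :=
    f.continuous.comp (continuous_torusFlow θ)
  have hinteg (f : C(UnitAddTorus d, ℂ)) (U : ℝ) :
      IntegrableOn (fun u ↦ f (torusFlow θ u)) (Set.Ioc 0 U) := (hcont f).integrableOn_Ioc
  have hintegμ (f : C(UnitAddTorus d, ℂ)) : Integrable f μ :=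
    Integrable.of_bound f.continuous.aestronglyMeasurable ‖f‖
      (Eventually.of_forall f.norm_coe_le_norm)
  have hspan (g : C(UnitAddTorus d, ℂ))
      (hg : g ∈ Submodule.span ℂ (Set.range (UnitAddTorus.mFourier (d := d)))) :
      Tendsto (fun U : ℝ ↦ (U⁻¹ : ℂ) * ∫ u in Set.Ioc 0 U, g (torusFlow θ u)) atTop
        (nhds (∫ x, g x ∂μ)) := by
    induction hg using Submodule.span_induction with
    | mem g hg =>
      obtain ⟨n, rfl⟩ := hg
      by_cases hn : n = 0
      · subst hn
        rw [UnitAddTorus.mFourier_zero]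
        simp only [ContinuousMap.one_apply, integral_const, probReal_univ, one_smul]
        refine tendsto_const_nhds.congr' ?_
        filter_upwards [eventually_gt_atTop 0] with U hU
        have : (U : ℂ) ≠ 0 := by exact_mod_cast hU.ne'
        rw [measureReal_restrict_apply_univ, Real.volume_real_Ioc_of_le hU.le, sub_zero]
        simp [this]
      · rw [integral_mFourier_eq_zero hn]
        refine (tendsto_average_exp (sum_int_mul_ne_zero hθ hn)).congr fun U ↦ ?_
        congr 2
        ext u
        simp only [UnitAddTorus.mFourier, ContinuousMap.coe_mk, fourier_torusFlow]
        rw [← Complex.exp_sum]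
        push_cast
        rw [Finset.sum_mul, Finset.sum_mul]
    | zero => simp
    | add f g _ _ hf hg =>
      simp only [ContinuousMap.add_apply]
      rw [integral_add (hintegμ f) (hintegμ g)]
      refine (hf.add hg).congr fun U ↦ ?_
      rw [integral_add (hinteg f U) (hinteg g U), mul_add]
    | smul c f _ hf =>
      simp only [ContinuousMap.smul_apply, smul_eq_mul]
      rw [integral_const_mul]
      refine (hf.const_mul c).congr fun U ↦ ?_
      rw [integral_const_mul]
      ring
  rw [Metric.tendsto_atTop]
  intro ε hε
  have hmem : f ∈ (Submodule.span ℂ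
      (Set.range (UnitAddTorus.mFourier (d := d)))).topologicalClosure := by
    rw [UnitAddTorus.span_mFourier_closure_eq_top]
    trivial
  obtain ⟨g, hg, hfg⟩ := Metric.mem_closure_iff.1 hmem (ε / 3) (by positivity)
  rw [dist_eq_norm] at hfg
  obtain ⟨T, hT⟩ := Metric.tendsto_atTop.1 (hspan g hg) (ε / 3) (by positivity)
  refine ⟨max T 1, fun U hU ↦ ?_⟩
  have hU0 : 0 < U := by linarith [(le_max_right T 1).trans hU]
  have h1 := hT U ((le_max_left _ _).trans hU)
  have hb (x) : ‖f x - g x‖ ≤ ‖f - g‖ := (f - g).norm_coe_le_norm x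
  have h2 : dist ((U⁻¹ : ℂ) * ∫ u in Set.Ioc 0 U, f (torusFlow θ u))
      ((U⁻¹ : ℂ) * ∫ u in Set.Ioc 0 U, g (torusFlow θ u)) ≤ ‖f - g‖ := by
    rw [dist_eq_norm, ← mul_sub, ← integral_sub (hinteg f U) (hinteg g U), norm_mul, norm_inv,
      Complex.norm_real, Real.norm_of_nonneg hU0.le, inv_mul_le_iff₀ hU0]
    refine (norm_setIntegral_le_of_norm_le_const (by simp) fun u _ ↦ hb _).trans_eq ?_
    rw [Real.volume_real_Ioc_of_le hU0.le, sub_zero, mul_comm]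
  have h3 : dist (∫ x, g x ∂μ) (∫ x, f x ∂μ) ≤ ‖f - g‖ := by
    rw [dist_comm, dist_eq_norm, ← integral_sub (hintegμ f) (hintegμ g)]
    refine (norm_integral_le_of_norm_le_const (Eventually.of_forall hb)).trans_eq ?_
    simp
  refine (dist_triangle4 _ _ _ _).trans_lt
    ((add_lt_add (add_lt_add (h2.trans_lt hfg) h1) (h3.trans_lt hfg)).trans_eq ?_)
  ring

/-- The uniform probability measure on a (possibly infinite) product of circles. -/
noncomputable def torusMeasure (ι : Type*) : Measure (ι → UnitAddCircle) :=
  Measure.infinitePi fun _ ↦ AddCircle.haarAddCircle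

instance (ι : Type*) : IsProbabilityMeasure (torusMeasure ι) := by
  unfold torusMeasure
  infer_instance

/-- A finite random trigonometric sum with amplitudes `c`. -/
noncomputable def trigSum {ι : Type*} (c : ι → ℂ) (t : Finset ι) (ω : ι → UnitAddCircle) : ℝ :=
  ∑ i ∈ t, (c i * fourier 1 (ω i)).re

section

variable {ι : Type*} (c : ι → ℂ) (t : Finset ι)

theorem continuous_trigSum : Continuous (trigSum c t) := by
  unfold trigSum
  fun_prop

theorem measurable_re_mul_fourier (z : ℂ) :
    Measurable fun x : UnitAddCircle ↦ (z * fourier 1 x).re := by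
  refine Continuous.measurable ?_
  fun_prop

theorem measurable_trigSum : Measurable (trigSum c t) :=
  Finset.measurable_fun_sum _ fun i _ ↦ (measurable_re_mul_fourier (c i)).comp (measurable_pi_apply i)

theorem abs_trigSum_le (ω : ι → UnitAddCircle) : |trigSum c t ω| ≤ ∑ i ∈ t, ‖c i‖ := by
  refine (Finset.abs_sum_le_sum_abs _ _).trans (Finset.sum_le_sum fun i _ ↦ ?_)
  refine (Complex.abs_re_le_norm _).trans_eq ?_
  rw [norm_mul, fourier_apply, Circle.norm_coe, mul_one]

theorem trigSum_restrict (ω : ι → UnitAddCircle) :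
    trigSum c t ω = trigSum (fun i : t ↦ c i) Finset.univ (t.restrict ω) := by
  simp only [trigSum, Finset.restrict]
  exact (Finset.sum_coe_sort t fun i ↦ (c i * fourier 1 (ω i)).re).symm

theorem map_trigSum : (torusMeasure ι).map (trigSum c t) =
    (Measure.pi fun _ : t ↦ (AddCircle.haarAddCircle : Measure UnitAddCircle)).map
      (trigSum (fun i : t ↦ c i) Finset.univ) := by
  rw [← Measure.infinitePi_map_restrict (fun _ : ι ↦ (AddCircle.haarAddCircle : Measure _)),
    Measure.map_map (measurable_trigSum _ _) (Finset.measurable_restrict t)]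
  congr 1
  ext ω
  exact trigSum_restrict c t ω

theorem trigSum_torusFlow (θ : ι → ℝ) (u : ℝ) : trigSum c t (torusFlow θ u) =
    ∑ i ∈ t, (c i * Complex.exp (θ i * u * Complex.I)).re := by
  simp only [trigSum, fourier_torusFlow, Int.cast_one, one_mul]

/-- The distribution of a trigonometric sum along the flow converges to its law on the torus. -/
theorem tendsto_average_comp_trigSum {θ : ι → ℝ} (hθ : LinearIndependent ℚ θ) {φ : ℝ → ℝ}
    (hφ : Continuous φ) :
    Tendsto (fun U : ℝ ↦ U⁻¹ * ∫ u in Set.Ioc 0 U, φ (trigSum c t (torusFlow θ u))) atTop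
      (nhds (∫ ω, φ (trigSum c t ω) ∂torusMeasure ι)) := by
  have hθ' : LinearIndependent ℚ fun i : t ↦ θ i := hθ.comp _ Subtype.val_injective
  let f : C(UnitAddTorus t, ℂ) :=
    ⟨fun x ↦ (φ (trigSum (fun i : t ↦ c i) Finset.univ x) : ℂ),
      Complex.continuous_ofReal.comp (hφ.comp (continuous_trigSum _ _))⟩
  have h := tendsto_average_torusFlow hθ' f
  have h1 : ∫ ω, φ (trigSum c t ω) ∂torusMeasure ι =
      ∫ x, φ (trigSum (fun i : t ↦ c i) Finset.univ x)
        ∂(Measure.pi fun _ : t ↦ (AddCircle.haarAddCircle : Measure UnitAddCircle)) := by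
    rw [← integral_map (measurable_trigSum c t).aemeasurable hφ.aestronglyMeasurable,
      map_trigSum, integral_map (measurable_trigSum _ _).aemeasurable hφ.aestronglyMeasurable]
  rw [h1]
  have h2 := (Complex.continuous_re.tendsto _).comp h
  convert h2 using 1
  · ext U
    simp only [Function.comp, f, ContinuousMap.coe_mk]
    rw [integral_complex_ofReal, ← Complex.ofReal_inv, ← Complex.ofReal_mul, Complex.ofReal_re]
    congr 3
    ext u
    rw [trigSum_restrict]
    rfl
  · simp only [f, ContinuousMap.coe_mk]
    rw [integral_complex_ofReal, Complex.ofReal_re]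

theorem exists_mul_fourier_eq (z w : ℂ) (hw : ‖w‖ = 1) :
    ∃ x : UnitAddCircle, z * fourier 1 x = ‖z‖ * w := by
  have hpi : (2 * Real.pi : ℂ) ≠ 0 := by exact_mod_cast Real.two_pi_pos.ne'
  refine ⟨(((w.arg - z.arg) / (2 * Real.pi) : ℝ) : UnitAddCircle), ?_⟩
  rw [fourier_coe_apply]
  have e : (2 * Real.pi * Complex.I * ((1 : ℤ) : ℂ) *
      (((w.arg - z.arg) / (2 * Real.pi) : ℝ) : ℂ) / ((1 : ℝ) : ℂ)) =
      w.arg * Complex.I - z.arg * Complex.I := by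
    push_cast
    field_simp
  rw [e, Complex.exp_sub]
  have hz := Complex.norm_mul_exp_arg_mul_I z
  have hw' := Complex.norm_mul_exp_arg_mul_I w
  rw [hw, Complex.ofReal_one, one_mul] at hw'
  rw [hw']
  nth_rewrite 1 [← hz]
  field_simp [Complex.exp_ne_zero]

theorem measure_trigSum_mem_pos {V : Set ℝ} (hV : IsOpen V) {w : ℂ} (hw : ‖w‖ = 1)
    (h : (∑ i ∈ t, ‖c i‖) * w.re ∈ V) : 0 < (torusMeasure ι).real {ω | trigSum c t ω ∈ V} := by
  have h1 : (torusMeasure ι) {ω | trigSum c t ω ∈ V} =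
      (Measure.pi fun _ : t ↦ (AddCircle.haarAddCircle : Measure UnitAddCircle))
        ((trigSum (fun i : t ↦ c i) Finset.univ) ⁻¹' V) := by
    rw [← Measure.map_apply (measurable_trigSum _ _) hV.measurableSet, ← map_trigSum,
      Measure.map_apply (measurable_trigSum _ _) hV.measurableSet]
    rfl
  rw [measureReal_def, h1]
  refine ENNReal.toReal_pos ?_ (measure_ne_top _ _)
  refine ((hV.preimage (continuous_trigSum _ _)).measure_pos _ ?_).ne'
  choose x hx using fun i : t ↦ exists_mul_fourier_eq (c i) w hw
  refine ⟨x, ?_⟩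
  rw [Set.mem_preimage]
  convert h
  simp only [trigSum, hx, Complex.re_ofReal_mul]
  rw [Finset.sum_mul]
  exact Finset.sum_coe_sort t fun i ↦ ‖c i‖ * w.re

theorem measure_trigSum_neg (V : Set ℝ) (hV : MeasurableSet V) :
    (torusMeasure ι) {ω | -trigSum c t ω ∈ V} = (torusMeasure ι) {ω | trigSum c t ω ∈ V} := by
  have hm : Measurable fun (ω : ι → UnitAddCircle) (i : ι) ↦ ω i + (((1 : ℝ) / 2 / (1 : ℤ) : ℝ) :
      UnitAddCircle) := by fun_prop
  have h : (torusMeasure ι).map (fun ω i ↦ ω i + (((1 : ℝ) / 2 / (1 : ℤ) : ℝ) : UnitAddCircle)) =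
      torusMeasure ι := by
    unfold torusMeasure
    rw [Measure.infinitePi_map_pi (f := fun _ x ↦ x + (((1 : ℝ) / 2 / (1 : ℤ) : ℝ) :
      UnitAddCircle)) _ (fun i ↦ by fun_prop)]
    congr 1
    ext1 i
    exact map_add_right_eq_self _ _
  change _ = torusMeasure ι (trigSum c t ⁻¹' V)
  conv_rhs => rw [← h, Measure.map_apply hm (measurable_trigSum c t hV)]
  congr 1
  ext ω
  simp only [Set.mem_ofPred_eq, Set.mem_preimage, trigSum]
  simp only [fourier_add_half_inv_index one_ne_zero one_pos, mul_neg, Complex.neg_re,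
    Finset.sum_neg_distrib]

theorem indepFun_trigSum {t t' : Finset ι} (h : Disjoint t t') :
    ProbabilityTheory.IndepFun (trigSum c t) (trigSum c t') (torusMeasure ι) := by
  have h1 : ProbabilityTheory.iIndepFun (fun i (ω : ι → UnitAddCircle) ↦ (c i * fourier 1 (ω i)).re)
      (torusMeasure ι) :=
    ProbabilityTheory.iIndepFun_infinitePi (X := fun i x ↦ (c i * fourier 1 x).re)
      fun i ↦ measurable_re_mul_fourier (c i)
  have h2 := h1.indepFun_finset t t' h
    fun i ↦ (measurable_re_mul_fourier (c i)).comp (measurable_pi_apply i)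
  have h3 (s : Finset ι) : Measurable fun x : s → ℝ ↦ ∑ i, x i := by fun_prop
  have h4 := h2.comp (h3 t) (h3 t')
  convert h4 using 1
  · ext ω
    exact (Finset.sum_coe_sort t fun i ↦ (c i * fourier 1 (ω i)).re).symm
  · ext ω
    exact (Finset.sum_coe_sort t' fun i ↦ (c i * fourier 1 (ω i)).re).symm

end

theorem haarAddCircle_singleton (x : UnitAddCircle) :
    (AddCircle.haarAddCircle : Measure UnitAddCircle) {x} = 0 := by
  have hv : (volume : Measure UnitAddCircle) = AddCircle.haarAddCircle := by
    rw [AddCircle.volume_eq_smul_haarAddCircle]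
    simp
  rw [← hv]
  refine le_antisymm (ENNReal.le_of_forall_pos_le_add fun ε hε _ ↦ ?_) zero_le
  rw [zero_add]
  calc (volume : Measure UnitAddCircle) {x} ≤ volume (Metric.closedBall x (ε / 2)) :=
        measure_mono (by simpa using (by positivity : (0 : ℝ) ≤ ε / 2))
    _ = ENNReal.ofReal (min 1 (2 * ((ε : ℝ) / 2))) := AddCircle.volume_closedBall _ _
    _ ≤ ENNReal.ofReal (ε : ℝ) := by
        refine ENNReal.ofReal_le_ofReal ((min_le_right _ _).trans_eq (by ring))
    _ = ε := ENNReal.ofReal_coe_nnreal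

theorem haarAddCircle_re_mul_fourier_eq {z : ℂ} (hz : z ≠ 0) (y : ℝ) :
    (AddCircle.haarAddCircle : Measure UnitAddCircle) {x | (z * fourier 1 x).re = y} = 0 := by
  have hnull : NullSingletonClass (AddCircle.haarAddCircle : Measure UnitAddCircle) :=
    ⟨haarAddCircle_singleton⟩
  let p : Polynomial ℂ := Polynomial.C z * Polynomial.X ^ 2 +
    Polynomial.C (-2 * y : ℂ) * Polynomial.X + Polynomial.C (starRingEnd ℂ z)
  have hp : p ≠ 0 := by
    intro h
    have := Polynomial.degree_quadratic (b := (-2 * y : ℂ)) (c := starRingEnd ℂ z) hz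
    rw [show Polynomial.C z * Polynomial.X ^ 2 + Polynomial.C (-2 * y : ℂ) * Polynomial.X +
      Polynomial.C (starRingEnd ℂ z) = p from rfl, h, Polynomial.degree_zero] at this
    exact absurd this (by decide)
  have hinj : Function.Injective fun x : UnitAddCircle ↦ (fourier 1 x : ℂ) := by
    intro a b hab
    simp only [fourier_one] at hab
    exact AddCircle.injective_toCircle one_ne_zero (Circle.coe_injective hab)
  refine Set.Finite.measure_zero (Set.Finite.subset
    (Set.Finite.preimage hinj.injOn (p.finite_setOfPred_isRoot hp)) fun x hx ↦ ?_) _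
  have hx : (z * fourier 1 x).re = y := hx
  rw [Set.mem_preimage, Set.mem_ofPred_eq, Polynomial.IsRoot]
  simp only [p, Polynomial.eval_add, Polynomial.eval_mul, Polynomial.eval_C, Polynomial.eval_pow,
    Polynomial.eval_X]
  set e : ℂ := fourier 1 x with he
  have h1 : e * starRingEnd ℂ e = 1 := by
    rw [Complex.mul_conj, Complex.normSq_eq_norm_sq, he, fourier_apply, Circle.norm_coe]
    norm_num
  have h2 : z * e + starRingEnd ℂ (z * e) = 2 * y := by
    rw [Complex.add_conj, hx]
    push_cast
    ring
  rw [map_mul] at h2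
  linear_combination e * h2 - starRingEnd ℂ z * h1

/-- Uniform anticoncentration of a single trigonometric wave. -/
theorem exists_haarAddCircle_small_ball {z : ℂ} (hz : z ≠ 0) {κ : ℝ} (hκ : 0 < κ) :
    ∃ ε : ℝ, 0 < ε ∧ ∀ y : ℝ, (AddCircle.haarAddCircle : Measure UnitAddCircle)
      {x | |(z * fourier 1 x).re - y| ≤ ε} ≤ ENNReal.ofReal κ := by
  set μ := (AddCircle.haarAddCircle : Measure UnitAddCircle)
  set X : UnitAddCircle → ℝ := fun x ↦ (z * fourier 1 x).re with hX
  have hXm : Measurable X := measurable_re_mul_fourier z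
  let A : ℕ → Set (UnitAddCircle × UnitAddCircle) :=
    fun n ↦ {p | |X p.1 - X p.2| ≤ 2 * (1 / ((n : ℝ) + 1))}
  have hdm : Measurable fun p : UnitAddCircle × UnitAddCircle ↦ |X p.1 - X p.2| :=
    ((hXm.comp measurable_fst).sub (hXm.comp measurable_snd)).abs
  have hAm (n : ℕ) : MeasurableSet (A n) := measurableSet_le hdm measurable_const
  have hanti : Antitone A := by
    intro m n hmn p hp
    refine le_trans (show |X p.1 - X p.2| ≤ _ from hp) ?_
    exact mul_le_mul_of_nonneg_left (Nat.one_div_le_one_div hmn) (by norm_num)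
  have hinter : (μ.prod μ) (⋂ n, A n) = 0 := by
    rw [Measure.measure_prod_null (MeasurableSet.iInter hAm)]
    refine Eventually.of_forall fun x ↦ ?_
    refine measure_mono_null (fun x' hx' ↦ ?_) (haarAddCircle_re_mul_fourier_eq hz (X x))
    rw [Set.mem_preimage, Set.mem_iInter] at hx'
    have h0 : |X x - X x'| ≤ 0 := by
      have ht : Tendsto (fun n : ℕ ↦ 2 * (1 / ((n : ℝ) + 1))) atTop (nhds (2 * 0)) :=
        tendsto_one_div_add_atTop_nhds_zero_nat.const_mul 2
      rw [mul_zero] at ht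
      exact ge_of_tendsto' ht hx'
    have := abs_nonpos_iff.1 h0
    change X x' = X x
    linarith
  have ht := tendsto_measure_iInter_atTop (μ := μ.prod μ)
    (fun n ↦ (hAm n).nullMeasurableSet) hanti ⟨0, measure_ne_top _ _⟩
  rw [hinter] at ht
  obtain ⟨n, hn⟩ := (ht.eventually (gt_mem_nhds
    (show (0 : ENNReal) < ENNReal.ofReal κ ^ 2 by
      exact ENNReal.pow_pos (ENNReal.ofReal_pos.2 hκ) 2))).exists
  refine ⟨1 / ((n : ℝ) + 1), by positivity, fun y ↦ ?_⟩
  have hsub : {x | |X x - y| ≤ 1 / ((n : ℝ) + 1)} ×ˢ {x | |X x - y| ≤ 1 / ((n : ℝ) + 1)} ⊆ A n := by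
    rintro ⟨a, b⟩ ⟨ha, hb⟩
    have ha : |X a - y| ≤ 1 / ((n : ℝ) + 1) := ha
    have hb : |X b - y| ≤ 1 / ((n : ℝ) + 1) := hb
    change |X a - X b| ≤ _
    rw [abs_le] at *
    constructor <;> linarith [ha.1, ha.2, hb.1, hb.2]
  have h := (measure_mono hsub).trans hn.le
  rw [Measure.prod_prod, ← sq] at h
  exact (ENNReal.pow_le_pow_left_iff two_ne_zero).1 h

theorem exists_trigSum_small_ball {ι : Type*} (c : ι → ℂ) {i : ι} (hi : c i ≠ 0) {κ : ℝ}
    (hκ : 0 < κ) : ∃ ε : ℝ, 0 < ε ∧ ∀ t : Finset ι, i ∈ t → ∀ y : ℝ,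
      (torusMeasure ι).real {ω | |trigSum c t ω - y| ≤ ε} ≤ κ := by
  classical
  obtain ⟨ε, hε, h⟩ := exists_haarAddCircle_small_ball hi hκ
  refine ⟨ε, hε, fun t hit y ↦ ?_⟩
  set X := trigSum c {i}
  set Y := trigSum c (t.erase i)
  have hXY : trigSum c t = fun ω ↦ X ω + Y ω := by
    ext ω
    simp only [X, Y, trigSum, Finset.sum_singleton]
    exact (Finset.add_sum_erase t _ hit).symm
  have hind : ProbabilityTheory.IndepFun X Y (torusMeasure ι) :=
    indepFun_trigSum c (by simp)
  have hXm : Measurable X := measurable_trigSum _ _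
  have hYm : Measurable Y := measurable_trigSum _ _
  rw [ProbabilityTheory.indepFun_iff_map_prod_eq_prod_map_map hXm.aemeasurable
    hYm.aemeasurable] at hind
  set B : Set (ℝ × ℝ) := {p | |p.1 + p.2 - y| ≤ ε}
  have hB : MeasurableSet B := measurableSet_le (by fun_prop) measurable_const
  have e1 : {ω | |trigSum c t ω - y| ≤ ε} = (fun ω ↦ (X ω, Y ω)) ⁻¹' B := by
    rw [hXY]
    rfl
  rw [measureReal_def]
  refine ENNReal.toReal_le_of_le_ofReal hκ.le ?_
  have hYp : IsProbabilityMeasure ((torusMeasure ι).map Y) :=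
    Measure.isProbabilityMeasure_map hYm.aemeasurable
  have hXp : IsProbabilityMeasure ((torusMeasure ι).map X) :=
    Measure.isProbabilityMeasure_map hXm.aemeasurable
  rw [e1, ← Measure.map_apply (hXm.prodMk hYm) hB, hind, Measure.prod_apply_symm hB]
  calc ∫⁻ b, ((torusMeasure ι).map X) ((fun a ↦ (a, b)) ⁻¹' B) ∂((torusMeasure ι).map Y)
      ≤ ∫⁻ _, ENNReal.ofReal κ ∂((torusMeasure ι).map Y) := by
        refine lintegral_mono fun b ↦ ?_
        have hBb : MeasurableSet ((fun a ↦ (a, b)) ⁻¹' B) := measurable_prodMk_right hB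
        rw [Measure.map_apply hXm hBb]
        have e2 : X ⁻¹' ((fun a ↦ (a, b)) ⁻¹' B) =
            (fun ω : ι → UnitAddCircle ↦ ω i) ⁻¹' {x | |(c i * fourier 1 x).re - (y - b)| ≤ ε} := by
          ext ω
          simp only [X, B, trigSum, Finset.sum_singleton, Set.mem_preimage, Set.mem_ofPred_eq]
          rw [show (c i * fourier 1 (ω i)).re + b - y = (c i * fourier 1 (ω i)).re - (y - b) by ring]
        have hm : MeasurableSet {x | |(c i * fourier 1 x).re - (y - b)| ≤ ε} :=
          measurableSet_le (((measurable_re_mul_fourier (c i)).sub_const _).abs) measurable_const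
        rw [e2, torusMeasure, (measurePreserving_eval_infinitePi
          (fun _ : ι ↦ (AddCircle.haarAddCircle : Measure UnitAddCircle)) i).measure_preimage
          hm.nullMeasurableSet]
        exact h _
    _ = ENNReal.ofReal κ := by simp

/-- The continuous function that is `0` on `x ≤ 0`, `1` on `x ≥ ε` and linear in between. -/
noncomputable def ramp (ε x : ℝ) : ℝ := max (min (x / ε) 1) 0

theorem continuous_ramp (ε : ℝ) : Continuous (ramp ε) := by
  unfold ramp
  fun_prop

theorem ramp_nonneg (ε x : ℝ) : 0 ≤ ramp ε x := le_max_right _ _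

theorem ramp_le_one (ε x : ℝ) : ramp ε x ≤ 1 := max_le (min_le_right _ _) zero_le_one

theorem ramp_of_nonpos {ε x : ℝ} (hε : 0 < ε) (hx : x ≤ 0) : ramp ε x = 0 :=
  max_eq_right ((min_le_left _ _).trans (div_nonpos_of_nonpos_of_nonneg hx hε.le))

theorem ramp_of_le {ε x : ℝ} (hε : 0 < ε) (hx : ε ≤ x) : ramp ε x = 1 := by
  rw [ramp, min_eq_right ((one_le_div hε).2 hx), max_eq_left zero_le_one]

theorem abs_ramp_sub_le {ε : ℝ} (hε : 0 < ε) (x y : ℝ) :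
    |ramp ε x - ramp ε y| ≤ |x - y| / ε := by
  refine (abs_max_sub_max_le_abs _ _ _).trans ((abs_min_sub_min_le_max _ _ _ _).trans ?_)
  rw [sub_self, abs_zero, max_eq_left (abs_nonneg _), ← sub_div, abs_div, abs_of_pos hε]

section

variable {ι : Type*} {θ : ι → ℝ} {c : ι → ℂ} {s : ℕ → Finset ι} {F : ℝ → ℝ}

theorem integrable_comp_trigSum {φ : ℝ → ℝ} (hφ : Continuous φ) (t : Finset ι) :
    Integrable (fun ω ↦ φ (trigSum c t ω)) (torusMeasure ι) := by
  obtain ⟨M, hM⟩ := (isCompact_Icc (a := -∑ i ∈ t, ‖c i‖)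
    (b := ∑ i ∈ t, ‖c i‖)).exists_bound_of_continuousOn hφ.continuousOn
  refine Integrable.of_bound (hφ.measurable.comp (measurable_trigSum c t)).aestronglyMeasurable M
    (Eventually.of_forall fun ω ↦ hM _ ?_)
  exact abs_le.1 (abs_trigSum_le c t ω)

theorem continuous_trigSum_torusFlow (θ : ι → ℝ) (c : ι → ℂ) (t : Finset ι) :
    Continuous fun u ↦ trigSum c t (torusFlow θ u) :=
  (continuous_trigSum c t).comp (continuous_torusFlow θ)

theorem trigSum_sdiff [DecidableEq ι] {t t' : Finset ι} (h : t ⊆ t') (ω : ι → UnitAddCircle) :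
    trigSum c (t' \ t) ω = trigSum c t' ω - trigSum c t ω := by
  simp only [trigSum]
  rw [← Finset.sum_sdiff h]
  ring

theorem exists_integral_abs_trigSum_sdiff_le [DecidableEq ι] (hθ : LinearIndependent ℚ θ)
    (hs : Monotone s) (hFi : ∀ U, IntegrableOn F (Set.Ioc 0 U))
    (hclose : ∀ η > 0, ∃ N₀, ∀ N ≥ N₀, ∀ᶠ U : ℝ in atTop,
      U⁻¹ * ∫ u in Set.Ioc 0 U, |F u + 1 - trigSum c (s N) (torusFlow θ u)| ≤ η)
    {η : ℝ} (hη : 0 < η) : ∃ N₀, ∀ M ≥ N₀, ∀ N ≥ M,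
      ∫ ω, |trigSum c (s N \ s M) ω| ∂torusMeasure ι ≤ η := by
  obtain ⟨N₀, hN₀⟩ := hclose (η / 2) (by positivity)
  refine ⟨N₀, fun M hM N hN ↦ ?_⟩
  refine le_of_tendsto (tendsto_average_comp_trigSum c (s N \ s M) hθ continuous_abs) ?_
  filter_upwards [hN₀ N (hM.le.trans hN), hN₀ M hM, eventually_gt_atTop 0] with U h1 h2 hU
  have hi (K : ℕ) : IntegrableOn (fun u ↦ |F u + 1 - trigSum c (s K) (torusFlow θ u)|)
      (Set.Ioc 0 U) :=
    (((hFi U).add (integrableOn_const (by simp))).sub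
      (continuous_trigSum_torusFlow θ c (s K)).integrableOn_Ioc).abs
  have h3 : ∫ u in Set.Ioc 0 U, |trigSum c (s N \ s M) (torusFlow θ u)| ≤
      (∫ u in Set.Ioc 0 U, |F u + 1 - trigSum c (s N) (torusFlow θ u)|) +
        ∫ u in Set.Ioc 0 U, |F u + 1 - trigSum c (s M) (torusFlow θ u)| := by
    rw [← integral_add (hi N) (hi M)]
    refine setIntegral_mono_on (continuous_trigSum_torusFlow θ c _).abs.integrableOn_Ioc
      ((hi N).add (hi M)) measurableSet_Ioc fun u _ ↦ ?_
    rw [trigSum_sdiff (hs hN), abs_sub_comm]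
    have := abs_sub_le (trigSum c (s M) (torusFlow θ u)) (F u + 1) (trigSum c (s N) (torusFlow θ u))
    rw [abs_sub_comm (trigSum c (s M) (torusFlow θ u)) (F u + 1)] at this
    linarith
  have h4 := mul_le_mul_of_nonneg_left h3 (inv_nonneg.2 hU.le)
  rw [mul_add] at h4
  linarith

theorem exists_le_measure_trigSum (hθ : LinearIndependent ℚ θ) (hs : Monotone s)
    (hsum : Tendsto (fun N ↦ ∑ i ∈ s N, ‖c i‖) atTop atTop)
    (hFi : ∀ U, IntegrableOn F (Set.Ioc 0 U))
    (hclose : ∀ η > 0, ∃ N₀, ∀ N ≥ N₀, ∀ᶠ U : ℝ in atTop,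
      U⁻¹ * ∫ u in Set.Ioc 0 U, |F u + 1 - trigSum c (s N) (torusFlow θ u)| ≤ η) :
    ∃ p : ℝ, 0 < p ∧ ∃ N₀, ∀ N ≥ N₀,
      p ≤ (torusMeasure ι).real {ω | 1 < trigSum c (s N) ω} ∧
      p ≤ (torusMeasure ι).real {ω | |trigSum c (s N) ω| ≤ 1} := by
  classical
  obtain ⟨N₀, hN₀⟩ := exists_integral_abs_trigSum_sdiff_le hθ hs hFi hclose
    (show (0 : ℝ) < 1 / 4 by norm_num)
  obtain ⟨M, hM0, hM⟩ := ((eventually_ge_atTop N₀).and (hsum.eventually_gt_atTop 2)).exists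
  set P := torusMeasure ι
  have key (V W : Set ℝ) (hV : MeasurableSet V) (hVW : ∀ x ∈ V, ∀ r, |r| ≤ 1 / 2 → x + r ∈ W)
      (N : ℕ) (hN : N ≥ M) :
      P.real {ω | trigSum c (s M) ω ∈ V} * (1 / 2) ≤ P.real {ω | trigSum c (s N) ω ∈ W} := by
    set R := trigSum c (s N \ s M) with hR
    have hRm : Measurable R := measurable_trigSum _ _
    have hE : ∫ ω, |R ω| ∂P ≤ 1 / 4 := hN₀ M hM0 N hN
    have hmk := mul_meas_ge_le_integral_of_nonneg (μ := P) (f := fun ω ↦ |R ω|)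
      (Eventually.of_forall fun ω ↦ abs_nonneg _)
      (integrable_comp_trigSum (c := c) continuous_abs (s N \ s M)) (1 / 2)
    have hA : MeasurableSet {r : ℝ | |r| ≤ 1 / 2} := measurableSet_le (by fun_prop) measurable_const
    have hhalf : 1 / 2 ≤ P.real (R ⁻¹' {r | |r| ≤ 1 / 2}) := by
      have h1 := probReal_compl_eq_one_sub (μ := P) (hRm hA)
      have h2 : P.real (R ⁻¹' {r | |r| ≤ 1 / 2})ᶜ ≤ P.real {ω | 1 / 2 ≤ |R ω|} :=
        measureReal_mono fun ω hω ↦ by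
          simp only [Set.mem_compl_iff, Set.mem_preimage, Set.mem_ofPred_eq, not_le] at hω
          exact hω.le
      linarith
    have hind : ProbabilityTheory.IndepFun (trigSum c (s M)) R P :=
      indepFun_trigSum c Finset.disjoint_sdiff
    have hprod := hind.measure_inter_preimage_eq_mul V {r | |r| ≤ 1 / 2} hV hA
    have hprod' : P.real (trigSum c (s M) ⁻¹' V ∩ R ⁻¹' {r | |r| ≤ 1 / 2}) =
        P.real (trigSum c (s M) ⁻¹' V) * P.real (R ⁻¹' {r | |r| ≤ 1 / 2}) := by
      simp only [measureReal_def, hprod, ENNReal.toReal_mul]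
    calc P.real {ω | trigSum c (s M) ω ∈ V} * (1 / 2)
        ≤ P.real (trigSum c (s M) ⁻¹' V) * P.real (R ⁻¹' {r | |r| ≤ 1 / 2}) :=
          mul_le_mul_of_nonneg_left hhalf measureReal_nonneg
      _ = _ := hprod'.symm
      _ ≤ _ := measureReal_mono fun ω hω ↦ by
          have h := hVW _ hω.1 _ hω.2
          rw [hR, trigSum_sdiff (hs hN), add_sub_cancel] at h
          exact h
  have hpos1 : 0 < P.real {ω | trigSum c (s M) ω ∈ Set.Ioi 2} :=
    measure_trigSum_mem_pos c (s M) isOpen_Ioi (w := 1) (by simp) (by simpa using hM)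
  have hpos2 : 0 < P.real {ω | trigSum c (s M) ω ∈ Set.Ioo (-(1 / 2)) (1 / 2)} :=
    measure_trigSum_mem_pos c (s M) isOpen_Ioo (w := Complex.I) (by simp) (by norm_num)
  refine ⟨min (P.real {ω | trigSum c (s M) ω ∈ Set.Ioi 2} * (1 / 2))
    (P.real {ω | trigSum c (s M) ω ∈ Set.Ioo (-(1 / 2)) (1 / 2)} * (1 / 2)),
    lt_min (by positivity) (by positivity), M, fun N hN ↦ ⟨?_, ?_⟩⟩
  · refine (min_le_left _ _).trans (key _ (Set.Ioi 1) measurableSet_Ioi (fun x hx r hr ↦ ?_) N hN)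
    have hx : 2 < x := hx
    have := (abs_le.1 hr).1
    rw [Set.mem_Ioi]
    linarith
  · refine (min_le_right _ _).trans (key _ {x | |x| ≤ 1} measurableSet_Ioo (fun x hx r hr ↦ ?_) N hN)
    have := abs_le.1 hr
    rw [Set.mem_ofPred_eq, abs_le]
    constructor <;> linarith [hx.1, hx.2]

theorem two_mul_measure_one_lt_trigSum_le (c : ι → ℂ) (t : Finset ι) :
    2 * (torusMeasure ι).real {ω | 1 < trigSum c t ω} ≤
      1 - (torusMeasure ι).real {ω | |trigSum c t ω| ≤ 1} := by
  set P := torusMeasure ι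
  have hm := measurable_trigSum c t
  have h1 : P.real {ω | -trigSum c t ω ∈ Set.Ioi 1} = P.real {ω | trigSum c t ω ∈ Set.Ioi 1} := by
    rw [measureReal_def, measureReal_def, measure_trigSum_neg c t _ measurableSet_Ioi]
  have hA : MeasurableSet {ω | 1 < trigSum c t ω} := measurableSet_lt measurable_const hm
  have hB : MeasurableSet {ω | 1 < -trigSum c t ω} := measurableSet_lt measurable_const hm.neg
  have hC : MeasurableSet {ω | |trigSum c t ω| ≤ 1} := measurableSet_le hm.abs measurable_const
  have hAB : Disjoint {ω | 1 < trigSum c t ω} {ω | 1 < -trigSum c t ω} :=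
    Set.disjoint_left.2 fun ω h h' ↦ by
      simp only [Set.mem_ofPred_eq] at h h'
      linarith
  have hABC : Disjoint ({ω | 1 < trigSum c t ω} ∪ {ω | 1 < -trigSum c t ω})
      {ω | |trigSum c t ω| ≤ 1} := by
    refine Set.disjoint_left.2 fun ω h h' ↦ ?_
    have := abs_le.1 (show |trigSum c t ω| ≤ 1 from h')
    rcases h with h | h
    · have h : 1 < trigSum c t ω := h
      linarith
    · have h : 1 < -trigSum c t ω := h
      linarith
  have h2 := measureReal_union (μ := P) hAB hB
  have h3 := measureReal_union (μ := P) hABC hC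
  have h4 : P.real ({ω | 1 < trigSum c t ω} ∪ {ω | 1 < -trigSum c t ω} ∪
    {ω | |trigSum c t ω| ≤ 1}) ≤ 1 := measureReal_le_one
  simp only [Set.mem_Ioi] at h1
  linarith

end

section

variable {ι : Type*} {θ : ι → ℝ} {c : ι → ℂ} {s : ℕ → Finset ι} {F : ℝ → ℝ}

theorem integral_ramp_trigSum_le {ε : ℝ} (hε : 0 < ε) (t : Finset ι) :
    ∫ ω, ramp ε (trigSum c t ω - 1 + ε) ∂torusMeasure ι ≤
      (torusMeasure ι).real {ω | 1 < trigSum c t ω} +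
        (torusMeasure ι).real {ω | |trigSum c t ω - 1| ≤ ε} := by
  have hm := measurable_trigSum c t
  have hA : MeasurableSet {ω | 1 < trigSum c t ω} := measurableSet_lt measurable_const hm
  have hB : MeasurableSet {ω | |trigSum c t ω - 1| ≤ ε} :=
    measurableSet_le (hm.sub_const 1).abs measurable_const
  have hiA : Integrable ({ω | 1 < trigSum c t ω}.indicator (1 : (ι → UnitAddCircle) → ℝ))
      (torusMeasure ι) := (integrable_const (1 : ℝ)).indicator hA
  have hiB : Integrable ({ω | |trigSum c t ω - 1| ≤ ε}.indicator (1 : (ι → UnitAddCircle) → ℝ))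
      (torusMeasure ι) := (integrable_const (1 : ℝ)).indicator hB
  rw [← integral_indicator_one hA, ← integral_indicator_one hB, ← integral_add hiA hiB]
  refine integral_mono (integrable_comp_trigSum (φ := fun x ↦ ramp ε (x - 1 + ε))
    ((continuous_ramp ε).comp (by fun_prop)) t) (hiA.add hiB) fun ω ↦ ?_
  simp only [Set.indicator, Set.mem_ofPred_eq, Pi.one_apply]
  have h1 := ramp_le_one ε (trigSum c t ω - 1 + ε)
  split_ifs with h2 h3 h3
  · linarith
  · linarith
  · linarith
  · rw [ramp_of_nonpos hε, add_zero]
    by_contra! h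
    exact h3 (abs_le.2 ⟨by linarith, by linarith⟩)

theorem le_integral_ramp_trigSum {ε : ℝ} (hε : 0 < ε) (t : Finset ι) :
    (torusMeasure ι).real {ω | 1 < trigSum c t ω} ≤
      ∫ ω, ramp ε (trigSum c t ω - 1) ∂torusMeasure ι +
        (torusMeasure ι).real {ω | |trigSum c t ω - 1| ≤ ε} := by
  have hm := measurable_trigSum c t
  have hA : MeasurableSet {ω | 1 < trigSum c t ω} := measurableSet_lt measurable_const hm
  have hB : MeasurableSet {ω | |trigSum c t ω - 1| ≤ ε} :=
    measurableSet_le (hm.sub_const 1).abs measurable_const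
  have hiA : Integrable ({ω | 1 < trigSum c t ω}.indicator (1 : (ι → UnitAddCircle) → ℝ))
      (torusMeasure ι) := (integrable_const (1 : ℝ)).indicator hA
  have hiB : Integrable ({ω | |trigSum c t ω - 1| ≤ ε}.indicator (1 : (ι → UnitAddCircle) → ℝ))
      (torusMeasure ι) := (integrable_const (1 : ℝ)).indicator hB
  have hiR := integrable_comp_trigSum (c := c) (φ := fun x ↦ ramp ε (x - 1))
    ((continuous_ramp ε).comp (by fun_prop)) t
  rw [← integral_indicator_one hA, ← integral_indicator_one hB, ← integral_add hiR hiB]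
  refine integral_mono hiA (hiR.add hiB) fun ω ↦ ?_
  simp only [Set.indicator, Set.mem_ofPred_eq, Pi.one_apply]
  have h1 := ramp_nonneg ε (trigSum c t ω - 1)
  split_ifs with h2 h3 h3
  · linarith
  · rw [ramp_of_le hε, add_zero]
    by_contra! h
    exact h3 (abs_le.2 ⟨by linarith, by linarith⟩)
  · linarith
  · linarith

theorem exists_abs_average_indicator_sub_le (hθ : LinearIndependent ℚ θ) (hs : Monotone s)
    (hsum : Tendsto (fun N ↦ ∑ i ∈ s N, ‖c i‖) atTop atTop) (hF : Measurable F)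
    (hFi : ∀ U, IntegrableOn F (Set.Ioc 0 U))
    (hclose : ∀ η > 0, ∃ N₀, ∀ N ≥ N₀, ∀ᶠ U : ℝ in atTop,
      U⁻¹ * ∫ u in Set.Ioc 0 U, |F u + 1 - trigSum c (s N) (torusFlow θ u)| ≤ η)
    {η : ℝ} (hη : 0 < η) : ∃ N₀, ∀ N ≥ N₀, ∀ᶠ U : ℝ in atTop,
      |U⁻¹ * (∫ u in Set.Ioc 0 U, {u | 0 < F u}.indicator 1 u) -
        (torusMeasure ι).real {ω | 1 < trigSum c (s N) ω}| ≤ η := by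
  obtain ⟨N₁, hN₁⟩ := (hsum.eventually_gt_atTop 0).exists
  obtain ⟨i, hi, hci⟩ := Finset.exists_ne_zero_of_sum_ne_zero hN₁.ne'
  obtain ⟨ε, hε, hball⟩ := exists_trigSum_small_ball c (norm_ne_zero_iff.1 hci)
    (show 0 < η / 3 by positivity)
  obtain ⟨N₀, hN₀⟩ := hclose (ε * (η / 3)) (by positivity)
  refine ⟨max N₀ N₁, fun N hN ↦ ?_⟩
  have hball' := hball (s N) (hs ((le_max_right _ _).trans hN) hi) 1
  have hup := integral_ramp_trigSum_le (c := c) hε (s N)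
  have hlo := le_integral_ramp_trigSum (c := c) hε (s N)
  have tup := tendsto_average_comp_trigSum c (s N) hθ (φ := fun x ↦ ramp ε (x - 1 + ε))
    ((continuous_ramp ε).comp (by fun_prop))
  have tlo := tendsto_average_comp_trigSum c (s N) hθ (φ := fun x ↦ ramp ε (x - 1))
    ((continuous_ramp ε).comp (by fun_prop))
  filter_upwards [hN₀ N ((le_max_left _ _).trans hN), eventually_gt_atTop 0,
    tup.eventually (gt_mem_nhds (lt_add_of_pos_right _ (show 0 < η / 3 by positivity))),
    tlo.eventually (lt_mem_nhds (sub_lt_self _ (show 0 < η / 3 by positivity)))]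
    with U h1 hU h2 h3
  set S : ℝ → ℝ := fun u ↦ trigSum c (s N) (torusFlow θ u) with hS
  have hSc : Continuous S := continuous_trigSum_torusFlow θ c (s N)
  have hU' : 0 ≤ U⁻¹ := inv_nonneg.2 hU.le
  have hdi : IntegrableOn (fun u ↦ |F u + 1 - S u|) (Set.Ioc 0 U) :=
    (((hFi U).add (integrableOn_const (by simp))).sub hSc.integrableOn_Ioc).abs
  have hdi' := hdi.div_const ε
  have hind : IntegrableOn ({u | 0 < F u}.indicator (1 : ℝ → ℝ)) (Set.Ioc 0 U) := by
    refine integrableOn_Ioc_of_measurable_of_bound (B := 1)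
      (measurable_one.indicator (measurableSet_lt measurable_const hF)) fun u _ ↦ ?_
    rw [Set.indicator]
    split_ifs <;> simp
  have hup' : IntegrableOn (fun u ↦ ramp ε (S u - 1 + ε)) (Set.Ioc 0 U) :=
    ((continuous_ramp ε).comp (by fun_prop)).integrableOn_Ioc
  have hlo' : IntegrableOn (fun u ↦ ramp ε (S u - 1)) (Set.Ioc 0 U) :=
    ((continuous_ramp ε).comp (by fun_prop)).integrableOn_Ioc
  have e1 : ∫ u in Set.Ioc 0 U, {u | 0 < F u}.indicator (1 : ℝ → ℝ) u ≤
      (∫ u in Set.Ioc 0 U, ramp ε (S u - 1 + ε)) + (∫ u in Set.Ioc 0 U, |F u + 1 - S u|) / ε := by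
    rw [← integral_div, ← integral_add hup' hdi']
    refine integral_mono hind (hup'.add hdi') fun u ↦ ?_
    have h4 := (abs_le.1 (abs_ramp_sub_le hε (F u + ε) (S u - 1 + ε))).2
    rw [show F u + ε - (S u - 1 + ε) = F u + 1 - S u by ring] at h4
    simp only [Set.indicator, Set.mem_ofPred_eq, Pi.one_apply]
    split_ifs with h5
    · rw [ramp_of_le hε (show ε ≤ F u + ε by linarith)] at h4
      linarith
    · have := ramp_nonneg ε (S u - 1 + ε)
      positivity
  have e2 : ∫ u in Set.Ioc 0 U, ramp ε (S u - 1) ≤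
      (∫ u in Set.Ioc 0 U, {u | 0 < F u}.indicator (1 : ℝ → ℝ) u) +
        (∫ u in Set.Ioc 0 U, |F u + 1 - S u|) / ε := by
    rw [← integral_div, ← integral_add hind hdi']
    refine integral_mono hlo' (hind.add hdi') fun u ↦ ?_
    have h4 := (abs_le.1 (abs_ramp_sub_le hε (F u) (S u - 1))).1
    rw [show F u - (S u - 1) = F u + 1 - S u by ring] at h4
    simp only [Set.indicator, Set.mem_ofPred_eq, Pi.one_apply]
    split_ifs with h5
    · have := ramp_le_one ε (F u)
      linarith
    · rw [ramp_of_nonpos hε (not_lt.1 h5)] at h4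
      linarith
  have e3 : U⁻¹ * ((∫ u in Set.Ioc 0 U, |F u + 1 - S u|) / ε) ≤ η / 3 := by
    rw [← mul_div_assoc, div_le_iff₀ hε, mul_comm (η / 3)]
    exact h1
  have f1 := mul_le_mul_of_nonneg_left e1 hU'
  have f2 := mul_le_mul_of_nonneg_left e2 hU'
  rw [mul_add] at f1 f2
  rw [abs_le]
  constructor <;> linarith

/-- A function that is approximated in the mean by trigonometric sums with rationally independent
frequencies and divergent total amplitude, shifted by `-1`, is positive on a set whose density
exists and lies strictly between `0` and `1 / 2`. -/
theorem exists_tendsto_average_indicator_pos (hθ : LinearIndependent ℚ θ) (hs : Monotone s)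
    (hsum : Tendsto (fun N ↦ ∑ i ∈ s N, ‖c i‖) atTop atTop) (hF : Measurable F)
    (hFi : ∀ U, IntegrableOn F (Set.Ioc 0 U))
    (hclose : ∀ η > 0, ∃ N₀, ∀ N ≥ N₀, ∀ᶠ U : ℝ in atTop,
      U⁻¹ * ∫ u in Set.Ioc 0 U, |F u + 1 - trigSum c (s N) (torusFlow θ u)| ≤ η) :
    ∃ δ : ℝ, Tendsto (fun U : ℝ ↦ U⁻¹ * ∫ u in Set.Ioc 0 U, {u | 0 < F u}.indicator 1 u) atTop
      (nhds δ) ∧ 0 < δ ∧ δ < 1 / 2 := by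
  set D : ℝ → ℝ := fun U ↦ U⁻¹ * ∫ u in Set.Ioc 0 U, {u | 0 < F u}.indicator 1 u with hD
  have happrox := fun {η : ℝ} (hη : 0 < η) ↦
    exists_abs_average_indicator_sub_le hθ hs hsum hF hFi hclose hη
  obtain ⟨p, hp, N₁, hN₁⟩ := exists_le_measure_trigSum hθ hs hsum hFi hclose
  have hcauchy : Cauchy (map D atTop) := by
    rw [Metric.cauchy_iff]
    refine ⟨inferInstance, fun ε hε ↦ ?_⟩
    obtain ⟨N₀, hN₀⟩ := happrox (show 0 < ε / 3 by positivity)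
    refine ⟨D '' {U | |D U - (torusMeasure ι).real {ω | 1 < trigSum c (s N₀) ω}| ≤ ε / 3},
      image_mem_map (hN₀ N₀ le_rfl), ?_⟩
    rintro _ ⟨U, hU, rfl⟩ _ ⟨V, hV, rfl⟩
    have hU := abs_le.1 (Set.mem_ofPred_eq ▸ hU)
    have hV := abs_le.1 (Set.mem_ofPred_eq ▸ hV)
    rw [Real.dist_eq, abs_lt]
    constructor <;> linarith [hU.1, hU.2, hV.1, hV.2]
  obtain ⟨δ, hδ⟩ := CompleteSpace.complete hcauchy
  have hδ : Tendsto D atTop (nhds δ) := hδ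
  obtain ⟨N₀, hN₀⟩ := happrox (show 0 < p / 4 by positivity)
  set N := max N₀ N₁
  have h1 := hN₀ N (le_max_left _ _)
  have h2 := hN₁ N (le_max_right _ _)
  have h3 := two_mul_measure_one_lt_trigSum_le c (s N)
  have hge : (torusMeasure ι).real {ω | 1 < trigSum c (s N) ω} - p / 4 ≤ δ :=
    ge_of_tendsto hδ (h1.mono fun U hU ↦ by linarith [(abs_le.1 hU).1])
  have hle : δ ≤ (torusMeasure ι).real {ω | 1 < trigSum c (s N) ω} + p / 4 :=
    le_of_tendsto hδ (h1.mono fun U hU ↦ by linarith [(abs_le.1 hU).2])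
  exact ⟨δ, hδ, by linarith [h2.1], by linarith [h2.2]⟩

end

theorem riemannZeta₁_conj_eq_zero {ρ : ℂ} (hρ : 0 < ρ.re) (h : riemannZeta₁ ρ = 0) :
    riemannZeta₁ (starRingEnd ℂ ρ) = 0 := by
  rw [riemannZeta₁_eq_zero_iff hρ] at h
  rw [riemannZeta₁_eq_zero_iff (by simpa using hρ), riemannZeta_conj, h.1]
  simpa using h.2

/-- The ordinates up to height `N` of the zeros on the critical line. -/
noncomputable def criticalOrdinates (N : ℕ) : Finset ℝ :=
  ((criticalZeros N).filter fun ρ ↦ 0 < ρ.im).image Complex.im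

/-- The point of height `γ` on the critical line. -/
noncomputable def criticalPoint (γ : ℝ) : ℂ := ⟨1 / 2, γ⟩

theorem norm_criticalPoint_neg (γ : ℝ) : ‖criticalPoint (-γ)‖ = ‖criticalPoint γ‖ := by
  simp [criticalPoint, Complex.norm_def, Complex.normSq_mk]

theorem criticalPoint_im_of_mem {N : ℕ} {ρ : ℂ} (h : ρ ∈ criticalZeros N) :
    criticalPoint ρ.im = ρ :=
  Complex.ext ((mem_criticalZeros.1 h).2.1).symm rfl

theorem mem_criticalOrdinates {N : ℕ} {γ : ℝ} :
    γ ∈ criticalOrdinates N ↔ 0 < γ ∧ criticalPoint γ ∈ criticalZeros N := by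
  simp only [criticalOrdinates, Finset.mem_image, Finset.mem_filter]
  constructor
  · rintro ⟨ρ, ⟨h1, h2⟩, rfl⟩
    exact ⟨h2, by rwa [criticalPoint_im_of_mem h1]⟩
  · rintro ⟨h1, h2⟩
    exact ⟨_, ⟨h2, h1⟩, rfl⟩

theorem criticalPoint_neg_mem {N : ℕ} {γ : ℝ} (h : criticalPoint γ ∈ criticalZeros N) :
    criticalPoint (-γ) ∈ criticalZeros N := by
  rw [mem_criticalZeros] at *
  refine ⟨?_, rfl, by simpa [criticalPoint] using h.2.2⟩
  exact riemannZeta₁_conj_eq_zero (ρ := criticalPoint γ) (by norm_num [criticalPoint]) h.1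

theorem im_ne_zero_of_mem_criticalZeros {N : ℕ} {ρ : ℂ} (h : ρ ∈ criticalZeros N) : ρ.im ≠ 0 := by
  intro h0
  have h1 := (mem_criticalZeros.1 h).1
  rw [← criticalPoint_im_of_mem h, h0] at h1
  refine riemannZeta₁_real_ne_zero (x := 1 / 2) (by norm_num) (by norm_num) ?_
  convert h1 using 2
  apply Complex.ext <;> norm_num [criticalPoint]

theorem sum_criticalZeros {E : Type*} [AddCommMonoid E] (N : ℕ) (h : ℂ → E) :
    ∑ ρ ∈ criticalZeros N, h ρ =
      ∑ γ ∈ criticalOrdinates N, (h (criticalPoint γ) + h (criticalPoint (-γ))) := by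
  rw [Finset.sum_add_distrib, ← Finset.sum_filter_add_sum_filter_not _ fun ρ : ℂ ↦ 0 < ρ.im]
  congr 1
  · refine Finset.sum_nbij' Complex.im criticalPoint ?_ ?_ ?_ ?_ ?_
    · intro ρ hρ
      rw [Finset.mem_filter] at hρ
      exact mem_criticalOrdinates.2 ⟨hρ.2, by rw [criticalPoint_im_of_mem hρ.1]; exact hρ.1⟩
    · intro γ hγ
      rw [mem_criticalOrdinates] at hγ
      exact Finset.mem_filter.2 ⟨hγ.2, hγ.1⟩
    · intro ρ hρ
      exact criticalPoint_im_of_mem (Finset.mem_filter.1 hρ).1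
    · intro γ _
      rfl
    · intro ρ hρ
      rw [criticalPoint_im_of_mem (Finset.mem_filter.1 hρ).1]
  · refine Finset.sum_nbij' (fun ρ ↦ -ρ.im) (fun γ ↦ criticalPoint (-γ)) ?_ ?_ ?_ ?_ ?_
    · intro ρ hρ
      rw [Finset.mem_filter] at hρ
      refine mem_criticalOrdinates.2 ⟨?_, criticalPoint_neg_mem ?_⟩
      · exact neg_pos.2 (lt_of_le_of_ne (not_lt.1 hρ.2) (im_ne_zero_of_mem_criticalZeros hρ.1))
      · rw [criticalPoint_im_of_mem hρ.1]
        exact hρ.1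
    · intro γ hγ
      rw [mem_criticalOrdinates] at hγ
      refine Finset.mem_filter.2 ⟨criticalPoint_neg_mem hγ.2, ?_⟩
      simpa [criticalPoint] using hγ.1.le
    · intro ρ hρ
      rw [neg_neg]
      exact criticalPoint_im_of_mem (Finset.mem_filter.1 hρ).1
    · intro γ _
      simp [criticalPoint]
    · intro ρ hρ
      rw [neg_neg, criticalPoint_im_of_mem (Finset.mem_filter.1 hρ).1]

theorem criticalOrdinates_mono : Monotone criticalOrdinates := by
  intro M N hMN γ hγ
  rw [mem_criticalOrdinates, mem_criticalZeros] at *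
  exact ⟨hγ.1, hγ.2.1, hγ.2.2.1, hγ.2.2.2.trans (by exact_mod_cast hMN)⟩

theorem mem_zetaOrdinates_of_mem {N : ℕ} {γ : ℝ} (h : γ ∈ criticalOrdinates N) :
    γ ∈ zetaOrdinates := by
  rw [mem_criticalOrdinates, mem_criticalZeros] at h
  have h0 : 0 < (criticalPoint γ).re := by norm_num [criticalPoint]
  have h1 := (riemannZeta₁_eq_zero_iff h0).1 h.2.1
  exact ⟨h.1, criticalPoint γ, h1.1, h0, h1.2, rfl⟩

/-- The ordinates up to height `N`, as a finite set of elements of `zetaOrdinates`. -/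
noncomputable def ordinatesUpTo (N : ℕ) : Finset zetaOrdinates :=
  open scoped Classical in (criticalOrdinates N).subtype (· ∈ zetaOrdinates)

theorem sum_ordinatesUpTo {E : Type*} [AddCommMonoid E] (N : ℕ) (h : ℝ → E) :
    ∑ γ ∈ ordinatesUpTo N, h γ = ∑ γ ∈ criticalOrdinates N, h γ := by
  classical
  exact Finset.sum_subtype_of_mem h fun γ hγ ↦ mem_zetaOrdinates_of_mem hγ

theorem ordinatesUpTo_mono : Monotone ordinatesUpTo := by
  intro M N hMN γ hγ
  simp only [ordinatesUpTo, Finset.mem_subtype] at *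
  exact criticalOrdinates_mono hMN hγ

/-- The amplitude of the wave of frequency `γ` in the explicit formula. -/
noncomputable def ordinateAmplitude (γ : ℝ) : ℂ :=
  -((zetaOrder (criticalPoint γ) : ℂ) + zetaOrder (criticalPoint (-γ))) / criticalPoint γ

theorem norm_ordinateAmplitude (γ : ℝ) : ‖ordinateAmplitude γ‖ =
    zetaOrder (criticalPoint γ) / ‖criticalPoint γ‖ +
      zetaOrder (criticalPoint (-γ)) / ‖criticalPoint (-γ)‖ := by
  rw [ordinateAmplitude, norm_div, norm_neg, norm_criticalPoint_neg, ← add_div]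
  norm_cast

theorem re_zeroSum (N : ℕ) (u : ℝ) : (zeroSum (criticalZeros N) u).re =
    trigSum (fun γ : zetaOrdinates ↦ ordinateAmplitude γ) (ordinatesUpTo N)
      (torusFlow (fun γ : zetaOrdinates ↦ (γ : ℝ)) u) := by
  rw [trigSum_torusFlow, sum_ordinatesUpTo N
    fun γ ↦ (ordinateAmplitude γ * Complex.exp (γ * u * Complex.I)).re, zeroSum,
    sum_criticalZeros, Complex.neg_re, Complex.re_sum, ← Finset.sum_neg_distrib]
  refine Finset.sum_congr rfl fun γ _ ↦ ?_
  have hconj : starRingEnd ℂ ((zetaOrder (criticalPoint (-γ)) : ℂ) / criticalPoint (-γ) *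
      Complex.exp ((criticalPoint (-γ)).im * u * Complex.I)) =
      (zetaOrder (criticalPoint (-γ)) : ℂ) / criticalPoint γ *
        Complex.exp (γ * u * Complex.I) := by
    rw [map_mul, map_div₀, ← Complex.exp_conj]
    simp only [map_mul, Complex.conj_ofReal, Complex.conj_I, map_natCast]
    congr 2
    · apply Complex.ext <;> simp [criticalPoint]
    · simp [criticalPoint]
  rw [Complex.add_re, ← Complex.conj_re ((zetaOrder (criticalPoint (-γ)) : ℂ) / _ * _), hconj,
    ← Complex.add_re, ← Complex.neg_re]
  congr 1
  have him : (criticalPoint γ).im = γ := rfl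
  rw [ordinateAmplitude, him]
  ring

theorem tendsto_sum_norm_ordinateAmplitude
    (hRH : ∀ ρ : ℂ, riemannZeta₁ ρ = 0 → 0 < ρ.re → ρ.re = 1 / 2) :
    Tendsto (fun N ↦ ∑ γ ∈ ordinatesUpTo N, ‖ordinateAmplitude γ‖) atTop atTop := by
  have hmono : Monotone fun N ↦ ∑ γ ∈ ordinatesUpTo N, ‖ordinateAmplitude γ‖ := fun M N hMN ↦
    Finset.sum_le_sum_of_subset_of_nonneg (ordinatesUpTo_mono hMN) fun _ _ _ ↦ norm_nonneg _
  refine tendsto_atTop_atTop_of_monotone hmono fun K ↦ ?_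
  obtain ⟨Z, hZ, hK⟩ := exists_lt_sum_zetaOrder_div_norm K
  obtain ⟨N, hN⟩ := exists_nat_ge (∑ ρ ∈ Z, |ρ.im|)
  refine ⟨N, hK.le.trans ?_⟩
  rw [sum_ordinatesUpTo N fun γ ↦ ‖ordinateAmplitude γ‖]
  simp only [norm_ordinateAmplitude]
  rw [← sum_criticalZeros N fun ρ ↦ (zetaOrder ρ : ℝ) / ‖ρ‖]
  refine Finset.sum_le_sum_of_subset_of_nonneg (fun ρ hρ ↦ ?_) fun _ _ _ ↦ by positivity
  refine mem_criticalZeros.2 ⟨(hZ ρ hρ).1, hRH ρ (hZ ρ hρ).1 (hZ ρ hρ).2, le_trans ?_ hN⟩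
  exact Finset.single_le_sum (f := fun ρ : ℂ ↦ |ρ.im|) (fun _ _ ↦ abs_nonneg _) hρ

theorem integrableOn_primeError
    (hRH : ∀ ρ : ℂ, riemannZeta₁ ρ = 0 → 0 < ρ.re → ρ.re = 1 / 2) (U : ℝ) :
    IntegrableOn primeError (Set.Ioc 0 U) := by
  have h1 := (tendsto_average_abs_primeError_sub hRH).1 U
  have h2 : IntegrableOn (fun u ↦ primeError u - (psiError u - 1)) (Set.Ioc 0 U) :=
    (integrable_norm_iff ((measurable_primeError.sub
      (measurable_psiError.sub_const 1)).aestronglyMeasurable)).1 h1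
  have h3 : IntegrableOn (fun u ↦ psiError u - 1) (Set.Ioc 0 U) :=
    (integrableOn_psiError U).sub (integrableOn_const (by simp))
  refine (h2.add h3).congr (Eventually.of_forall fun u ↦ ?_)
  simp

theorem exists_average_primeError_sub_trigSum_le
    (hRH : ∀ ρ : ℂ, riemannZeta₁ ρ = 0 → 0 < ρ.re → ρ.re = 1 / 2) {η : ℝ} (hη : 0 < η) :
    ∃ N₀, ∀ N ≥ N₀, ∀ᶠ U : ℝ in atTop,
      U⁻¹ * ∫ u in Set.Ioc 0 U, |primeError u + 1 -
        trigSum (fun γ : zetaOrdinates ↦ ordinateAmplitude γ) (ordinatesUpTo N)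
          (torusFlow (fun γ : zetaOrdinates ↦ (γ : ℝ)) u)| ≤ η := by
  obtain ⟨τ, hτ0, hτ⟩ := exists_psiError_mean_square_bound hRH
  obtain ⟨hFi, hF⟩ := tendsto_average_abs_primeError_sub hRH
  obtain ⟨N₀, hN₀⟩ := eventually_atTop.1 (hτ0.eventually_le_const (u := η ^ 2 / 8) (by positivity))
  refine ⟨N₀, fun N hN ↦ ?_⟩
  obtain ⟨K, hK⟩ := hτ N
  have hKU : Tendsto (fun U : ℝ ↦ K / U) atTop (nhds 0) := tendsto_const_nhds.div_atTop tendsto_id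
  filter_upwards [eventually_ge_atTop 1, hKU.eventually_le_const (u := η ^ 2 / 8) (by positivity),
    hF.eventually_le_const (u := η / 4) (by positivity)] with U hU hKU hFU
  have hU0 : 0 < U := by linarith
  have hinteg := integrableOn_sq_norm_psiError_sub_zeroSum (criticalZeros N) U
  set R : ℝ → ℝ := fun u ↦ ‖(psiError u : ℂ) - zeroSum (criticalZeros N) u‖ ^ 2 with hR
  set G : ℝ → ℝ := fun u ↦ |primeError u - (psiError u - 1)| with hG
  have hconst : IntegrableOn (fun _ ↦ η / 4) (Set.Ioc 0 U) := integrableOn_const (by simp)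
  have hRη : IntegrableOn (fun u ↦ η⁻¹ * R u) (Set.Ioc 0 U) := hinteg.const_mul _
  have hle : ∫ u in Set.Ioc 0 U, |primeError u + 1 -
        trigSum (fun γ : zetaOrdinates ↦ ordinateAmplitude γ) (ordinatesUpTo N)
          (torusFlow (fun γ : zetaOrdinates ↦ (γ : ℝ)) u)| ≤
      ∫ u in Set.Ioc 0 U, (G u + (η / 4 + η⁻¹ * R u)) := by
    refine integral_mono_of_nonneg (Eventually.of_forall fun u ↦ abs_nonneg _)
      ((hFi U).add (hconst.add hRη)) (Eventually.of_forall fun u ↦ ?_)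
    simp only
    rw [← re_zeroSum]
    have h1 := Complex.abs_re_le_norm ((psiError u : ℂ) - zeroSum (criticalZeros N) u)
    rw [Complex.sub_re, Complex.ofReal_re] at h1
    have h2 : primeError u + 1 - (zeroSum (criticalZeros N) u).re =
      (primeError u - (psiError u - 1)) + (psiError u - (zeroSum (criticalZeros N) u).re) := by ring
    rw [h2]
    refine (abs_add_le _ _).trans (add_le_add le_rfl (h1.trans ?_))
    rw [hR]
    set z := ‖(psiError u : ℂ) - zeroSum (criticalZeros N) u‖
    have h3 : η / 4 + η⁻¹ * z ^ 2 - z = η⁻¹ * (z - η / 2) ^ 2 := by field_simp; ring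
    have h4 : 0 ≤ η⁻¹ * (z - η / 2) ^ 2 := by positivity
    simp only
    linarith
  have hsplit : ∫ u in Set.Ioc 0 U, (G u + (η / 4 + η⁻¹ * R u)) =
      (∫ u in Set.Ioc 0 U, G u) + (U * (η / 4) + η⁻¹ * ∫ u in Set.Ioc 0 U, R u) := by
    rw [integral_add (f := G) (g := fun u ↦ η / 4 + η⁻¹ * R u) (hFi U) (hconst.add hRη),
      integral_add (f := fun _ ↦ η / 4) (g := fun u ↦ η⁻¹ * R u) hconst hRη,
      integral_const_mul, setIntegral_const, Real.volume_real_Ioc_of_le hU0.le, smul_eq_mul,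
      sub_zero]
  have hRU := hK U hU
  rw [one_div] at hRU hFU
  calc _ ≤ U⁻¹ * ∫ u in Set.Ioc 0 U, (G u + (η / 4 + η⁻¹ * R u)) :=
        mul_le_mul_of_nonneg_left hle (by positivity)
    _ = U⁻¹ * (∫ u in Set.Ioc 0 U, G u) + η / 4 + η⁻¹ * (U⁻¹ * ∫ u in Set.Ioc 0 U, R u) := by
        rw [hsplit]; field_simp; ring
    _ ≤ η / 4 + η / 4 + η⁻¹ * (η ^ 2 / 8 + η ^ 2 / 8) := by
        refine add_le_add (add_le_add hFU le_rfl) (mul_le_mul_of_nonneg_left ?_ (by positivity))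
        exact hRU.trans (add_le_add hKU (hN₀ N hN))
    _ ≤ η := by
        have : η⁻¹ * (η ^ 2 / 8 + η ^ 2 / 8) = η / 4 := by field_simp; ring
        linarith

theorem primeError_pos_iff {u : ℝ} :
    0 < primeError u ↔ Real.log 2 ≤ u ∧ Li (Real.exp u) < primePi (Real.exp u) := by
  unfold primeError
  split_ifs with h
  · have hu : 0 < u := (Real.log_pos one_lt_two).trans_le h
    rw [mul_pos_iff_of_pos_left (by positivity), sub_pos]
    simp [h]
  · simp [h]

theorem setIntegral_one_div_primePi_gt_Li {X : ℝ} (hX : 0 < X) :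
    ∫ t in {t : ℝ | 2 ≤ t ∧ t ≤ X ∧ (primePi t : ℝ) > Li t}, 1 / t =
      ∫ u in Set.Ioc 0 (Real.log X), {u | 0 < primeError u}.indicator 1 u := by
  have hl2 : 0 < Real.log 2 := Real.log_pos one_lt_two
  have hE : MeasurableSet {u | 0 < primeError u} :=
    measurableSet_lt measurable_const measurable_primeError
  have himage : {t : ℝ | 2 ≤ t ∧ t ≤ X ∧ (primePi t : ℝ) > Li t} =
      Real.exp '' (Set.Ioc 0 (Real.log X) ∩ {u | 0 < primeError u}) := by
    ext t
    simp only [Set.mem_ofPred_eq, Set.mem_image, Set.mem_inter_iff, Set.mem_Ioc, primeError_pos_iff]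
    constructor
    · rintro ⟨h2, hX, h⟩
      have ht : 0 < t := by linarith
      have hlog := Real.log_le_log two_pos h2
      refine ⟨Real.log t, ⟨⟨hl2.trans_le hlog, Real.log_le_log ht hX⟩, hlog, ?_⟩, Real.exp_log ht⟩
      rwa [Real.exp_log ht]
    · rintro ⟨u, ⟨⟨_, huX⟩, hu2, h⟩, rfl⟩
      exact ⟨(Real.log_le_iff_le_exp two_pos).1 hu2, (Real.le_log_iff_exp_le hX).1 huX, h⟩
  rw [himage, integral_image_eq_integral_abs_deriv_smul (measurableSet_Ioc.inter hE)
    (fun u _ ↦ (Real.hasDerivAt_exp u).hasDerivWithinAt) Real.exp_injective.injOn,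
    setIntegral_indicator hE]
  refine setIntegral_congr_fun (measurableSet_Ioc.inter hE) fun u _ ↦ ?_
  simp

/-- Assuming RH and the linear independence of the ordinates of `ζ` over `ℚ`, the
logarithmic density `δ` of the set of `x` with `π(x) > Li(x)` exists and satisfies
`0 < δ < 1/2` (Rubinstein–Sarnak). -/
theorem logDensity_primePi_gt_Li
    (RH : ∀ ρ : ℂ, riemannZeta ρ = 0 → 0 < ρ.re → ρ.re < 1 → ρ.re = 1 / 2)
    (LI : LinearIndependent ℚ (fun t : zetaOrdinates => (t : ℝ))) :
    ∃ δ : ℝ,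
      Tendsto (fun X : ℝ =>
          (1 / Real.log X) * ∫ t in {t : ℝ | 2 ≤ t ∧ t ≤ X ∧ (primePi t : ℝ) > Li t}, 1 / t)
        atTop (nhds δ) ∧ 0 < δ ∧ δ < 1 / 2 := by
  have hRH : ∀ ρ : ℂ, riemannZeta₁ ρ = 0 → 0 < ρ.re → ρ.re = 1 / 2 := fun ρ h0 hre ↦
    have h := (riemannZeta₁_eq_zero_iff hre).1 h0
    RH ρ h.1 hre h.2
  obtain ⟨δ, hδ, hpos, hlt⟩ := exists_tendsto_average_indicator_pos LI
    (fun _ _ h ↦ ordinatesUpTo_mono h) (tendsto_sum_norm_ordinateAmplitude hRH)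
    measurable_primeError (integrableOn_primeError hRH)
    fun η hη ↦ exists_average_primeError_sub_trigSum_le hRH hη
  refine ⟨δ, (hδ.comp Real.tendsto_log_atTop).congr' ?_, hpos, hlt⟩
  filter_upwards [eventually_gt_atTop 0] with X hX
  rw [setIntegral_one_div_primePi_gt_Li hX, one_div, Function.comp_apply]
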